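/- Let p be an odd prime and let F be a number field containing a primitive p²-th root of unity. Then every continuous homomorphism Gal(F_s/F) → GL_3(𝔽_p) admits a lift to a continuous homomorphism Gal(F_s/F) → GL_3(ℤ/p²) along the reduction ℤ/p² → ℤ/p. -/

import Mathlib

open scoped MatrixGroups

/-- The absolute Galois group `Gal(F_s/F)`, with its Krull topology. -/
abbrev AbsGal (F : Type) [Field F] : Type :=
  SeparableClosure F ≃ₐ[F] SeparableClosure F

set_option linter.unusedSectionVars false

section

open WithZero

section Local

variable {K : Type*} [Field K] (v : Valuation K ℤᵐ⁰)

/-- The additive order attached to a `ℤᵐ⁰`-valued valuation (junk value `0` at `0`). -/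
noncomputable def vord (x : K) : ℤ := -(log (v x))

/-- The elements of order at least `n`. -/
def filt (n : ℤ) : AddSubgroup K where
  carrier := {x | v x ≤ exp (-n)}
  zero_mem' := by simp
  add_mem' {x y} hx hy := (v.map_add x y).trans (max_le hx hy)
  neg_mem' {x} hx := by simpa [Valuation.map_neg] using hx

variable {v}

theorem mem_filt_def {n : ℤ} {x : K} : x ∈ filt v n ↔ v x ≤ exp (-n) := Iff.rfl

theorem valuation_eq_exp_vord {x : K} (hx : x ≠ 0) : v x = exp (-(vord v x)) := by
  simp only [vord, neg_neg]
  rw [exp_log]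
  simpa using hx

theorem mem_filt_iff {n : ℤ} {x : K} (hx : x ≠ 0) : x ∈ filt v n ↔ n ≤ vord v x := by
  rw [mem_filt_def, valuation_eq_exp_vord hx, exp_le_exp]
  omega

theorem vord_mul {x y : K} (hx : x ≠ 0) (hy : y ≠ 0) : vord v (x * y) = vord v x + vord v y := by
  simp only [vord, map_mul]
  rw [log_mul (by simpa using hx) (by simpa using hy)]
  ring

@[simp] theorem vord_one : vord v (1 : K) = 0 := by simp [vord]

@[simp] theorem vord_inv (x : K) : vord v x⁻¹ = - vord v x := by simp [vord, log_inv]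

@[simp] theorem vord_pow (x : K) (n : ℕ) : vord v (x ^ n) = n * vord v x := by
  simp [vord, log_pow]

@[simp] theorem vord_zpow (x : K) (n : ℤ) : vord v (x ^ n) = n * vord v x := by
  simp [vord, log_zpow]

theorem vord_div {x y : K} (hx : x ≠ 0) (hy : y ≠ 0) : vord v (x / y) = vord v x - vord v y := by
  rw [div_eq_mul_inv, vord_mul hx (inv_ne_zero hy), vord_inv]; ring

theorem vord_prod {ι : Type*} (s : Finset ι) (f : ι → K) (hf : ∀ i ∈ s, f i ≠ 0) :
    vord v (∏ i ∈ s, f i) = ∑ i ∈ s, vord v (f i) := by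
  classical
  induction s using Finset.induction_on with
  | empty => simp
  | insert a s ha ih =>
    rw [Finset.prod_insert ha, Finset.sum_insert ha, vord_mul, ih]
    · exact fun i hi => hf i (Finset.mem_insert_of_mem hi)
    · exact hf a (Finset.mem_insert_self _ _)
    · exact Finset.prod_ne_zero_iff.2 fun i hi => hf i (Finset.mem_insert_of_mem hi)

theorem valuation_eq_one_iff {x : K} (hx : x ≠ 0) : v x = 1 ↔ vord v x = 0 := by
  rw [valuation_eq_exp_vord hx, exp_eq_one]; omega

theorem filt_mono {m n : ℤ} (h : m ≤ n) : filt v n ≤ filt v m := fun x hx =>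
  le_trans hx (exp_le_exp.2 (by omega))

theorem filt_mul {m n : ℤ} {x y : K} (hx : x ∈ filt v m) (hy : y ∈ filt v n) :
    x * y ∈ filt v (m + n) := by
  rcases eq_or_ne x 0 with rfl | hx0
  · simp
  rcases eq_or_ne y 0 with rfl | hy0
  · simp
  rw [mem_filt_iff hx0] at hx
  rw [mem_filt_iff hy0] at hy
  rw [mem_filt_iff (mul_ne_zero hx0 hy0), vord_mul hx0 hy0]
  omega

theorem mem_filt_vord (x : K) : x ∈ filt v (vord v x) := by
  rcases eq_or_ne x 0 with rfl | hx0
  · simp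
  rw [mem_filt_iff hx0]

theorem one_mem_filt : (1 : K) ∈ filt v 0 := by simp [mem_filt_def]

theorem filt_pow {m : ℤ} {x : K} (hx : x ∈ filt v m) (n : ℕ) : x ^ n ∈ filt v (n * m) := by
  induction n with
  | zero => simpa using one_mem_filt
  | succ n ih =>
    have := filt_mul ih hx
    rw [pow_succ]; convert this using 2; push_cast; ring

theorem natCast_mem_filt (n : ℕ) : (n : K) ∈ filt v 0 := by
  induction n with
  | zero => simp
  | succ n ih => push_cast; exact add_mem ih one_mem_filt

theorem intCast_mem_filt (n : ℤ) : (n : K) ∈ filt v 0 := by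
  cases n with
  | ofNat n => simpa using natCast_mem_filt n
  | negSucc n =>
    have := natCast_mem_filt (v := v) (n + 1)
    rw [Int.cast_negSucc]; exact neg_mem this

theorem filt_prod {ι : Type*} (s : Finset ι) (f : ι → K) (hf : ∀ i ∈ s, f i ∈ filt v 0) :
    ∏ i ∈ s, f i ∈ filt v 0 := by
  classical
  induction s using Finset.induction_on with
  | empty => simpa using one_mem_filt
  | insert a s ha ih =>
    rw [Finset.prod_insert ha]
    simpa using filt_mul (hf a (Finset.mem_insert_self _ _))
      (ih fun i hi => hf i (Finset.mem_insert_of_mem hi))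

/-- If `y` is closer to `x` than `x` is to zero then both have the same order. -/
theorem vord_eq_of_sub_mem {x y : K} (hx : x ≠ 0) (h : y - x ∈ filt v (vord v x + 1)) :
    y ≠ 0 ∧ vord v y = vord v x := by
  have hy0 : y ≠ 0 := by
    rintro rfl
    have : x ∈ filt v (vord v x + 1) := by simpa using neg_mem h
    rw [mem_filt_iff hx] at this
    omega
  refine ⟨hy0, le_antisymm ?_ ?_⟩
  · by_contra hlt
    push Not at hlt
    have hy : y ∈ filt v (vord v x + 1) := by rw [mem_filt_iff hy0]; omega
    have : x ∈ filt v (vord v x + 1) := by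
      have := sub_mem hy h
      simpa using this
    rw [mem_filt_iff hx] at this
    omega
  · rw [← mem_filt_iff hy0]
    have := add_mem (filt_mono (by omega) h) (mem_filt_vord (v := v) x)
    simpa using this

variable (v)

/-- The principal units of level `n` (all units for `n = 0`). -/
def punit (n : ℕ) : Subgroup Kˣ where
  carrier := {x | vord v (x : K) = 0 ∧ (x : K) - 1 ∈ filt v n}
  one_mem' := by simp
  mul_mem' {x y} hx hy := by
    refine ⟨by simp [vord_mul, hx.1, hy.1], ?_⟩
    have h1 : ((x : K) - 1) * y ∈ filt v n := by
      have := filt_mul hx.2 (mem_filt_vord (v := v) (y : K))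
      rwa [hy.1, add_zero] at this
    have := add_mem h1 hy.2
    convert this using 1; push_cast; ring
  inv_mem' {x} hx := by
    refine ⟨by simp [hx.1], ?_⟩
    have := filt_mul (neg_mem hx.2) (mem_filt_vord (v := v) (x : K)⁻¹)
    rw [vord_inv, hx.1, neg_zero, add_zero] at this
    convert this using 1
    push_cast
    field_simp
    ring

variable {v}

theorem mem_punit {n : ℕ} {x : Kˣ} :
    x ∈ punit v n ↔ vord v (x : K) = 0 ∧ (x : K) - 1 ∈ filt v n := Iff.rfl

theorem mem_punit_zero {x : Kˣ} : x ∈ punit v 0 ↔ vord v (x : K) = 0 := by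
  rw [mem_punit, and_iff_left_iff_imp]
  intro h
  refine sub_mem ?_ one_mem_filt
  rw [Nat.cast_zero, mem_filt_iff x.ne_zero, h]

theorem mem_punit_iff {n : ℕ} (hn : n ≠ 0) {x : Kˣ} :
    x ∈ punit v n ↔ (x : K) - 1 ∈ filt v n := by
  rw [mem_punit, and_iff_right_iff_imp]
  intro h
  have := (vord_eq_of_sub_mem (v := v) (x := 1) (y := x) one_ne_zero
    (by rw [vord_one]; exact filt_mono (by omega) h)).2
  rwa [vord_one] at this

theorem punit_anti {m n : ℕ} (h : m ≤ n) : punit v n ≤ punit v m := fun _ hx =>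
  ⟨hx.1, filt_mono (by exact_mod_cast h) hx.2⟩

/-- `x / y` is a principal unit of level `n` as soon as `x` is close to `y`. -/
theorem div_mem_punit {n : ℕ} (hn : n ≠ 0) {x y : Kˣ}
    (h : (x : K) - y ∈ filt v (n + vord v (y : K))) : x * y⁻¹ ∈ punit v n := by
  rw [mem_punit_iff hn]
  have := filt_mul h (mem_filt_vord (v := v) (y : K)⁻¹)
  rw [vord_inv] at this
  convert this using 1
  · congr 1; ring
  · push_cast
    rw [sub_mul, mul_inv_cancel₀ y.ne_zero]

variable (v) in
/-- The closure of a subgroup for the topology given by `v`. -/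
def clos (H : Subgroup Kˣ) : Subgroup Kˣ := ⨅ n : ℕ, H ⊔ punit v n

theorem le_clos (H : Subgroup Kˣ) : H ≤ clos v H := le_iInf fun _ => le_sup_left

theorem clos_le (H : Subgroup Kˣ) (n : ℕ) : clos v H ≤ H ⊔ punit v n := iInf_le _ n

theorem clos_mono {H H' : Subgroup Kˣ} (h : H ≤ H') : clos v H ≤ clos v H' :=
  iInf_mono fun _ => sup_le_sup_right h _

theorem mem_clos {H : Subgroup Kˣ} {x : Kˣ} :
    x ∈ clos v H ↔ ∀ n : ℕ, ∃ h ∈ H, x * h⁻¹ ∈ punit v n := by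
  simp only [clos, Subgroup.mem_iInf]
  refine forall_congr' fun n => ?_
  rw [Subgroup.mem_sup]
  constructor
  · rintro ⟨y, hy, z, hz, rfl⟩
    exact ⟨y, hy, by simpa [mul_comm, mul_left_comm] using hz⟩
  · rintro ⟨y, hy, hz⟩
    exact ⟨y, hy, _, hz, by rw [mul_comm x, mul_inv_cancel_left]⟩

/-- The subgroup of `p`-th powers. -/
abbrev pows (p : ℕ) (K : Type*) [Field K] : Subgroup Kˣ := (powMonoidHom p : Kˣ →* Kˣ).range

theorem mem_pows {p : ℕ} {x : Kˣ} : x ∈ pows p K ↔ ∃ y : Kˣ, y ^ p = x := by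
  simp [pows, MonoidHom.mem_range]

section Open

variable {p : ℕ} [Fact p.Prime]

/-- One Newton step. -/
theorem newton_step (hp0 : (p : K) ≠ 0) {n : ℕ} (hn : 2 * vord v (p : K) < n)
    {x : Kˣ} (hx : x ∈ punit v n) : x ∈ pows p K ⊔ punit v (n + 1) := by
  have hvp : 0 ≤ vord v (p : K) := by
    rw [← mem_filt_iff hp0]; exact natCast_mem_filt p
  have hp2 : 2 ≤ p := (Fact.out : p.Prime).two_le
  set z : K := x - 1 with hz
  have hzf : z ∈ filt v n := hx.2
  set w : K := z / p with hw
  have hwf : w ∈ filt v (n - vord v (p : K)) := by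
    have := filt_mul hzf (mem_filt_vord (v := v) (p : K)⁻¹)
    rw [vord_inv] at this
    simpa [hw, div_eq_mul_inv, sub_eq_add_neg] using this
  obtain ⟨hy0, hyo⟩ := vord_eq_of_sub_mem (v := v) (x := 1) (y := 1 + w) one_ne_zero
    (by rw [vord_one, add_sub_cancel_left]; exact filt_mono (by omega) hwf)
  rw [vord_one] at hyo
  set y : Kˣ := Units.mk0 (1 + w) hy0 with hy
  have key : (1 + w) ^ p - (1 + z) ∈ filt v (n + 1) := by
    have hexp : (1 + w) ^ p - (1 + z) =
        ∑ k ∈ Finset.range (p - 1), w ^ (k + 2) * (p.choose (k + 2) : K) := by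
      obtain ⟨m, rfl⟩ : ∃ m, p = m + 2 := ⟨p - 2, by omega⟩
      rw [add_comm 1 w, add_pow, Finset.sum_range_succ', Finset.sum_range_succ']
      have hpw : ((m + 2 : ℕ) : K) * w = z := by
        rw [hw]; field_simp
      simp only [one_pow, mul_one, pow_zero, zero_add, pow_one, Nat.choose_zero_right,
        Nat.choose_one_right, Nat.cast_one]
      rw [mul_comm w, hpw]
      simp only [add_assoc]
      norm_num
      ring_nf
    rw [hexp]
    refine sum_mem fun k _ => ?_
    have h1 := filt_mul (filt_pow hwf (k + 2)) (natCast_mem_filt (v := v) (p.choose (k + 2)))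
    refine filt_mono ?_ h1
    have : (n : ℤ) + 1 ≤ 2 * (n - vord v (p : K)) := by omega
    have h0 : 0 ≤ (n : ℤ) - vord v (p : K) := by omega
    push_cast
    nlinarith
  rw [Subgroup.mem_sup]
  refine ⟨y ^ p, ⟨y, rfl⟩, x * (y ^ p)⁻¹, ?_, by rw [mul_comm x, mul_inv_cancel_left]⟩
  apply div_mem_punit (by omega)
  have h2 : vord v ((y ^ p : Kˣ) : K) = 0 := by
    push_cast; rw [vord_pow]; simp [hy, hyo]
  rw [h2, add_zero, Nat.cast_add, Nat.cast_one]
  have := neg_mem key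
  convert this using 1
  rw [hz]; push_cast; simp [hy]

/-- Sufficiently principal units are limits of `p`-th powers. -/
theorem punit_le_clos_pows (hp0 : (p : K) ≠ 0) {n : ℕ} (hn : 2 * vord v (p : K) < n) :
    punit v n ≤ clos v (pows p K) := by
  have key : ∀ m : ℕ, punit v n ≤ pows p K ⊔ punit v (n + m) := by
    intro m
    induction m with
    | zero => exact le_sup_right
    | succ m ih =>
      refine ih.trans (sup_le le_sup_left ?_)
      intro x hx
      exact newton_step hp0 (hn.trans_le (by exact_mod_cast Nat.le_add_right n m)) hx
  refine le_iInf fun m => (key m).trans (sup_le_sup_left (punit_anti (by omega)) _)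

end Open

end Local

end

section

open WithZero

section Groups

variable {G : Type*} [CommGroup G]

theorem relIndex_sup_eq (H K : Subgroup G) : K.relIndex (H ⊔ K) = K.relIndex H :=
  Subgroup.relIndex_sup_right H K

/-- Kernel and cokernel of an endomorphism of a finite quotient have the same size. -/
theorem relIndex_map_sup_eq (f : G →* G) {A B : Subgroup G} (hAB : A ≤ B) (hfA : A.map f ≤ A)
    (hfB : B.map f ≤ B) (hfin : A.relIndex B ≠ 0) :
    (B.map f ⊔ A).relIndex B = A.relIndex (A.comap f ⊓ B) := by
  have h1 : A.relIndex (B.map f ⊔ A) = (A.comap f ⊓ B).relIndex B := by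
    rw [relIndex_sup_eq, Subgroup.inf_relIndex_right, Subgroup.relIndex_comap]
  have h2 := Subgroup.relIndex_mul_relIndex A (B.map f ⊔ A) B le_sup_right (sup_le hfB hAB)
  have h3 := Subgroup.relIndex_mul_relIndex A (A.comap f ⊓ B) B
    (le_inf (Subgroup.map_le_iff_le_comap.1 hfA) hAB) inf_le_right
  rw [h1] at h2
  rw [← h3] at h2
  have hne : (A.comap f ⊓ B).relIndex B ≠ 0 := by
    intro h0
    rw [h0, mul_zero] at h3
    exact hfin h3.symm
  rw [mul_comm] at h2
  exact Nat.eq_of_mul_eq_mul_right (Nat.pos_of_ne_zero hne) h2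

end Groups

section Counting

variable {K : Type*} [Field K] {v : Valuation K ℤᵐ⁰}

variable (v) in
/-- The cardinality of the residue field. -/
noncomputable def qres : ℕ := (filt v 1).relIndex (filt v 0)

/-- Multiplication by a fixed nonzero element as an additive map. -/
theorem filt_map_mulLeft {a : K} (ha : a ≠ 0) (m : ℤ) :
    (filt v m).map (AddMonoidHom.mulLeft a) = filt v (vord v a + m) := by
  ext x
  simp only [AddSubgroup.mem_map, AddMonoidHom.coe_mulLeft]
  constructor
  · rintro ⟨y, hy, rfl⟩
    exact filt_mul (mem_filt_vord a) hy
  · intro hx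
    refine ⟨a⁻¹ * x, ?_, by rw [mul_inv_cancel_left₀ ha]⟩
    have := filt_mul (mem_filt_vord (v := v) a⁻¹) hx
    rwa [vord_inv, neg_add_cancel_left] at this

theorem relIndex_filt {π : K} (hπ : vord v π = 1) (m : ℤ) :
    (filt v (m + 1)).relIndex (filt v m) = qres v := by
  have hπ0 : π ≠ 0 := by rintro rfl; simp [vord] at hπ
  have h := AddSubgroup.relIndex_map_map_of_injective (f := AddMonoidHom.mulLeft (π ^ m))
    (filt v 1) (filt v 0) (fun x y h => mul_left_cancel₀ (zpow_ne_zero m hπ0) h)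
  rw [filt_map_mulLeft (zpow_ne_zero m hπ0), filt_map_mulLeft (zpow_ne_zero m hπ0), vord_zpow, hπ]
    at h
  simpa [qres] using h

/-- The map `x ↦ x - 1` from `punit v n` to `filt v n / filt v (n + 1)`. -/
def punitHom (v : Valuation K ℤᵐ⁰) (n : ℕ) (hn : n ≠ 0) :
    punit v n →* Multiplicative (K ⧸ filt v (n + 1)) where
  toFun x := Multiplicative.ofAdd (QuotientAddGroup.mk ((x : Kˣ) - 1 : K))
  map_one' := by simp
  map_mul' x y := by
    rw [← ofAdd_add, ← QuotientAddGroup.mk_add]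
    congr 1
    rw [QuotientAddGroup.eq]
    have h := filt_mono (m := (n : ℤ) + 1) (by omega) (neg_mem (filt_mul x.2.2 y.2.2))
    convert h using 1
    rw [Subgroup.coe_mul, Units.val_mul]
    ring

theorem relIndex_punit {π : K} (hπ : vord v π = 1) {n : ℕ} (hn : n ≠ 0) :
    (punit v (n + 1)).relIndex (punit v n) = qres v := by
  have hker : (punitHom v n hn).ker = (punit v (n + 1)).subgroupOf (punit v n) := by
    ext x
    rw [MonoidHom.mem_ker, Subgroup.mem_subgroupOf, mem_punit_iff (by omega)]
    change Multiplicative.ofAdd _ = Multiplicative.ofAdd 0 ↔ _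
    rw [Multiplicative.ofAdd.injective.eq_iff, QuotientAddGroup.eq_zero_iff]
    push_cast
    rfl
  rw [Subgroup.relIndex, ← hker, Subgroup.index_ker, ← relIndex_filt hπ n, AddSubgroup.relIndex,
    AddSubgroup.index]
  have e1 : Nat.card (punitHom v n hn).range =
      Nat.card ((filt v n).map (QuotientAddGroup.mk' (filt v (n + 1)))) := by
    refine Nat.card_congr (Equiv.subtypeEquiv Multiplicative.toAdd fun a => ?_)
    constructor
    · rintro ⟨x, rfl⟩
      exact ⟨_, x.2.2, rfl⟩
    · rintro ⟨y, hy, h⟩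
      obtain ⟨hy0, hyo⟩ := vord_eq_of_sub_mem (v := v) (x := 1) (y := 1 + y) one_ne_zero
        (by rw [vord_one, add_sub_cancel_left]; exact filt_mono (by omega) hy)
      refine ⟨⟨Units.mk0 (1 + y) hy0, by simpa using hyo, by simpa using hy⟩, ?_⟩
      apply Multiplicative.toAdd.injective
      rw [← h]
      simp [punitHom]
  rw [e1, ← AddSubgroup.relIndex_ker, QuotientAddGroup.ker_mk']
  rfl

theorem relIndex_punit_pow {π : K} (hπ : vord v π = 1) {n : ℕ} (hn : n ≠ 0) (k : ℕ) :
    (punit v (n + k)).relIndex (punit v n) = qres v ^ k := by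
  induction k with
  | zero => simp
  | succ k ih =>
    rw [pow_succ, ← ih, ← relIndex_punit hπ (n := n + k) (by omega), mul_comm,
      Subgroup.relIndex_mul_relIndex _ _ _ (punit_anti (by omega)) (punit_anti (by omega))]
    rfl

theorem relIndex_punit_one_ne_zero (hq : qres v ≠ 0) :
    (punit v 1).relIndex (punit v 0) ≠ 0 := by
  have hfin : Finite (filt v 0 ⧸ (filt v 1).addSubgroupOf (filt v 0)) :=
    by
    have : ((filt v 1).addSubgroupOf (filt v 0)).FiniteIndex := ⟨hq⟩
    infer_instance
  let f : punit v 0 → filt v 0 ⧸ (filt v 1).addSubgroupOf (filt v 0) := fun x =>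
    QuotientAddGroup.mk ⟨((x : Kˣ) : K), by
      rw [mem_filt_iff (Units.ne_zero _)]; exact x.2.1.ge⟩
  let g : punit v 0 ⧸ (punit v 1).subgroupOf (punit v 0) →
      filt v 0 ⧸ (filt v 1).addSubgroupOf (filt v 0) := fun x => f x.out
  have hg : Function.Injective g := by
    intro x y hxy
    have h1 : f x.out = f y.out := hxy
    rw [← Quotient.out_eq' x, ← Quotient.out_eq' y]
    refine QuotientGroup.eq.2 ?_
    simp only [f] at h1
    rw [QuotientAddGroup.eq, AddSubgroup.mem_addSubgroupOf] at h1
    rw [Subgroup.mem_subgroupOf, Subgroup.coe_mul, mul_comm]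
    refine div_mem_punit one_ne_zero ?_
    rw [x.out.2.1]
    convert h1 using 1
    · simp
    · rw [AddSubgroup.coe_add, AddSubgroup.coe_neg]
      ring
  have := Finite.of_injective g hg
  exact Subgroup.index_ne_zero_of_finite

theorem relIndex_punit_zero_ne_zero (hq : qres v ≠ 0) {π : K} (hπ : vord v π = 1) (n : ℕ) :
    (punit v n).relIndex (punit v 0) ≠ 0 := by
  rcases Nat.eq_zero_or_pos n with rfl | hn
  · simp
  refine Subgroup.relIndex_ne_zero_trans (K := punit v 1) ?_ (relIndex_punit_one_ne_zero hq)
  obtain ⟨k, rfl⟩ : ∃ k, n = 1 + k := ⟨n - 1, by omega⟩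
  rw [relIndex_punit_pow hπ one_ne_zero]
  exact pow_ne_zero _ hq

variable {p : ℕ} [hp : Fact p.Prime] {ζ : K}

theorem pow_sub_one_eq_mul_prod (hζ : IsPrimitiveRoot ζ p) (x : K) :
    x ^ p - 1 = (x - 1) * ∏ k ∈ Finset.range (p - 1), (x - ζ ^ (k + 1)) := by
  have h := hζ.pow_sub_pow_eq_prod_sub_mul x 1 hp.out.pos
  rw [one_pow] at h
  rw [h]
  have h2 : ∏ k ∈ Finset.range p, (x - ζ ^ k) =
      ∏ ζ ∈ Polynomial.nthRootsFinset p (1 : K), (x - ζ * 1) := by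
    refine Finset.prod_nbij (fun k => ζ ^ k) ?_ ?_ ?_ ?_
    · intro k _
      rw [Polynomial.mem_nthRootsFinset hp.out.pos, ← pow_mul, mul_comm, pow_mul, hζ.pow_eq_one,
        one_pow]
    · intro i hi j hj hij
      exact hζ.pow_inj (by simpa using hi) (by simpa using hj) hij
    · intro y hy
      obtain ⟨i, hi, rfl⟩ := hζ.eq_pow_of_pow_eq_one
        ((Polynomial.mem_nthRootsFinset hp.out.pos _).1 hy)
      exact ⟨i, by simpa using hi, rfl⟩
    · simp
  rw [← h2]
  obtain ⟨m, hm⟩ : ∃ m, p = m + 1 := ⟨p - 1, by have := hp.out.pos; omega⟩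
  rw [hm, Finset.prod_range_succ', pow_zero, mul_comm]
  rfl

theorem prod_one_sub_pow (hζ : IsPrimitiveRoot ζ p) :
    ∏ k ∈ Finset.range (p - 1), (1 - ζ ^ (k + 1)) = (p : K) := by
  obtain ⟨m, hm⟩ : ∃ m, p = m + 1 := ⟨p - 1, by have := hp.out.pos; omega⟩
  rw [hm] at hζ ⊢
  rw [Nat.add_sub_cancel, hζ.prod_one_sub_pow_eq_order]
  push_cast; rfl

theorem vord_of_isPrimitiveRoot (hζ : IsPrimitiveRoot ζ p) : vord v ζ = 0 := by
  have h := congrArg (vord v) hζ.pow_eq_one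
  rw [vord_pow, vord_one] at h
  have := hp.out.pos
  simpa [this.ne'] using h

theorem pow_ne_one_of_lt (hζ : IsPrimitiveRoot ζ p) {k : ℕ} (hk : k < p - 1) :
    1 - ζ ^ (k + 1) ≠ 0 := by
  rw [sub_ne_zero]
  exact (hζ.pow_ne_one_of_pos_of_lt (by omega) (by omega)).symm

theorem vord_one_sub_pow_nonneg (hζ : IsPrimitiveRoot ζ p) {k : ℕ} (hk : k < p - 1) :
    0 ≤ vord v (1 - ζ ^ (k + 1)) := by
  rw [← mem_filt_iff (pow_ne_one_of_lt hζ hk)]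
  refine sub_mem one_mem_filt ?_
  have := filt_pow (mem_filt_vord (v := v) ζ) (k + 1)
  rwa [vord_of_isPrimitiveRoot hζ, mul_zero] at this

theorem sum_vord_one_sub_pow (hζ : IsPrimitiveRoot ζ p) :
    ∑ k ∈ Finset.range (p - 1), vord v (1 - ζ ^ (k + 1)) = vord v (p : K) := by
  rw [← prod_one_sub_pow hζ, vord_prod]
  exact fun i hi => pow_ne_one_of_lt hζ (Finset.mem_range.1 hi)

theorem vord_one_sub_pow_le (hζ : IsPrimitiveRoot ζ p) {k : ℕ} (hk : k < p - 1) :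
    vord v (1 - ζ ^ (k + 1)) ≤ vord v (p : K) := by
  rw [← sum_vord_one_sub_pow hζ]
  exact Finset.single_le_sum (f := fun k => vord v (1 - ζ ^ (k + 1)))
    (fun i hi => vord_one_sub_pow_nonneg hζ (Finset.mem_range.1 hi)) (Finset.mem_range.2 hk)

theorem sub_one_mem_of_pow_sub_one_mem (hζ : IsPrimitiveRoot ζ p) {x : K}
    (hx : x - 1 ∈ filt v (vord v (p : K) + 1)) {N : ℤ} (h : x ^ p - 1 ∈ filt v N) :
    x - 1 ∈ filt v (N - vord v (p : K)) := by
  rcases eq_or_ne (x - 1) 0 with h0 | h0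
  · rw [h0]; exact zero_mem _
  have key : ∀ k ∈ Finset.range (p - 1), x - ζ ^ (k + 1) ≠ 0 ∧
      vord v (x - ζ ^ (k + 1)) = vord v (1 - ζ ^ (k + 1)) := by
    intro k hk
    have hk' := Finset.mem_range.1 hk
    refine vord_eq_of_sub_mem (pow_ne_one_of_lt hζ hk') ?_
    rw [sub_sub_sub_cancel_right]
    exact filt_mono (by have := vord_one_sub_pow_le (v := v) hζ hk'; omega) hx
  have hprod : ∏ k ∈ Finset.range (p - 1), (x - ζ ^ (k + 1)) ≠ 0 :=
    Finset.prod_ne_zero_iff.2 fun k hk => (key k hk).1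
  rw [pow_sub_one_eq_mul_prod hζ, mem_filt_iff (mul_ne_zero h0 hprod), vord_mul h0 hprod,
    vord_prod _ _ fun k hk => (key k hk).1, Finset.sum_congr rfl fun k hk => (key k hk).2,
    sum_vord_one_sub_pow hζ] at h
  rw [mem_filt_iff h0]
  omega

theorem exists_close_root (hζ : IsPrimitiveRoot ζ p) {x : K} {N : ℤ}
    (hN : p * vord v (p : K) < N) (h : x ^ p - 1 ∈ filt v N) :
    ∃ i : ℕ, x - ζ ^ i ∈ filt v (vord v (p : K) + 1) := by
  by_contra hcon
  push Not at hcon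
  have h0 : ∀ i : ℕ, x - ζ ^ i ≠ 0 := fun i h0 => hcon i (by rw [h0]; exact zero_mem _)
  have hle : ∀ i : ℕ, vord v (x - ζ ^ i) ≤ vord v (p : K) := by
    intro i
    have := hcon i
    rw [mem_filt_iff (h0 i)] at this
    omega
  have hx1 : x - 1 ≠ 0 := by simpa using h0 0
  have hprod : ∏ k ∈ Finset.range (p - 1), (x - ζ ^ (k + 1)) ≠ 0 :=
    Finset.prod_ne_zero_iff.2 fun k _ => h0 _
  rw [pow_sub_one_eq_mul_prod hζ, mem_filt_iff (mul_ne_zero hx1 hprod), vord_mul hx1 hprod,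
    vord_prod _ _ fun k _ => h0 _] at h
  have h1 : vord v (x - 1) ≤ vord v (p : K) := by simpa using hle 0
  have h2 := Finset.sum_le_card_nsmul (Finset.range (p - 1)) (fun k => vord v (x - ζ ^ (k + 1)))
    _ fun k _ => hle (k + 1)
  rw [Finset.card_range, nsmul_eq_mul, Nat.cast_sub hp.out.one_le] at h2
  push_cast at h2
  linarith

theorem exists_root_mul_mem_punit (hζ : IsPrimitiveRoot ζ p) {x : Kˣ}
    {N : ℕ} {e : ℕ} (he : vord v (p : K) = e) (hN : p * e + e < N)
    (h : (x : K) ^ p - 1 ∈ filt v N) :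
    ∃ i : ℕ, x * (hζ.isUnit hp.out.ne_zero).unit⁻¹ ^ i ∈ punit v (N - e) := by
  obtain ⟨i, hi⟩ := exists_close_root (v := v) hζ (N := N) (by rw [he]; push_cast; norm_cast; omega) h
  refine ⟨i, ?_⟩
  set u := (hζ.isUnit hp.out.ne_zero).unit with hu
  have hu' : (u : K) = ζ := rfl
  have hvu : vord v ((u : K) ^ i) = 0 := by
    rw [vord_pow, hu', vord_of_isPrimitiveRoot hζ, mul_zero]
  have hyp : ((x : K) * (ζ⁻¹) ^ i) ^ p = x ^ p := by
    rw [mul_pow, ← pow_mul, mul_comm i, pow_mul, inv_pow, hζ.pow_eq_one]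
    simp
  have h1 : ((x * u⁻¹ ^ i : Kˣ) : K) - 1 ∈ filt v (vord v (p : K) + 1) := by
    have := filt_mul hi (mem_filt_vord (v := v) ((ζ⁻¹) ^ i))
    rw [vord_pow, vord_inv, vord_of_isPrimitiveRoot hζ] at this
    have hz0 : ζ ^ i ≠ 0 := pow_ne_zero _ (hζ.ne_zero hp.out.ne_zero)
    convert this using 1
    · simp
    · push_cast
      rw [hu', sub_mul, inv_pow, mul_inv_cancel₀ hz0]
  have h2 := sub_one_mem_of_pow_sub_one_mem (v := v) hζ h1 (N := N) (by
    push_cast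
    rw [hu', hyp]; exact h)
  rw [mem_punit_iff (by omega)]
  rw [he] at h2
  convert h2 using 2
  omega

theorem relIndex_torsion_le (hζ : IsPrimitiveRoot ζ p) (hq : qres v ≠ 0) {π : K}
    (hπ : vord v π = 1) {N : ℕ} {e : ℕ} (he : vord v (p : K) = e) (hN : p * e + e < N) :
    (punit v N).relIndex ((punit v N).comap (powMonoidHom p) ⊓ punit v 0) ≤ p * qres v ^ e := by
  set u := (hζ.isUnit hp.out.ne_zero).unit with hu
  have hle : (punit v N).comap (powMonoidHom p) ⊓ punit v 0 ≤
      Subgroup.zpowers u ⊔ punit v (N - e) := by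
    rintro x ⟨hx, -⟩
    obtain ⟨i, hi⟩ := exists_root_mul_mem_punit hζ he hN (by simpa using hx.2)
    rw [Subgroup.mem_sup]
    refine ⟨u ^ i, Subgroup.npow_mem_zpowers _ _, _, hi, ?_⟩
    rw [mul_comm x, inv_pow, mul_inv_cancel_left]
  have h1 : (punit v N).relIndex (punit v (N - e)) = qres v ^ e := by
    have := relIndex_punit_pow hπ (n := N - e) (by omega) e
    rwa [Nat.sub_add_cancel (by omega)] at this
  have h2 : (punit v (N - e)).relIndex (Subgroup.zpowers u ⊔ punit v (N - e)) ∣ p := by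
    rw [relIndex_sup_eq]
    have hup : orderOf u = p := by
      rw [← orderOf_units, hu, IsUnit.unit_spec, ← hζ.eq_orderOf]
    have := Subgroup.relIndex_dvd_card (punit v (N - e)) (Subgroup.zpowers u)
    rwa [Nat.card_zpowers, hup] at this
  have h3 := Subgroup.relIndex_mul_relIndex (punit v N) (punit v (N - e))
    (Subgroup.zpowers u ⊔ punit v (N - e)) (punit_anti (by omega)) le_sup_right
  refine (Subgroup.relIndex_le_of_le_right hle ?_).trans ?_
  · rw [← h3, h1]
    exact mul_ne_zero (pow_ne_zero _ hq) (ne_zero_of_dvd_ne_zero hp.out.ne_zero h2)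
  · rw [← h3, h1, mul_comm]
    exact Nat.mul_le_mul_right _ (Nat.le_of_dvd hp.out.pos h2)

/-- Index of the local `p`-th powers among units. -/
theorem relIndex_clos_pows_units (hζ : IsPrimitiveRoot ζ p) (hp0 : (p : K) ≠ 0) (hq : qres v ≠ 0)
    {π : K} (hπ : vord v π = 1) {e : ℕ} (he : vord v (p : K) = e) :
    (clos v (pows p K)).relIndex (punit v 0) ≠ 0 ∧
    (clos v (pows p K)).relIndex (punit v 0) ≤ p * qres v ^ e := by
  obtain ⟨N, hN⟩ : ∃ N : ℕ, N = p * e + 2 * e + 1 := ⟨_, rfl⟩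
  have hle : (punit v 0).map (powMonoidHom p) ⊔ punit v N ≤ clos v (pows p K) := by
    refine sup_le ?_ (punit_le_clos_pows hp0 (by rw [he, hN]; push_cast; nlinarith))
    refine le_trans ?_ (le_clos _)
    rintro _ ⟨y, _, rfl⟩
    exact ⟨y, rfl⟩
  have hmap : ∀ n, (punit v n).map (powMonoidHom p) ≤ punit v n := by
    rintro n _ ⟨y, hy, rfl⟩
    exact pow_mem hy p
  have hfin := relIndex_punit_zero_ne_zero hq hπ N
  have h1 := relIndex_map_sup_eq (powMonoidHom p) (punit_anti (v := v) (Nat.zero_le N)) (hmap N)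
    (hmap 0) hfin
  have h2 : ((punit v 0).map (powMonoidHom p) ⊔ punit v N).relIndex (punit v 0) ≠ 0 := by
    rw [h1]
    intro h0
    refine hfin ?_
    rw [← Subgroup.relIndex_mul_relIndex _ _ _ (le_inf (Subgroup.map_le_iff_le_comap.1 (hmap N))
      (punit_anti (v := v) (Nat.zero_le N))) inf_le_right, h0, zero_mul]
  refine ⟨ne_zero_of_dvd_ne_zero h2 (Subgroup.relIndex_dvd_of_le_left _ hle), ?_⟩
  refine (Subgroup.relIndex_le_of_le_left hle h2).trans ?_
  rw [h1]
  exact relIndex_torsion_le hζ hq hπ he (by omega)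

variable (v) in
/-- The order as a homomorphism to `ℤ / p`. -/
noncomputable def ordModHom (p : ℕ) : Kˣ →* Multiplicative (ZMod p) where
  toFun x := Multiplicative.ofAdd ((vord v (x : K) : ℤ) : ZMod p)
  map_one' := by simp
  map_mul' x y := by
    rw [← ofAdd_add]
    push_cast
    rw [vord_mul x.ne_zero y.ne_zero]
    push_cast; rfl

theorem mem_ker_ordModHom {x : Kˣ} :
    x ∈ (ordModHom v p).ker ↔ (p : ℤ) ∣ vord v (x : K) := by
  rw [MonoidHom.mem_ker, ← ZMod.intCast_zmod_eq_zero_iff_dvd]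
  rfl

theorem ker_ordModHom {π : K} (hπ : vord v π = 1) :
    (ordModHom v p).ker = punit v 0 ⊔ pows p K := by
  have hπ0 : π ≠ 0 := by rintro rfl; simp [vord] at hπ
  apply le_antisymm
  · intro x hx
    rw [mem_ker_ordModHom] at hx
    obtain ⟨k, hk⟩ := hx
    rw [Subgroup.mem_sup]
    refine ⟨x * ((Units.mk0 π hπ0) ^ k)⁻¹ ^ p, ?_, ((Units.mk0 π hπ0) ^ k) ^ p, ⟨_, rfl⟩, ?_⟩
    · rw [mem_punit_zero]
      push_cast
      rw [vord_mul x.ne_zero (pow_ne_zero _ (inv_ne_zero (zpow_ne_zero _ (by simpa using hπ0)))), hk]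
      simp [hπ]
    · rw [inv_pow, inv_mul_cancel_right]
  · refine sup_le ?_ ?_
    · intro x hx
      rw [mem_ker_ordModHom, hx.1]; exact dvd_zero _
    · rintro _ ⟨y, rfl⟩
      rw [mem_ker_ordModHom]
      simp

/-- Index of the local `p`-th powers. -/
theorem index_clos_pows (hζ : IsPrimitiveRoot ζ p) (hp0 : (p : K) ≠ 0) (hq : qres v ≠ 0)
    {π : K} (hπ : vord v π = 1) {e : ℕ} (he : vord v (p : K) = e) :
    (clos v (pows p K)).index ≠ 0 ∧ (clos v (pows p K)).index ≤ p * (p * qres v ^ e) := by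
  obtain ⟨h1, h2⟩ := relIndex_clos_pows_units hζ hp0 hq hπ he
  have hle : clos v (pows p K) ≤ (ordModHom v p).ker := by
    rw [ker_ordModHom hπ, sup_comm]; exact clos_le _ _
  have h3 : (clos v (pows p K)).relIndex (ordModHom v p).ker =
      (clos v (pows p K)).relIndex (punit v 0) := by
    have : (ordModHom v p).ker = punit v 0 ⊔ clos v (pows p K) := by
      apply le_antisymm
      · rw [ker_ordModHom hπ]; exact sup_le_sup_left (le_clos _) _
      · exact sup_le (by rw [ker_ordModHom hπ]; exact le_sup_left) hle
    rw [this, relIndex_sup_eq]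
  have h4 := Subgroup.relIndex_mul_index hle
  have h5 : (ordModHom v p).ker.index ∣ p := by
    rw [Subgroup.index_ker]
    have := Subgroup.card_subgroup_dvd_card (ordModHom v p).range
    simpa using this
  rw [← h4, h3]
  refine ⟨mul_ne_zero h1 (ne_zero_of_dvd_ne_zero hp.out.ne_zero h5), ?_⟩
  rw [mul_comm]
  exact Nat.mul_le_mul (Nat.le_of_dvd hp.out.pos h5) h2

end Counting

end

section

section Abelian

open DirectSum

theorem card_ker_comp {A : Type*} [AddCommGroup A] (f g : A →+ A) :
    Nat.card (f.comp g).ker = Nat.card g.ker * Nat.card (g.range ⊓ f.ker : AddSubgroup A) := by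
  have hc : (f.comp g).ker = f.ker.comap g := rfl
  have hle : g.ker ≤ (f.comp g).ker := by
    rw [hc]; exact AddSubgroup.comap_mono bot_le
  rw [← AddSubgroup.relIndex_bot_left, ← AddSubgroup.relIndex_mul_relIndex _ _ _ bot_le hle,
    AddSubgroup.relIndex_bot_left, AddSubgroup.relIndex_ker, hc, AddSubgroup.map_comap_eq]

/-- Multiplicativity of the quotient of the orders of cokernel and kernel. -/
theorem index_range_comp_mul {A : Type*} [AddCommGroup A] (f g : A →+ A) :
    (f.comp g).range.index * (Nat.card f.ker * Nat.card g.ker) =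
      f.range.index * g.range.index * Nat.card (f.comp g).ker := by
  have h1 : (f.comp g).range.index = (g.range ⊔ f.ker).index * f.range.index := by
    rw [AddMonoidHom.range_comp, AddSubgroup.index_map]
  have h2 : (g.range ⊓ f.ker).relIndex f.ker * (g.range ⊔ f.ker).index = g.range.index := by
    rw [AddSubgroup.inf_relIndex_right, ← AddSubgroup.relIndex_sup_left,
      AddSubgroup.relIndex_mul_index le_sup_left]
  have h3 : Nat.card (g.range ⊓ f.ker : AddSubgroup A) * (g.range ⊓ f.ker).relIndex f.ker =
      Nat.card f.ker := by
    rw [← AddSubgroup.relIndex_bot_left, ← AddSubgroup.relIndex_bot_left,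
      AddSubgroup.relIndex_mul_relIndex _ _ _ bot_le inf_le_right]
  rw [h1, card_ker_comp, ← h2, ← h3]
  ring

theorem finrank_int_of_finite (T : Type*) [AddCommGroup T] [Finite T] :
    Module.finrank ℤ T = 0 := by
  have h : Module.rank ℤ T = 0 := rank_eq_zero_iff.2 fun x =>
    ⟨(Nat.card T : ℤ), by exact_mod_cast Nat.card_pos.ne', by
      rw [natCast_zsmul, card_nsmul_eq_zero']⟩
  rw [Module.finrank, h, map_zero]

/-- Multiplication by `n` on a finitely generated abelian group. -/
theorem index_range_nsmul {A : Type*} [AddCommGroup A] [Module.Finite ℤ A] {n : ℕ} (hn : n ≠ 0) :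
    (nsmulAddMonoidHom (α := A) n).range.index =
      n ^ Module.finrank ℤ A * Nat.card (nsmulAddMonoidHom (α := A) n).ker ∧
    Nat.card (nsmulAddMonoidHom (α := A) n).ker ≠ 0 := by
  have hfg : AddGroup.FG A := Module.Finite.iff_addGroup_fg.1 inferInstance
  obtain ⟨r, ι, _, q, hq, e, ⟨f⟩⟩ := AddCommGroup.equiv_free_prod_directSum_zmod A
  have : ∀ i, NeZero (q i ^ e i) := fun i => ⟨pow_ne_zero _ (hq i).ne_zero⟩
  have : ∀ i, Finite (ZMod (q i ^ e i)) := fun i => inferInstance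
  set T := ⨁ i : ι, ZMod (q i ^ e i) with hT
  have hTfin : Finite T := Finite.of_equiv _ (DirectSum.addEquivProd _).toEquiv.symm
  let g : A ≃+ (Fin r → ℤ) × T := f.trans
    (AddEquiv.prodCongr (Finsupp.addEquivFunOnFinite) (AddEquiv.refl T))
  have hr : Module.finrank ℤ A = r := by
    rw [g.toIntLinearEquiv.finrank_eq]
    have h := Submodule.finrank_quotient_add_finrank (LinearMap.ker (LinearMap.fst ℤ (Fin r → ℤ) T))
    rw [((LinearMap.fst ℤ (Fin r → ℤ) T).quotKerEquivOfSurjective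
      LinearMap.fst_surjective).finrank_eq, LinearMap.ker_fst,
      LinearMap.finrank_range_of_inj LinearMap.inr_injective, finrank_int_of_finite T,
      Module.finrank_fin_fun] at h
    exact h.symm
  have hker : Nat.card (nsmulAddMonoidHom (α := A) n).ker =
      Nat.card (nsmulAddMonoidHom (α := T) n).ker := by
    refine Nat.card_congr ?_
    refine Equiv.ofBijective (fun x => ⟨(g x).2, ?_⟩) ⟨?_, ?_⟩
    · have := x.2
      rw [AddMonoidHom.mem_ker, nsmulAddMonoidHom_apply] at this ⊢
      rw [← Prod.smul_snd, ← map_nsmul, this, map_zero]; rfl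
    · intro x y hxy
      have h1 : ∀ z : (nsmulAddMonoidHom (α := A) n).ker, (g z).1 = 0 := by
        intro z
        have := z.2
        rw [AddMonoidHom.mem_ker, nsmulAddMonoidHom_apply] at this
        have h2 : n • (g z).1 = 0 := by rw [← Prod.smul_fst, ← map_nsmul, this, map_zero]; rfl
        exact (smul_eq_zero.1 h2).resolve_left hn
      apply Subtype.ext
      apply g.injective
      exact Prod.ext ((h1 x).trans (h1 y).symm) (congrArg Subtype.val hxy)
    · rintro ⟨y, hy⟩
      rw [AddMonoidHom.mem_ker, nsmulAddMonoidHom_apply] at hy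
      refine ⟨⟨g.symm (0, y), ?_⟩, ?_⟩
      · rw [AddMonoidHom.mem_ker, nsmulAddMonoidHom_apply, ← map_nsmul]
        simp [hy]
      · simp
  have hrange : (nsmulAddMonoidHom (α := A) n).range.index =
      n ^ r * (nsmulAddMonoidHom (α := T) n).range.index := by
    rw [← AddSubgroup.index_map_equiv _ g]
    have : ((nsmulAddMonoidHom (α := A) n).range.map (g : A →+ (Fin r → ℤ) × T)) =
        (AddSubgroup.pi Set.univ fun _ : Fin r => AddSubgroup.zmultiples (n : ℤ)).prod
          (nsmulAddMonoidHom (α := T) n).range := by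
      ext ⟨a, b⟩
      rw [AddSubgroup.mem_prod, AddSubgroup.mem_pi]
      constructor
      · rintro ⟨_, ⟨x, rfl⟩, hx⟩
        have h1 : g (n • x) = (a, b) := hx
        rw [map_nsmul] at h1
        refine ⟨fun i _ => ?_, ⟨(g x).2, by rw [nsmulAddMonoidHom_apply, ← Prod.smul_snd, h1]⟩⟩
        rw [Int.mem_zmultiples_iff]
        refine ⟨(g x).1 i, ?_⟩
        have := congrFun (congrArg Prod.fst h1) i
        simpa using this.symm
      · rintro ⟨h1, ⟨y, hy⟩⟩
        have h2 : ∀ i, ∃ c, a i = n * c := fun i =>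
          Int.mem_zmultiples_iff.1 (h1 i (Set.mem_univ _))
        choose c hc using h2
        refine ⟨_, ⟨g.symm (c, y), rfl⟩, ?_⟩
        change g (n • g.symm (c, y)) = (a, b)
        rw [map_nsmul, AddEquiv.apply_symm_apply]
        refine Prod.ext ?_ hy
        ext i
        simp [hc]
    rw [this, AddSubgroup.index_prod, AddSubgroup.index_pi]
    simp [Int.index_zmultiples]
  rw [hrange, hker, hr, AddSubgroup.index_range]
  exact ⟨rfl, Nat.card_pos.ne'⟩

open Polynomial in
theorem exists_prod_one_sub_X_pow (p : ℕ) [hp : Fact p.Prime] :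
    ∃ Q : ℤ[X], ∏ i ∈ Finset.range (p - 1), (1 - X ^ (i + 1)) =
      C (p : ℤ) + (∑ i ∈ Finset.range p, X ^ i) * Q := by
  have hζ := Complex.isPrimitiveRoot_exp p hp.out.ne_zero
  obtain ⟨Q, hQ⟩ := minpoly.isIntegrallyClosed_dvd (R := ℤ) (hζ.isIntegral hp.out.pos)
    (p := ∏ i ∈ Finset.range (p - 1), (1 - X ^ (i + 1)) - C (p : ℤ)) (by
      rw [map_sub, map_prod]
      simp only [map_sub, map_one, map_pow, aeval_X, aeval_C]
      rw [prod_one_sub_pow hζ]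
      simp)
  rw [← cyclotomic_eq_minpoly hζ hp.out.pos, cyclotomic_prime] at hQ
  exact ⟨Q, by rw [← hQ]; ring⟩

section

variable {A : Type*} [AddCommGroup A]

theorem range_one_sub_pow_eq {p : ℕ} (hp : p.Prime) (s : AddMonoid.End A) (hs : s ^ p = 1)
    {i : ℕ} (hi : i ∈ Finset.range (p - 1)) :
    (1 - s ^ (i + 1)).range = (1 - s).range ∧ (1 - s ^ (i + 1)).ker = (1 - s).ker := by
  have key : ∀ (t : AddMonoid.End A) (n : ℕ),
      (1 - t ^ n).range ≤ (1 - t).range ∧ (1 - t).ker ≤ (1 - t ^ n).ker := by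
    intro t n
    constructor
    · rw [← mul_neg_geom_sum]
      rintro _ ⟨x, rfl⟩
      exact ⟨(∑ i ∈ Finset.range n, t ^ i) x, rfl⟩
    · rw [← geom_sum_mul_neg]
      intro x hx
      have hx' : (1 - t) x = 0 := hx
      change (∑ i ∈ Finset.range n, t ^ i) ((1 - t) x) = 0
      rw [hx', map_zero]
  obtain ⟨j, hj⟩ : ∃ j, (s ^ (i + 1)) ^ j = s := by
    have hi' := Finset.mem_range.1 hi
    have hc : Nat.Coprime (i + 1) p := (Nat.coprime_of_lt_prime (by omega) (by omega) hp).symm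
    obtain ⟨j, -, hj⟩ := Nat.exists_mul_mod_eq_one_of_coprime hc hp.one_lt
    refine ⟨j, ?_⟩
    rw [← pow_mul, ← Nat.mod_add_div ((i + 1) * j) p, hj, pow_add, pow_mul, hs]
    simp
  have h1 := key s (i + 1)
  have h2 := key (s ^ (i + 1)) j
  rw [hj] at h2
  exact ⟨le_antisymm h1.1 h2.1, le_antisymm h2.2 h1.2⟩

theorem index_range_one_sub [Module.Finite ℤ A] {p : ℕ} [hp : Fact p.Prime]
    (s : AddMonoid.End A) (hs : ∑ i ∈ Finset.range p, s ^ i = 0) :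
    ∃ l, Module.finrank ℤ A = l * (p - 1) ∧
      (1 - s).range.index = p ^ l * Nat.card (1 - s).ker ∧ Nat.card (1 - s).ker ≠ 0 := by
  have hsp : s ^ p = 1 := by
    have := mul_neg_geom_sum s p
    rw [hs, mul_zero] at this
    exact (sub_eq_zero.1 this.symm).symm
  obtain ⟨hpidx, hpker⟩ := index_range_nsmul (A := A) hp.out.ne_zero
  have hkle : (1 - s).ker ≤ (nsmulAddMonoidHom (α := A) p).ker := by
    intro x hx
    have hx' : s x = x := by
      have : x - s x = 0 := hx
      exact (sub_eq_zero.1 this).symm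
    have hpow : ∀ i : ℕ, (s ^ i) x = x := by
      intro i
      induction i with
      | zero => rfl
      | succ n ih => rw [pow_succ]; change (s ^ n) (s x) = x; rw [hx', ih]
    have h : (∑ i ∈ Finset.range p, s ^ i) x = 0 := by rw [hs]; rfl
    rw [show (∑ i ∈ Finset.range p, s ^ i) x = ∑ i ∈ Finset.range p, (s ^ i) x from
      AddMonoidHom.finsetSum_apply _ _ _, Finset.sum_congr rfl fun i _ => hpow i] at h
    simpa using h
  have hfin : Finite (nsmulAddMonoidHom (α := A) p).ker := Nat.finite_of_card_ne_zero hpker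
  have hκ : Nat.card (1 - s).ker ≠ 0 := by
    have : Finite (1 - s).ker := Finite.of_injective _ (AddSubgroup.inclusion_injective hkle)
    exact Nat.card_pos.ne'
  let P : ℕ → AddMonoid.End A := fun n =>
    Polynomial.aeval s (∏ i ∈ Finset.range n, (1 - Polynomial.X ^ (i + 1)) : Polynomial ℤ)
  have hPs : ∀ n, P (n + 1) = P n * (1 - s ^ (n + 1)) := fun n => by
    simp only [P, Finset.prod_range_succ, map_mul, map_sub, map_one, map_pow, Polynomial.aeval_X]
  have hPp : P (p - 1) = nsmulAddMonoidHom p := by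
    obtain ⟨Q, hQ⟩ := exists_prod_one_sub_X_pow p
    simp only [P]
    rw [hQ, map_add, map_mul, map_sum]
    simp only [map_pow, Polynomial.aeval_X]
    rw [hs, zero_mul, add_zero, Polynomial.aeval_C]
    ext x
    simp
    rfl
  have hker : ∀ n ≤ p - 1, Nat.card (P n).ker ≠ 0 := by
    have h1 : ∀ n ≤ p - 1, (P n).ker ≤ (P (p - 1)).ker := by
      intro n hn
      obtain ⟨d, hd⟩ := Nat.exists_eq_add_of_le hn
      rw [hd]
      clear hd hn
      induction d with
      | zero => exact le_rfl
      | succ d ih =>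
        refine ih.trans ?_
        intro x hx
        have hx' : P (n + d) x = 0 := hx
        have hcomm : P (n + (d + 1)) = (1 - s ^ (n + d + 1)) * P (n + d) := by
          rw [← add_assoc, hPs]
          refine Commute.eq (((Commute.one_left _).sub_left ?_).symm)
          have : s ^ (n + d + 1) = Polynomial.aeval s (Polynomial.X ^ (n + d + 1) : Polynomial ℤ) := by
            simp
          rw [this]
          exact (Commute.all _ _).map (Polynomial.aeval s)
        change P (n + (d + 1)) x = 0
        rw [hcomm]
        change (1 - s ^ (n + d + 1)) (P (n + d) x) = 0
        rw [hx', map_zero]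
    intro n hn
    have h2 := h1 n hn
    rw [hPp] at h2
    have : Finite (P n).ker := Finite.of_injective _ (AddSubgroup.inclusion_injective h2)
    exact Nat.card_pos.ne'
  have hind : ∀ n ≤ p - 1, (P n).range.index * Nat.card (1 - s).ker ^ n =
      (1 - s).range.index ^ n * Nat.card (P n).ker := by
    intro n
    induction n with
    | zero =>
      intro _
      have h1 : P 0 = 1 := by simp [P]
      have h2 : (1 : AddMonoid.End A).range = ⊤ := AddMonoidHom.range_eq_top.2 fun x => ⟨x, rfl⟩
      have h3 : (1 : AddMonoid.End A).ker = ⊥ := by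
        ext x
        exact Iff.rfl
      rw [h1, h2, h3]
      simp
    | succ n ih =>
      intro hn
      have h1 : (AddMonoidHom.range (P (n + 1))).index *
          (Nat.card (AddMonoidHom.ker (P n)) *
            Nat.card (AddMonoidHom.ker (1 - s ^ (n + 1) : AddMonoid.End A))) =
          (AddMonoidHom.range (P n)).index *
            (AddMonoidHom.range (1 - s ^ (n + 1) : AddMonoid.End A)).index *
              Nat.card (AddMonoidHom.ker (P (n + 1))) := by
        rw [hPs]
        exact index_range_comp_mul (P n) _
      have h2 := range_one_sub_pow_eq hp.out s hsp (i := n) (Finset.mem_range.2 (by omega))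
      rw [h2.1, h2.2] at h1
      have h4 := ih (by omega)
      refine mul_left_cancel₀ (hker n (by omega)) ?_
      calc _ = (P (n + 1)).range.index * (Nat.card (P n).ker * Nat.card (1 - s).ker) *
            Nat.card (1 - s).ker ^ n := by ring
        _ = ((P n).range.index * Nat.card (1 - s).ker ^ n) * (1 - s).range.index *
            Nat.card (P (n + 1)).ker := by rw [h1]; ring
        _ = _ := by rw [h4]; ring
  have hfinal := hind (p - 1) le_rfl
  rw [hPp, hpidx] at hfinal
  have hmain : p ^ Module.finrank ℤ A * Nat.card (1 - s).ker ^ (p - 1) =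
      (1 - s).range.index ^ (p - 1) :=
    mul_right_cancel₀ hpker (by rw [← hfinal]; ring)
  set κ := Nat.card (1 - s).ker
  set c := (1 - s).range.index
  have hp1 : p - 1 ≠ 0 := by have := hp.out.one_lt; omega
  have hdvd : κ ∣ c := by
    rw [← Nat.pow_dvd_pow_iff hp1, ← hmain]
    exact Dvd.intro_left _ rfl
  obtain ⟨d, hd⟩ := hdvd
  have hd' : p ^ Module.finrank ℤ A = d ^ (p - 1) := by
    refine mul_right_cancel₀ (pow_ne_zero (p - 1) hκ) ?_
    rw [hmain, hd]; ring
  obtain ⟨l, -, hl⟩ := (Nat.dvd_prime_pow hp.out).1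
    ((Dvd.intro_left _ (pow_sub_one_mul hp1 d)).trans hd'.symm.dvd)
  rw [hl, ← pow_mul] at hd'
  exact ⟨l, Nat.pow_right_injective hp.out.two_le hd', by rw [hd, hl, mul_comm], hκ⟩

theorem herbrand [Module.Finite ℤ A] {p : ℕ} [hp : Fact p.Prime]
    (s : AddMonoid.End A) (hsp : s ^ p = 1) (N : A →+ A)
    (hN : ∀ a, N a = ∑ i ∈ Finset.range p, (s ^ i) a)
    (h1 : ∀ a, N a = 0 → ∃ b, a = b - s b) (B : AddSubgroup A) (hB : ∀ a, a ∈ B ↔ s a = a) :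
    ∃ l, Module.finrank ℤ A = Module.finrank ℤ B + l * (p - 1) ∧
      N.range.relIndex B * p ^ l = p ^ Module.finrank ℤ B := by
  have hND : ∀ a, N (a - s a) = 0 := by
    intro a
    have h2 : N = ((∑ i ∈ Finset.range p, s ^ i : AddMonoid.End A) : A →+ A) := by
      ext a
      rw [hN]
      exact (AddMonoidHom.finsetSum_apply _ _ _).symm
    rw [h2]
    change ((∑ i ∈ Finset.range p, s ^ i) * (1 - s)) a = 0
    rw [geom_sum_mul_neg, hsp, sub_self]
    rfl
  let D : A →+ A := ((1 - s : AddMonoid.End A) : A →+ A)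
  have hD : ∀ a, D a = a - s a := fun a => rfl
  have hDr : D.range = N.ker := by
    ext a
    constructor
    · rintro ⟨b, rfl⟩
      exact hND b
    · intro ha
      obtain ⟨b, rfl⟩ := h1 a ha
      exact ⟨b, rfl⟩
  have hDk : D.ker = B := by
    ext a
    rw [hB, AddMonoidHom.mem_ker, hD, sub_eq_zero]
    exact eq_comm
  have hNs : ∀ a, N (s a) = N a := fun a => by
    have := hND a
    rw [map_sub] at this
    exact (sub_eq_zero.1 this).symm
  have hpow : ∀ b ∈ B, ∀ i : ℕ, (s ^ i) b = b := by
    intro b hb i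
    induction i with
    | zero => rfl
    | succ n ih => rw [pow_succ]; change (s ^ n) (s b) = b; rw [(hB b).1 hb, ih]
  have hNB : ∀ b ∈ B, N b = p • b := by
    intro b hb
    rw [hN, Finset.sum_congr rfl fun i _ => hpow b hb i]
    simp
  let s0 : AddMonoid.End N.ker := (s.comp N.ker.subtype).codRestrict N.ker (fun a => by
    change N (s a) = 0
    rw [hNs]
    exact a.2)
  have hs0 : ∑ i ∈ Finset.range p, s0 ^ i = 0 := by
    ext a
    have h2 : ∀ i : ℕ, (((s0 ^ i) a : N.ker) : A) = (s ^ i) (a : A) := by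
      intro i
      induction i with
      | zero => rfl
      | succ n ih =>
        rw [pow_succ', pow_succ']
        change s ((s0 ^ n) a : N.ker) = s ((s ^ n) a)
        rw [ih]
    rw [show (∑ i ∈ Finset.range p, s0 ^ i) a = ∑ i ∈ Finset.range p, (s0 ^ i) a from
      AddMonoidHom.finsetSum_apply _ _ _, AddSubgroup.val_finsetSum,
      Finset.sum_congr rfl fun i _ => h2 i, ← hN]
    exact a.2
  have hfin0 : Module.Finite ℤ N.ker :=
    inferInstanceAs (Module.Finite ℤ (AddSubgroup.toIntSubmodule N.ker))
  have hfinB : Module.Finite ℤ B :=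
    inferInstanceAs (Module.Finite ℤ (AddSubgroup.toIntSubmodule B))
  obtain ⟨l, hl, hidx, hκ⟩ := index_range_one_sub s0 hs0
  refine ⟨l, ?_, ?_⟩
  · have h2 := Submodule.finrank_quotient_add_finrank (LinearMap.ker D.toIntLinearMap)
    have e1 : LinearMap.ker D.toIntLinearMap = AddSubgroup.toIntSubmodule B := by
      ext a
      rw [← hDk]
      rfl
    have e2 : LinearMap.range D.toIntLinearMap = AddSubgroup.toIntSubmodule N.ker := by
      ext a
      rw [← hDr]
      rfl
    rw [D.toIntLinearMap.quotKerEquivRange.finrank_eq, e1, e2] at h2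
    rw [← h2, ← hl, add_comm]
    rfl
  · obtain ⟨hp1, hp2⟩ := index_range_nsmul (A := B) hp.out.ne_zero
    have hle1 : B.map N ≤ N.range := by
      rintro _ ⟨b, -, rfl⟩
      exact ⟨b, rfl⟩
    have hle2 : N.range ≤ B := by
      rintro _ ⟨a, rfl⟩
      rw [← hDk]
      change N a - s (N a) = 0
      rw [hN, map_sum]
      have : ∀ i, s ((s ^ i) a) = (s ^ i) (s a) := fun i => by
        change (s * s ^ i) a = (s ^ i * s) a
        rw [← pow_succ, ← pow_succ']
      rw [Finset.sum_congr rfl fun i _ => this i, ← hN, ← hN, hNs, sub_self]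
    have hrel := AddSubgroup.relIndex_mul_relIndex _ _ _ hle1 hle2
    have hR : (B.map N).relIndex B =
        p ^ Module.finrank ℤ B * Nat.card (nsmulAddMonoidHom (α := B) p).ker := by
      rw [← hp1, AddSubgroup.relIndex]
      congr 1
      ext b
      rw [AddSubgroup.mem_addSubgroupOf]
      constructor
      · rintro ⟨c, hc, hcb⟩
        refine ⟨⟨c, hc⟩, Subtype.ext ?_⟩
        rw [← hcb, hNB c hc]
        rfl
      · rintro ⟨c, rfl⟩
        exact ⟨c, c.2, hNB c c.2⟩
    have hL : (B.map N).relIndex N.range = p ^ l * Nat.card (AddMonoidHom.ker (1 - s0 : AddMonoid.End N.ker)) := by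
      rw [← hidx, AddMonoidHom.range_eq_map, AddSubgroup.relIndex_map_map, top_sup_eq,
        AddSubgroup.relIndex_top_right, sup_comm, ← hDk, ← AddSubgroup.relIndex_top_right,
        ← top_sup_eq D.ker, ← AddSubgroup.relIndex_map_map, ← AddMonoidHom.range_eq_map, hDr,
        AddSubgroup.relIndex]
      congr 1
      ext b
      rw [AddSubgroup.mem_addSubgroupOf]
      constructor
      · rintro ⟨c, hc, hcb⟩
        exact ⟨⟨c, hc⟩, Subtype.ext hcb⟩
      · rintro ⟨c, rfl⟩
        exact ⟨c, c.2, rfl⟩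
    have hκβ : Nat.card (AddMonoidHom.ker (1 - s0 : AddMonoid.End N.ker)) =
        Nat.card (nsmulAddMonoidHom (α := B) p).ker := by
      refine Nat.card_congr ⟨fun a => ⟨⟨a.1.1, ?_⟩, ?_⟩, fun a => ⟨⟨a.1.1, ?_⟩, ?_⟩, ?_, ?_⟩
      · rw [← hDk]
        exact congrArg Subtype.val a.2
      · have h3 : (a.1.1 : A) ∈ B := by
          rw [← hDk]
          exact congrArg Subtype.val a.2
        refine Subtype.ext ?_
        change p • (a.1.1 : A) = 0
        rw [← hNB _ h3]
        exact a.1.2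
      · rw [AddMonoidHom.mem_ker, hNB _ a.1.2]
        exact congrArg Subtype.val a.2
      · refine Subtype.ext ?_
        change D a.1.1 = 0
        rw [← AddMonoidHom.mem_ker, hDk]
        exact a.1.2
      · intro a; rfl
      · intro a; rfl
    rw [hL, hR, hκβ] at hrel
    exact mul_left_cancel₀ hp2 (by rw [← mul_assoc] at *; linarith)

end

end Abelian

end

section

open NumberField IsDedekindDomain WithZero

section Places

/-- Finite places of a number field. -/
abbrev Pl (K : Type*) [Field K] : Type _ := HeightOneSpectrum (𝓞 K)

/-- The valuation attached to a finite place. -/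
noncomputable abbrev Pl.val {K : Type*} [Field K] [NumberField K] (v : Pl K) : Valuation K ℤᵐ⁰ :=
  v.valuation K

variable {K : Type*} [Field K] [NumberField K]

theorem Pl.exists_uniformizer (v : Pl K) : ∃ π : K, vord v.val π = 1 := by
  obtain ⟨π, hπ⟩ := v.valuation_exists_uniformizer K
  refine ⟨π, ?_⟩
  rw [vord, hπ, log_exp, neg_neg]

theorem Pl.coe_mem_filt_iff (v : Pl K) (a : 𝓞 K) (n : ℕ) :
    (a : K) ∈ filt v.val n ↔ a ∈ v.asIdeal ^ n := by
  rw [mem_filt_def, ← v.intValuation_le_pow_iff_mem, ← v.valuation_of_algebraMap (K := K)]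

theorem Pl.coe_mem_filt_zero (v : Pl K) (a : 𝓞 K) : (a : K) ∈ filt v.val 0 := by
  have := (v.coe_mem_filt_iff a 0).2 (by simp)
  simpa using this

theorem Pl.coe_mem_filt_one_iff (v : Pl K) (a : 𝓞 K) :
    (a : K) ∈ filt v.val 1 ↔ a ∈ v.asIdeal := by
  have := (v.coe_mem_filt_iff a 1)
  simpa using this

theorem Pl.vord_coe_eq_zero_iff (v : Pl K) {a : 𝓞 K} (ha : a ≠ 0) :
    vord v.val (a : K) = 0 ↔ a ∉ v.asIdeal := by
  have ha' : (a : K) ≠ 0 := by simpa using ha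
  rw [← v.coe_mem_filt_one_iff, mem_filt_iff ha']
  have := (mem_filt_iff ha').1 (v.coe_mem_filt_zero a)
  omega

theorem Pl.ext_of_filt {v v' : Pl K} (h : ∀ a : K, a ∈ filt v.val 1 → a ∈ filt v'.val 1) :
    v = v' := by
  apply HeightOneSpectrum.ext
  have hle : v.asIdeal ≤ v'.asIdeal := fun a ha =>
    (v'.coe_mem_filt_one_iff a).1 (h _ ((v.coe_mem_filt_one_iff a).2 ha))
  exact v.isMaximal.eq_of_le v'.isPrime.ne_top hle

/-- Weak approximation. -/
theorem Pl.exists_approx (S : Finset (Pl K)) (x : Pl K → K) (n : ℤ) :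
    ∃ z : K, ∀ v ∈ S, z - x v ∈ filt v.val n := by
  classical
  obtain ⟨d, hd⟩ := IsLocalization.exist_integer_multiples_of_finset (nonZeroDivisors (𝓞 K))
    (S.image x)
  have hd0 : ((d : 𝓞 K) : K) ≠ 0 := by
    simp
  have hd' : ∀ v : Pl K, v ∈ S → ∃ a : 𝓞 K, (a : K) = (d : 𝓞 K) * x v := by
    intro v hv
    obtain ⟨a, ha⟩ := hd (x v) (Finset.mem_image_of_mem x hv)
    refine ⟨a, ha.trans ?_⟩
    exact Algebra.smul_def _ _
  choose! a ha using hd'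
  obtain ⟨y, hy⟩ := IsDedekindDomain.exists_forall_sub_mem_ideal (s := S)
    (fun v : Pl K => v.asIdeal) (fun v => (n + vord v.val ((d : 𝓞 K) : K)).toNat)
    (fun v _ => v.prime) (fun v _ w _ hvw h => hvw (HeightOneSpectrum.ext h)) (fun v => a v)
  refine ⟨y / (d : 𝓞 K), fun v hv => ?_⟩
  have h1 := (v.coe_mem_filt_iff _ _).2 (hy v hv)
  have h2 : (y : K) / (d : 𝓞 K) - x v = ((y - a v : 𝓞 K) : K) * ((d : 𝓞 K) : K)⁻¹ := by
    have : ((y - a v : 𝓞 K) : K) = (y : K) - a v := map_sub _ _ _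
    rw [this, ha v hv]
    field_simp
  rw [h2]
  refine filt_mono ?_ (filt_mul h1 (mem_filt_vord _))
  rw [vord_inv]
  have := Int.self_le_toNat (n + vord v.val ((d : 𝓞 K) : K))
  omega

theorem Pl.exists_approx_unit (S : Finset (Pl K)) (x : Pl K → Kˣ) (n : ℕ) :
    ∃ z : Kˣ, ∀ v ∈ S, z * (x v)⁻¹ ∈ punit v.val n := by
  classical
  rcases S.eq_empty_or_nonempty with rfl | ⟨v0, hv0⟩
  · exact ⟨1, by simp⟩
  obtain ⟨N, hN⟩ : ∃ N : ℤ, ∀ v ∈ S, ((n + 1 : ℕ) : ℤ) + vord v.val (x v : K) ≤ N := by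
    obtain ⟨N, hN⟩ := (S.image fun v => ((n + 1 : ℕ) : ℤ) + vord v.val (x v : K)).bddAbove
    exact ⟨N, fun v hv => hN (by
      rw [Finset.mem_coe]
      exact Finset.mem_image_of_mem (fun v => ((n + 1 : ℕ) : ℤ) + vord v.val (x v : K)) hv)⟩
  obtain ⟨z, hz⟩ := Pl.exists_approx S (fun v => (x v : K)) N
  have hz0 : z ≠ 0 := (vord_eq_of_sub_mem (x v0).ne_zero
    (filt_mono (by have := hN v0 hv0; push_cast at this; omega) (hz v0 hv0))).1
  refine ⟨Units.mk0 z hz0, fun v hv => punit_anti (Nat.le_succ n) (div_mem_punit n.succ_ne_zero ?_)⟩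
  exact filt_mono (hN v hv) (hz v hv)

theorem Pl.finite_support (x : Kˣ) : {v : Pl K | vord v.val (x : K) ≠ 0}.Finite := by
  refine ((HeightOneSpectrum.Support.finite (𝓞 K) (x : K)).union
    (HeightOneSpectrum.Support.finite (𝓞 K) ((x⁻¹ : Kˣ) : K))).subset ?_
  intro v hv
  by_contra h
  apply hv
  simp only [Set.mem_union, HeightOneSpectrum.Support, Set.mem_ofPred_eq, not_or, not_lt] at h
  rw [← valuation_eq_one_iff x.ne_zero]
  refine le_antisymm h.1 ?_
  have := h.2
  rw [Units.val_inv_eq_inv_val, map_inv₀] at this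
  exact (inv_le_one₀ (by simp [zero_lt_iff])).1 this

variable {E : Type*} [Field E] [NumberField E]

/-- Restriction of a place along a homomorphism of number fields. -/
def Pl.comap (f : K →+* E) (w : Pl E) : Pl K where
  asIdeal := w.asIdeal.comap (RingOfIntegers.mapRingHom f)
  isPrime := w.asIdeal.comap_isPrime _
  ne_bot := by
    let _ := f.toAlgebra
    exact mt (Ideal.eq_bot_of_comap_eq_bot (R := 𝓞 K) (S := 𝓞 E)) w.ne_bot

theorem Pl.exists_ramification (f : K →+* E) (w : Pl E) :
    ∃ e : ℕ, e ≠ 0 ∧ ∀ c : K, vord w.val (f c) = e * vord (w.comap f).val c := by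
  let _ := f.toAlgebra
  have : w.asIdeal.LiesOver (w.comap f).asIdeal := ⟨rfl⟩
  refine ⟨_, Ideal.IsDedekindDomain.ramificationIdx'_ne_zero_of_liesOver w.asIdeal (w.comap f).ne_bot, fun c => ?_⟩
  have h := HeightOneSpectrum.valuation_liesOver E (w.comap f) w c
  rw [vord, vord, show f c = algebraMap K E c from rfl, ← h, log_pow]
  simp

theorem Pl.comap_eq_of_filt (f : K →+* E) {w : Pl E} {v : Pl K}
    (h : ∀ c : K, c ∈ filt v.val 1 → f c ∈ filt w.val 1) : w.comap f = v := by
  refine (Pl.ext_of_filt fun c hc => ?_).symm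
  rcases eq_or_ne c 0 with rfl | hc0
  · exact zero_mem _
  obtain ⟨e, he, hf⟩ := w.exists_ramification f
  have h1 := (mem_filt_iff (by simpa using hc0)).1 (h c hc)
  rw [hf] at h1
  rw [mem_filt_iff hc0]
  by_contra hlt
  have : (e : ℤ) * vord (w.comap f).val c ≤ 0 :=
    mul_nonpos_of_nonneg_of_nonpos (by positivity) (by omega)
  omega

theorem Pl.comap_eq_of_vord (f : K →+* E) {w : Pl E} {v : Pl K} {e : ℕ} (he : e ≠ 0)
    (h : ∀ c : K, vord w.val (f c) = e * vord v.val c) : w.comap f = v := by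
  refine Pl.comap_eq_of_filt f fun c hc => ?_
  rcases eq_or_ne c 0 with rfl | hc0
  · simp
  rw [mem_filt_iff (by simpa using hc0), h]
  have := (mem_filt_iff hc0).1 hc
  have : (1 : ℤ) ≤ e := by omega
  nlinarith

theorem Pl.vord_comap_equiv (f : K ≃+* E) (w : Pl E) (c : K) :
    vord (w.comap (f : K →+* E)).val c = vord w.val (f c) := by
  obtain ⟨e, he, hf⟩ := w.exists_ramification (f : K →+* E)
  obtain ⟨π, hπ⟩ := w.exists_uniformizer
  have h1 := hf (f.symm π)
  rw [RingHom.coe_coe, RingEquiv.apply_symm_apply, hπ] at h1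
  have he1 : (e : ℤ) = 1 := Int.eq_one_of_mul_eq_one_right (by positivity) h1.symm
  have h2 := hf c
  rw [he1, one_mul] at h2
  exact h2.symm

theorem Pl.ext_vord {v v' : Pl K} (h : ∀ a : K, vord v.val a = vord v'.val a) : v = v' := by
  refine Pl.ext_of_filt fun a ha => ?_
  rcases eq_or_ne a 0 with rfl | hc0
  · simp
  rw [mem_filt_iff hc0] at ha ⊢
  rwa [← h]

end Places

end

section

open WithZero

/-- A Kummer extension `E / K` of prime degree `p` generated by a `p`-th root `γ` of `x`,
with its canonical automorphism `s`. -/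
structure Kum (p : ℕ) {K : Type*} (E : Type*) [Field K] [Field E] [Algebra K E] (ζ : K) (x : Kˣ)
    where
  γ : E
  s : E ≃ₐ[K] E
  prim : IsPrimitiveRoot ζ p
  not_pow : x ∉ pows p K
  pow_γ : γ ^ p = algebraMap K E x
  s_γ : s γ = algebraMap K E ζ * γ
  s_pow : s ^ p = 1
  fixed : ∀ y, s y = y → ∃ c, algebraMap K E c = y
  norm_eq : ∀ y, algebraMap K E (Algebra.norm K y) = ∏ i ∈ Finset.range p, (s ^ i) y
  adjoin_eq_top : Algebra.adjoin K {γ} = ⊤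

/-- The group of norms. -/
noncomputable abbrev norms (K E : Type*) [Field K] [Field E] [Algebra K E] : Subgroup Kˣ :=
  (Units.map (Algebra.norm K : E →* K)).range

theorem trace_polynomial (p : ℕ) [hp : Fact p.Prime] : ∃ Q : Polynomial ℤ,
    ∑ i ∈ Finset.range p, (Polynomial.X : Polynomial ℤ) ^ i =
      (Polynomial.X - 1) ^ (p - 1) + Polynomial.C (p : ℤ) * Q := by
  have h : Polynomial.C (p : ℤ) ∣ ∑ i ∈ Finset.range p, (Polynomial.X : Polynomial ℤ) ^ i -
      (Polynomial.X - 1) ^ (p - 1) := by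
    rw [Polynomial.C_dvd_iff_dvd_coeff]
    intro i
    rw [← ZMod.intCast_zmod_eq_zero_iff_dvd, ← eq_intCast (Int.castRingHom (ZMod p)), ← Polynomial.coeff_map]
    have : (∑ i ∈ Finset.range p, (Polynomial.X : Polynomial (ZMod p)) ^ i) =
        (Polynomial.X - 1) ^ (p - 1) := by
      have hne : (Polynomial.X - 1 : Polynomial (ZMod p)) ≠ 0 := by
        simpa using Polynomial.X_sub_C_ne_zero (1 : ZMod p)
      refine mul_right_cancel₀ hne ?_
      rw [geom_sum_mul, ← pow_succ, Nat.sub_add_cancel hp.out.one_le, sub_pow_char, one_pow]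
    rw [Polynomial.map_sub, Polynomial.map_pow, Polynomial.map_sum, Polynomial.map_sub,
      Polynomial.map_X, Polynomial.map_one]
    simp only [Polynomial.map_pow, Polynomial.map_X]
    rw [this, sub_self, Polynomial.coeff_zero]
  obtain ⟨Q, hQ⟩ := h
  exact ⟨Q, by rw [← hQ]; ring⟩

namespace Kum

variable {p : ℕ} [hp : Fact p.Prime] {K E : Type*} [Field K] [Field E] [Algebra K E] {ζ : K}
  {x : Kˣ} {v : Valuation K ℤᵐ⁰} {w : Valuation E ℤᵐ⁰}

theorem mem_filt_of_algebraMap_mem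
    (hvw : ∀ c : K, vord w (algebraMap K E c) = p * vord v c) {c : K} {n : ℤ} (h : algebraMap K E c ∈ filt w (p * n + 1)) :
    c ∈ filt v (n + 1) := by
  rcases eq_or_ne c 0 with rfl | hc
  · simp
  rw [mem_filt_iff ((map_ne_zero _).2 hc), hvw] at h
  rw [mem_filt_iff hc]
  have hpos : (0 : ℤ) < p := by exact_mod_cast hp.out.pos
  by_contra hlt
  push Not at hlt
  have : vord v c ≤ n := by omega
  nlinarith

variable (k : Kum p E ζ x)

theorem γ_ne_zero : k.γ ≠ 0 := by
  intro h
  have := k.pow_γ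
  rw [h, zero_pow hp.out.ne_zero] at this
  exact x.ne_zero ((map_eq_zero _).1 this.symm)

theorem s_pow_mod (n : ℕ) : k.s ^ (n % p) = k.s ^ n := by
  conv_rhs => rw [← Nat.div_add_mod n p, pow_add, pow_mul, k.s_pow, one_pow, one_mul]

/-- The trace lies in the base field. -/
theorem exists_trace (y : E) :
    ∃ c, algebraMap K E c = ∑ i ∈ Finset.range p, (k.s ^ i) y := by
  apply k.fixed
  rw [map_sum]
  have h := Finset.sum_range_succ' (fun i => (k.s ^ i) y) p
  rw [Finset.sum_range_succ] at h
  simp only [k.s_pow, pow_zero] at h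
  rw [add_right_cancel_iff] at h
  rw [h]
  refine Finset.sum_congr rfl fun i _ => ?_
  rw [pow_succ']; rfl

section Invariant

variable (hinv : ∀ y : E, vord w (k.s y) = vord w y)

include hinv

theorem vord_s_pow (i : ℕ) (y : E) : vord w ((k.s ^ i) y) = vord w y := by
  induction i with
  | zero => rfl
  | succ i ih =>
    rw [pow_succ', AlgEquiv.mul_apply, hinv, ih]

theorem s_pow_mem_filt (i : ℕ) {y : E} {m : ℤ} (hy : y ∈ filt w m) :
    (k.s ^ i) y ∈ filt w m := by
  rcases eq_or_ne y 0 with rfl | hy0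
  · simp
  rw [mem_filt_iff hy0] at hy
  rwa [mem_filt_iff ((map_ne_zero _).2 hy0), k.vord_s_pow hinv]

theorem vord_norm (y : E) (hy : y ≠ 0) :
    vord w (algebraMap K E (Algebra.norm K y)) = p * vord w y := by
  rw [k.norm_eq, vord_prod _ _ fun i _ => (map_ne_zero _).2 hy,
    Finset.sum_congr rfl fun i _ => k.vord_s_pow hinv i y]
  simp

/-- In the unramified inert case a uniformizer is not a norm. -/
theorem clos_norms_ne_top_of_inert (hvw : ∀ c : K, vord w (algebraMap K E c) = vord v c)
    {π : K} (hπ : vord v π = 1) : clos v (norms K E) ≠ ⊤ := by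
  intro htop
  have hπ0 : π ≠ 0 := by rintro rfl; simp [vord] at hπ
  have hle : clos v (norms K E) ≤ (ordModHom v p).ker := by
    refine (clos_le _ 0).trans (sup_le ?_ ?_)
    · rintro _ ⟨y, rfl⟩
      rw [mem_ker_ordModHom, ← hvw]
      change _ ∣ vord w (algebraMap K E (Algebra.norm K (y : E)))
      rw [k.vord_norm hinv _ y.ne_zero]
      exact dvd_mul_right _ _
    · rw [ker_ordModHom hπ]; exact le_sup_left
  have h1 : Units.mk0 π hπ0 ∈ (ordModHom v p).ker := hle (htop ▸ Subgroup.mem_top _)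
  rw [mem_ker_ordModHom, Units.val_mk0, hπ] at h1
  have := Int.le_of_dvd one_pos h1
  have := hp.out.two_le
  omega

section Ramified

variable (hvw : ∀ c : K, vord w (algebraMap K E c) = p * vord v c) {π : K} (hπ : vord v π = 1)
  (hf : ∀ y : E, vord w y = 0 → ∃ c : K, y - algebraMap K E c ∈ filt w 1)
  {ϖ : E} (hϖ : vord w ϖ = 1) {t : ℕ} (ht : k.s ϖ * ϖ⁻¹ - 1 ∈ filt w t)

include hvw hπ hf hϖ ht

theorem sub_mem_filt_aux (j : ℕ) (hj : j ≤ t) (m : ℤ) (y : E) (hy : y ∈ filt w m) :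
    k.s y - y ∈ filt w (m + j) := by
  have hϖ0 : ϖ ≠ 0 := by rintro rfl; simp [vord] at hϖ
  have hπ0 : π ≠ 0 := by rintro rfl; simp [vord] at hπ
  induction j generalizing m y with
  | zero =>
    have := k.s_pow_mem_filt hinv 1 hy
    rw [pow_one] at this
    simpa using sub_mem this hy
  | succ j ih =>
    rcases eq_or_ne y 0 with rfl | hy0
    · simp
    rw [mem_filt_iff hy0] at hy
    refine filt_mono (m := m + (j + 1 : ℕ)) (n := vord w y + (j + 1 : ℕ)) (by omega) ?_
    obtain ⟨i, l, hil⟩ : ∃ (i : ℕ) (l : ℤ), vord w y = i + p * l := by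
      have hpos : (0 : ℤ) < p := by exact_mod_cast hp.out.pos
      refine ⟨(vord w y % p).toNat, vord w y / p, ?_⟩
      rw [Int.toNat_of_nonneg (Int.emod_nonneg _ hpos.ne'), Int.emod_add_mul_ediv]
    set z : E := algebraMap K E (π ^ l) * ϖ ^ i with hz
    have hz1 : algebraMap K E (π ^ l) ≠ 0 := by
      rw [Ne, map_eq_zero]; exact zpow_ne_zero _ hπ0
    have hz0 : z ≠ 0 := mul_ne_zero hz1 (pow_ne_zero _ hϖ0)
    have hvz : vord w z = vord w y := by
      rw [hz, vord_mul hz1 (pow_ne_zero _ hϖ0), hvw, vord_zpow, hπ, vord_pow, hϖ, hil]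
      ring
    obtain ⟨c, hc⟩ := hf (y / z) (by rw [vord_div hy0 hz0, hvz, sub_self])
    have hcint : algebraMap K E c ∈ filt w 0 := by
      have h1 : y / z ∈ filt w 0 := by
        rw [mem_filt_iff (div_ne_zero hy0 hz0), vord_div hy0 hz0, hvz, sub_self]
      have := sub_mem h1 (filt_mono (by norm_num) hc)
      simpa using this
    have hy' : y - algebraMap K E c * z ∈ filt w (vord w y + 1) := by
      have := filt_mul hc (mem_filt_vord (v := w) z)
      rw [hvz, sub_mul, div_mul_cancel₀ _ hz0, add_comm] at this
      exact this
    have h1 := ih (by omega) _ _ hy'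
    have hu : (k.s ϖ * ϖ⁻¹) ^ i - 1 ∈ filt w t := by
      have hs0 : k.s ϖ * ϖ⁻¹ ≠ 0 := mul_ne_zero ((map_ne_zero _).2 hϖ0) (inv_ne_zero hϖ0)
      have : Units.mk0 _ hs0 ∈ punit w t := by
        refine ⟨?_, by simpa using ht⟩
        rw [Units.val_mk0, vord_mul ((map_ne_zero _).2 hϖ0) (inv_ne_zero hϖ0), hinv, vord_inv]
        ring
      have := (pow_mem this i).2
      simpa using this
    have h2 : k.s (algebraMap K E c * z) - algebraMap K E c * z ∈ filt w (vord w y + t) := by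
      have h3 := filt_mul (filt_mul hcint (mem_filt_vord (v := w) z)) hu
      rw [hvz, zero_add] at h3
      convert h3 using 1
      rw [hz, map_mul, map_mul, map_pow, AlgEquiv.commutes, AlgEquiv.commutes, mul_pow, inv_pow]
      field_simp
    have h3 := add_mem (filt_mono (n := vord w y + 1 + j) (m := vord w y + (j + 1 : ℕ))
      (by push_cast; omega) h1)
      (filt_mono (n := vord w y + t) (m := vord w y + (j + 1 : ℕ)) (by omega) h2)
    convert h3 using 1
    rw [map_sub]
    ring

theorem sub_mem_filt (m : ℤ) (y : E) (hy : y ∈ filt w m) : k.s y - y ∈ filt w (m + t) :=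
  k.sub_mem_filt_aux hinv hvw hπ hf hϖ ht t le_rfl m y hy

theorem natCast_p_mem_filt : (p : E) ∈ filt w (((p - 1 : ℕ) : ℤ) * t) := by
  have h1 : algebraMap K E ζ - 1 ∈ filt w t := by
    have := k.sub_mem_filt hinv hvw hπ hf hϖ ht _ _ (mem_filt_vord (v := w) k.γ)
    have := filt_mul this (mem_filt_vord (v := w) k.γ⁻¹)
    rw [vord_inv, k.s_γ] at this
    have hγ := k.γ_ne_zero
    convert this using 1
    · congr 1; ring
    · field_simp
  have hζ := k.prim.map_of_injective (algebraMap K E).injective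
  have hmem : (hζ.isUnit hp.out.ne_zero).unit ∈ punit w t :=
    ⟨vord_of_isPrimitiveRoot hζ, h1⟩
  rw [← prod_one_sub_pow hζ]
  have key : ∀ n : ℕ, ∏ i ∈ Finset.range n, (1 - (algebraMap K E ζ) ^ (i + 1)) ∈
      filt w ((n : ℤ) * t) := by
    intro n
    induction n with
    | zero => simpa using one_mem_filt
    | succ n ih =>
      rw [Finset.prod_range_succ]
      have h2 := neg_mem (pow_mem hmem (n + 1)).2
      have := filt_mul ih h2
      convert this using 1
      · congr 1; push_cast; ring
      · simp
  exact key _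

theorem trace_mem_filt (m : ℤ) (y : E) (hy : y ∈ filt w m) :
    ∑ i ∈ Finset.range p, (k.s ^ i) y ∈ filt w (m + ((p - 1 : ℕ) : ℤ) * t) := by
  obtain ⟨Q, hQ⟩ := trace_polynomial p
  let S : Module.End ℤ E := (k.s : E →+ E).toIntLinearMap
  have hSp : ∀ (i : ℕ) (z : E), (S ^ i) z = (k.s ^ i) z := by
    intro i z
    induction i with
    | zero => rfl
    | succ i ih => rw [pow_succ', pow_succ', Module.End.mul_apply, ih]; rfl
  have hS : ∀ (R : Polynomial ℤ) (n : ℤ) (z : E), z ∈ filt w n → Polynomial.aeval S R z ∈ filt w n := by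
    intro R n z hz
    rw [Polynomial.aeval_eq_sum_range, LinearMap.sum_apply]
    refine sum_mem fun i _ => ?_
    rw [LinearMap.smul_apply, hSp]
    exact zsmul_mem (k.s_pow_mem_filt hinv i hz) _
  have hS1 : ∀ j : ℕ, ((S - 1) ^ j) y ∈ filt w (m + (j : ℤ) * t) := by
    intro j
    induction j with
    | zero => simpa using hy
    | succ j ih =>
      rw [pow_succ', Module.End.mul_apply]
      have := k.sub_mem_filt hinv hvw hπ hf hϖ ht _ _ ih
      have h2 : m + ((j + 1 : ℕ) : ℤ) * t = m + j * t + t := by push_cast; ring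
      rw [h2]
      exact this
  have h := congrArg (fun P => Polynomial.aeval S P y) hQ
  simp only [map_sum, map_pow, Polynomial.aeval_X, map_add, map_sub, map_one, map_mul,
    Polynomial.aeval_C, LinearMap.sum_apply, hSp, LinearMap.add_apply] at h
  rw [h]
  refine add_mem (hS1 _) ?_
  rw [Module.End.mul_apply, Module.algebraMap_end_apply, zsmul_eq_mul, add_comm]
  push_cast
  exact filt_mul (k.natCast_p_mem_filt hinv hvw hπ hf hϖ ht) (hS Q _ _ hy)

theorem exists_trace_mem_filt {y : E} (hy : y ∈ filt w (t + 1)) :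
    ∑ i ∈ Finset.range p, (k.s ^ i) y ∈ filt w (p * t + 1) := by
  have h := k.trace_mem_filt hinv hvw hπ hf hϖ ht _ _ hy
  have h2 : (t : ℤ) + 1 + ((p - 1 : ℕ) : ℤ) * t = p * t + 1 := by
    rw [Nat.cast_sub hp.out.one_le]; push_cast; ring
  rwa [h2] at h

theorem esymm_mem_filt (ht0 : t ≠ 0) {y : E} (hy : y ∈ filt w (t + 1)) {j : ℕ} (hj0 : j ≠ 0)
    (hj : j < p) :
    ∑ I ∈ Finset.powersetCard j (Finset.univ : Finset (Fin p)), ∏ i ∈ I, (k.s ^ (i : ℕ)) y ∈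
      filt w (p * t + 1) := by
  have hy0 : y ∈ filt w 0 := filt_mono (by positivity) hy
  have hsy : ∀ i : Fin p, (k.s ^ (i : ℕ)) y ∈ filt w 0 := fun i => k.s_pow_mem_filt hinv _ hy0
  have hN := congrArg (MvPolynomial.aeval (fun i : Fin p => (k.s ^ (i : ℕ)) y))
    (MvPolynomial.mul_esymm_eq_sum (Fin p) ℤ j)
  simp only [map_mul, map_natCast, map_sum, map_pow, map_neg, map_one] at hN
  have hes : ∀ n, MvPolynomial.aeval (fun i : Fin p => (k.s ^ (i : ℕ)) y)
      (MvPolynomial.esymm (Fin p) ℤ n) =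
      ∑ I ∈ Finset.powersetCard n (Finset.univ : Finset (Fin p)), ∏ i ∈ I, (k.s ^ (i : ℕ)) y := by
    intro n
    simp [MvPolynomial.esymm]
  have hps : ∀ n, MvPolynomial.aeval (fun i : Fin p => (k.s ^ (i : ℕ)) y)
      (MvPolynomial.psum (Fin p) ℤ n) = ∑ i ∈ Finset.range p, (k.s ^ i) (y ^ n) := by
    intro n
    simp [MvPolynomial.psum, Finset.sum_range]
  simp only [hes, hps] at hN
  set e := ∑ I ∈ Finset.powersetCard j (Finset.univ : Finset (Fin p)),
    ∏ i ∈ I, (k.s ^ (i : ℕ)) y with he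
  have hes0 : ∀ n, ∑ I ∈ Finset.powersetCard n (Finset.univ : Finset (Fin p)),
    ∏ i ∈ I, (k.s ^ (i : ℕ)) y ∈ filt w 0 := fun n =>
      sum_mem fun I _ => filt_prod _ _ fun i _ => hsy i
  have hje : (j : E) * e ∈ filt w (p * t + 1) := by
    rw [hN]
    have hneg : ∀ m : ℕ, (-1 : E) ^ m ∈ filt w 0 := fun m => by
      simpa using intCast_mem_filt (v := w) ((-1) ^ m)
    rw [← zero_add ((p : ℤ) * t + 1)]
    refine filt_mul (hneg _) (sum_mem fun a ha => ?_)
    rw [← zero_add ((p : ℤ) * t + 1)]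
    rw [Finset.mem_filter, Finset.HasAntidiagonal.mem_antidiagonal] at ha
    refine filt_mul ?_ (k.exists_trace_mem_filt hinv hvw hπ hf hϖ ht ?_)
    · simpa using filt_mul (hneg a.1) (hes0 a.1)
    · obtain ⟨m, hm⟩ : ∃ m, a.2 = m + 1 := ⟨a.2 - 1, by have := ha.1; have := ha.2; omega⟩
      rw [hm, pow_succ]
      have := filt_mul (filt_pow hy0 m) hy
      simpa using this
  have hp1 : (p : E) ∈ filt w 1 := by
    refine filt_mono ?_ (k.natCast_p_mem_filt hinv hvw hπ hf hϖ ht)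
    have : 1 ≤ (p - 1) * t := Nat.mul_pos (by have := hp.out.two_le; omega)
      (Nat.pos_of_ne_zero ht0)
    exact_mod_cast this
  rcases eq_or_ne e 0 with he0 | he0
  · simp [he0]
  have hcop : Nat.Coprime p j := Nat.coprime_of_lt_prime hj0 hj hp.out
  have hjE : (j : E) ∉ filt w 1 := by
    intro hj1
    have h1 : (1 : E) ∈ filt w 1 := by
      have hb := Nat.gcd_eq_gcd_ab p j
      rw [hcop.gcd_eq_one] at hb
      have hb' : (1 : E) = p * (Nat.gcdA p j : ℤ) + j * (Nat.gcdB p j : ℤ) := by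
        have := congrArg (Int.cast : ℤ → E) hb
        push_cast at this
        exact this
      rw [hb']
      refine add_mem ?_ ?_
      · simpa using filt_mul hp1 (intCast_mem_filt (v := w) (Nat.gcdA p j))
      · simpa using filt_mul hj1 (intCast_mem_filt (v := w) (Nat.gcdB p j))
    rw [mem_filt_iff one_ne_zero, vord_one] at h1
    omega
  have hjE0 : (j : E) ≠ 0 := by rintro h; rw [h] at hjE; exact hjE (zero_mem _)
  have hjv : vord w (j : E) = 0 := by
    have h0 := natCast_mem_filt (v := w) j
    rw [mem_filt_iff hjE0] at h0 hjE
    omega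
  rw [mem_filt_iff (mul_ne_zero hjE0 he0), vord_mul hjE0 he0, hjv, zero_add] at hje
  rwa [mem_filt_iff he0]

theorem norm_one_add_mem {y : E} (hy : y ∈ filt w (t + 1)) :
    Algebra.norm K (1 + y) - 1 ∈ filt v (t + 1) := by
  apply mem_filt_of_algebraMap_mem hvw
  rw [map_sub, map_one, k.norm_eq]
  simp only [map_add, map_one]
  rcases Nat.eq_zero_or_pos t with rfl | ht0
  · have hy1 : ∀ i, (k.s ^ i) y ∈ filt w 1 := fun i => k.s_pow_mem_filt hinv i (by simpa using hy)
    have : ∀ n : ℕ, ∏ i ∈ Finset.range n, (1 + (k.s ^ i) y) - 1 ∈ filt w 1 := by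
      intro n
      induction n with
      | zero => simp
      | succ n ih =>
        have h0 : ∏ i ∈ Finset.range n, (1 + (k.s ^ i) y) ∈ filt w 0 := by
          have := add_mem (filt_mono (by norm_num) ih) (one_mem_filt (v := w))
          simpa using this
        have := add_mem ih (filt_mul h0 (hy1 n))
        rw [Finset.prod_range_succ]
        convert this using 1
        ring
    simpa using this p
  · have hp0 : p = (p - 1) + 1 := by have := hp.out.pos; omega
    rw [← Fin.prod_univ_eq_prod_range (fun i => 1 + (k.s ^ i) y), Finset.prod_one_add,
      Finset.sum_powerset, Finset.card_univ, Fintype.card_fin, Finset.sum_range_succ']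
    have h0 : ∑ I ∈ Finset.powersetCard 0 (Finset.univ : Finset (Fin p)),
        ∏ i ∈ I, (k.s ^ (i : ℕ)) y = 1 := by simp
    rw [h0, add_sub_cancel_right]
    refine sum_mem fun j hj => ?_
    rw [Finset.mem_range] at hj
    rcases Nat.lt_or_ge (j + 1) p with hj' | hj'
    · exact k.esymm_mem_filt hinv hvw hπ hf hϖ ht ht0.ne' hy (Nat.succ_ne_zero _) hj'
    · have hjp : j + 1 = p := le_antisymm hj hj'
      have : Finset.powersetCard (j + 1) (Finset.univ : Finset (Fin p)) = {Finset.univ} := by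
        have hs := Finset.powersetCard_self (Finset.univ : Finset (Fin p))
        rw [Finset.card_univ, Fintype.card_fin] at hs
        rw [hjp, hs]
      rw [this, Finset.sum_singleton]
      have key : ∀ n : ℕ, ∏ i ∈ Finset.range n, (k.s ^ i) y ∈ filt w (n * (t + 1)) := by
        intro n
        induction n with
        | zero => simpa using one_mem_filt
        | succ n ih =>
          have := filt_mul ih (k.s_pow_mem_filt hinv n hy)
          rw [Finset.prod_range_succ]
          refine filt_mono (le_of_eq ?_) this
          push_cast; ring
      rw [Fin.prod_univ_eq_prod_range (fun i => (k.s ^ i) y)]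
      refine filt_mono ?_ (key p)
      have := hp.out.pos
      have : (1 : ℤ) ≤ p := by exact_mod_cast this
      nlinarith

end Ramified

/-- If `v` is totally ramified in `E` then the local norm group is a proper subgroup. -/
theorem clos_norms_ne_top_of_ramified (hvw : ∀ c : K, vord w (algebraMap K E c) = p * vord v c)
    {π : K} (hπ : vord v π = 1)
    (hf : ∀ y : E, vord w y = 0 → ∃ c : K, y - algebraMap K E c ∈ filt w 1)
    {ϖ : E} (hϖ : vord w ϖ = 1) (hq : qres v ≠ 0) : clos v (norms K E) ≠ ⊤ := by
  intro htop
  have hϖ0 : ϖ ≠ 0 := by rintro rfl; simp [vord] at hϖ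
  have hsϖ0 : k.s ϖ ≠ 0 := (map_ne_zero _).2 hϖ0
  set η : Eˣ := Units.mk0 (k.s ϖ) hsϖ0 * (Units.mk0 ϖ hϖ0)⁻¹ with hη
  have hη0 : vord w (η : E) = 0 := by
    simp only [hη, Units.val_mul, Units.val_mk0, Units.val_inv_eq_inv_val]
    rw [vord_mul hsϖ0 (inv_ne_zero hϖ0), hinv, vord_inv]
    ring
  have hη1 : (η : E) - 1 ≠ 0 := by
    intro h
    have h1 : k.s ϖ = ϖ := by
      rw [sub_eq_zero] at h
      simp only [hη, Units.val_mul, Units.val_mk0, Units.val_inv_eq_inv_val] at h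
      exact (mul_inv_eq_one₀ hϖ0).1 h
    obtain ⟨c, rfl⟩ := k.fixed _ h1
    rw [hvw] at hϖ
    have := Int.le_of_dvd one_pos (Dvd.intro _ hϖ)
    have := hp.out.two_le
    omega
  have hη2 : (η : E) - 1 ∈ filt w 0 := by
    refine sub_mem ?_ one_mem_filt
    rw [mem_filt_iff η.ne_zero, hη0]
  obtain ⟨t, ht⟩ : ∃ t : ℕ, vord w ((η : E) - 1) = t := by
    rw [mem_filt_iff hη1] at hη2
    exact ⟨_, (Int.toNat_of_nonneg hη2).symm⟩
  have ht1 : k.s ϖ * ϖ⁻¹ - 1 ∈ filt w t := by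
    have := mem_filt_vord (v := w) ((η : E) - 1)
    rw [ht] at this
    simpa [hη] using this
  have ht2 : η ∉ punit w (t + 1) := by
    rintro ⟨-, h⟩
    rw [mem_filt_iff hη1, ht] at h
    push_cast at h
    omega
  let N : Eˣ →* Kˣ := Units.map (Algebra.norm K : E →* K)
  have hNord : ∀ y : Eˣ, vord v (N y : K) = vord w (y : E) := by
    intro y
    have := k.vord_norm hinv (y : E) y.ne_zero
    rw [hvw] at this
    exact mul_left_cancel₀ (by exact_mod_cast hp.out.ne_zero) this
  have hNη : N η = 1 := by
    have hinvol : ∀ z : Eˣ, N (Units.map (k.s : E →* E) z) = N z := by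
      intro z
      ext
      apply (algebraMap K E).injective
      have h := k.norm_eq (k.s z)
      have h2 := k.norm_eq z
      have h3 := Finset.prod_range_succ' (fun i => (k.s ^ i) (z : E)) p
      rw [Finset.prod_range_succ] at h3
      simp only [k.s_pow, pow_zero] at h3
      have h4 := mul_right_cancel₀ (by exact z.ne_zero) h3
      change algebraMap K E (Algebra.norm K (k.s z)) = algebraMap K E (Algebra.norm K (z : E))
      rw [h, h2, h4]
      refine Finset.prod_congr rfl fun i _ => ?_
      rw [pow_succ]; rfl
    have : η = Units.map (k.s : E →* E) (Units.mk0 ϖ hϖ0) * (Units.mk0 ϖ hϖ0)⁻¹ := by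
      rw [hη]; congr 1; ext; rfl
    rw [this, map_mul, map_inv, hinvol, mul_inv_cancel]
  have hAA : (punit w (t + 1)).map N ≤ punit v (t + 1) := by
    rintro _ ⟨y, hy, rfl⟩
    refine ⟨by rw [hNord]; exact hy.1, ?_⟩
    have h := k.norm_one_add_mem hinv hvw hπ hf hϖ ht1 (y := (y : E) - 1) (by exact_mod_cast hy.2)
    rw [add_sub_cancel] at h
    exact_mod_cast h
  have hBB : (punit w 0).map N ⊔ punit v (t + 1) = punit v 0 := by
    apply le_antisymm
    · refine sup_le ?_ (punit_anti (Nat.zero_le _))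
      rintro _ ⟨y, hy, rfl⟩
      rw [mem_punit_zero, hNord]
      exact hy.1
    · intro u hu
      have h1 : u ∈ clos v (norms K E) := htop ▸ Subgroup.mem_top _
      rw [mem_clos] at h1
      obtain ⟨_, ⟨y, rfl⟩, hy⟩ := h1 (t + 1)
      have hy2 := punit_anti (Nat.zero_le _) hy
      have hNy : N y ∈ punit v 0 := by
        have := mul_mem (inv_mem hy2) hu
        simpa [N] using this
      rw [mem_punit_zero, hNord] at hNy
      have := Subgroup.mul_mem_sup (Subgroup.mem_map_of_mem N (mem_punit_zero.2 hNy)) hy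
      simpa [N] using this
  -- comparison of the indices
  let i : K →+ E := (algebraMap K E : K →+ E)
  have hpp : (0 : ℤ) < p := by exact_mod_cast hp.out.pos
  have hi : ∀ n : ℤ, n ∈ ({0, 1} : Set ℤ) → (filt w n).comap i = filt v n := by
    intro n hn
    ext c
    rw [AddSubgroup.mem_comap]
    change algebraMap K E c ∈ filt w n ↔ _
    rcases eq_or_ne c 0 with rfl | hc
    · simp
    rw [mem_filt_iff ((map_ne_zero _).2 hc), mem_filt_iff hc, hvw]
    rcases hn with rfl | hn
    · constructor
      · intro h; by_contra h'; push Not at h'; nlinarith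
      · intro h; positivity
    · rw [Set.mem_singleton_iff] at hn
      subst hn
      constructor
      · intro h; by_contra h'; push Not at h'; nlinarith
      · intro h; nlinarith
  have hmap : (filt v 0).map i ⊔ filt w 1 = filt w 0 := by
    apply le_antisymm
    · refine sup_le ?_ (filt_mono (by norm_num))
      rw [AddSubgroup.map_le_iff_le_comap, hi 0 (by simp)]
    · intro y hy
      by_cases hy1 : y ∈ filt w 1
      · exact AddSubgroup.mem_sup_right hy1
      have hy0 : y ≠ 0 := by rintro rfl; exact hy1 (zero_mem _)
      have hvy : vord w y = 0 := by
        rw [mem_filt_iff hy0] at hy hy1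
        omega
      obtain ⟨c, hc⟩ := hf y hvy
      have hc0 : c ∈ filt v 0 := by
        rw [← hi 0 (by simp), AddSubgroup.mem_comap]
        have := sub_mem hy (filt_mono (show (0 : ℤ) ≤ 1 by norm_num) hc)
        simpa [i] using this
      have := AddSubgroup.add_mem_sup (AddSubgroup.mem_map_of_mem i hc0) hc
      simpa [i] using this
  have hqq : qres w = qres v := by
    unfold qres
    rw [← hi 1 (by simp), AddSubgroup.relIndex_comap]
    have := AddSubgroup.relIndex_sup_right ((filt v 0).map i) (filt w 1)
    rw [hmap] at this
    exact this
  let I : Kˣ →* Eˣ := Units.map (algebraMap K E : K →* E)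
  have hI : (punit w 1).comap I = punit v 1 := by
    ext u
    rw [Subgroup.mem_comap, mem_punit_iff one_ne_zero, mem_punit_iff one_ne_zero]
    have : ((I u : Eˣ) : E) - 1 = i ((u : K) - 1) := by simp [I, i]
    rw [this, ← AddSubgroup.mem_comap]
    push_cast
    rw [hi 1 (by simp)]
  have hImap : (punit v 0).map I ⊔ punit w 1 = punit w 0 := by
    apply le_antisymm
    · refine sup_le ?_ (punit_anti (Nat.zero_le _))
      rintro _ ⟨u, hu, rfl⟩
      rw [mem_punit_zero]
      change vord w (algebraMap K E u) = 0
      rw [hvw, mem_punit_zero.1 hu, mul_zero]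
    · intro y hy
      obtain ⟨c, hc⟩ := hf y hy.1
      have hvy := hy.1
      obtain ⟨hc0, hcv⟩ := vord_eq_of_sub_mem (v := w) (x := (y : E)) (y := algebraMap K E c) y.ne_zero
        (by rw [hvy, ← neg_mem_iff]; simpa using hc)
      have hc0' : c ≠ 0 := by rintro rfl; simp at hc0
      have hcu : Units.mk0 c hc0' ∈ punit v 0 := by
        rw [mem_punit_zero, Units.val_mk0]
        rw [hvw, hvy] at hcv
        exact (mul_eq_zero.1 hcv).resolve_left hpp.ne'
      have h2 : y * (I (Units.mk0 c hc0'))⁻¹ ∈ punit w 1 := by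
        apply div_mem_punit one_ne_zero
        have : ((I (Units.mk0 c hc0') : Eˣ) : E) = algebraMap K E c := rfl
        rw [this, hcv, hvy]
        simpa using hc
      have := Subgroup.mul_mem_sup (Subgroup.mem_map_of_mem I hcu) h2
      simpa using this
  have hrel1 : (punit w 1).relIndex (punit w 0) = (punit v 1).relIndex (punit v 0) := by
    rw [← hI, Subgroup.relIndex_comap]
    have := relIndex_sup_eq ((punit v 0).map I) (punit w 1)
    rw [hImap] at this
    exact this
  have hrel : (punit w (t + 1)).relIndex (punit w 0) = (punit v (t + 1)).relIndex (punit v 0) := by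
    rw [← Subgroup.relIndex_mul_relIndex _ _ _ (punit_anti (Nat.le_add_left 1 t))
      (punit_anti (Nat.zero_le 1)), ← Subgroup.relIndex_mul_relIndex (punit v (t + 1)) _ _
      (punit_anti (Nat.le_add_left 1 t)) (punit_anti (Nat.zero_le 1)), hrel1,
      add_comm t 1, relIndex_punit_pow hπ one_ne_zero, relIndex_punit_pow hϖ one_ne_zero, hqq]
  have hfin : (punit v (t + 1)).relIndex (punit v 0) ≠ 0 := relIndex_punit_zero_ne_zero hq hπ _
  have hC : ((punit v (t + 1)).comap N).relIndex (punit w 0) =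
      (punit w (t + 1)).relIndex (punit w 0) := by
    rw [hrel, Subgroup.relIndex_comap]
    have := relIndex_sup_eq ((punit w 0).map N) (punit v (t + 1))
    rw [hBB] at this
    exact this.symm
  have hle1 : punit w (t + 1) ≤ (punit v (t + 1)).comap N ⊓ punit w 0 :=
    le_inf (Subgroup.map_le_iff_le_comap.1 hAA) (punit_anti (Nat.zero_le _))
  have h3 := Subgroup.relIndex_mul_relIndex _ _ _ hle1 inf_le_right
  rw [Subgroup.inf_relIndex_right, hC] at h3
  have h4 : (punit w (t + 1)).relIndex ((punit v (t + 1)).comap N ⊓ punit w 0) = 1 := by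
    rw [← hrel] at hfin
    exact Nat.eq_of_mul_eq_mul_right (Nat.pos_of_ne_zero hfin) (by rw [h3, one_mul])
  rw [Subgroup.relIndex_eq_one] at h4
  refine ht2 (h4 ⟨?_, mem_punit_zero.2 hη0⟩)
  change N η ∈ punit v (t + 1)
  rw [hNη]
  exact one_mem _

/-- Outside the primes dividing `p` a unit radicand cannot ramify totally. -/
theorem vord_natCast_ne_zero_of_residue
    (hf : ∀ y : E, vord w y = 0 → ∃ c : K, y - algebraMap K E c ∈ filt w 1)
    (hγ : vord w k.γ = 0) : vord w (p : E) ≠ 0 := by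
  intro hp0
  have hζ := k.prim.map_of_injective (algebraMap K E).injective
  obtain ⟨c, hc⟩ := hf _ hγ
  have h1 := k.s_pow_mem_filt hinv 1 hc
  rw [pow_one, map_sub, k.s.commutes, k.s_γ] at h1
  have h2 := sub_mem h1 hc
  have h3 := filt_mul h2 (mem_filt_vord (v := w) k.γ⁻¹)
  rw [vord_inv, hγ] at h3
  have h4 : (1 : E) - algebraMap K E ζ ^ (0 + 1) ∈ filt w 1 := by
    rw [← neg_mem_iff]
    have hγ0 := k.γ_ne_zero
    have h5 : algebraMap K E ζ * k.γ - algebraMap K E c - (k.γ - algebraMap K E c) =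
      (algebraMap K E ζ - 1) * k.γ := by ring
    rw [h5, mul_assoc, mul_inv_cancel₀ hγ0, neg_zero, add_zero] at h3
    rw [zero_add, pow_one, neg_sub]
    simpa using h3
  have hlt : 0 < p - 1 := by have := hp.out.two_le; omega
  rw [mem_filt_iff (pow_ne_one_of_lt hζ hlt)] at h4
  have := vord_one_sub_pow_le (v := w) hζ hlt
  omega

/-- If `x` is locally a `p`-th power then `w` is not invariant. -/
theorem not_mem_clos_pows {e : ℕ} (he : e ≠ 0)
    (hvw : ∀ c : K, vord w (algebraMap K E c) = e * vord v c) (hp0 : (p : K) ≠ 0) :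
    x ∉ clos v (pows p K) := by
  intro hx
  have hζ := k.prim.map_of_injective (algebraMap K E).injective
  have hpE : (p : E) ≠ 0 := by
    have := (map_ne_zero (algebraMap K E)).2 hp0
    simpa using this
  have hvp : 0 ≤ vord w (p : E) := by
    rw [← mem_filt_iff hpE]; exact natCast_mem_filt p
  rw [mem_clos] at hx
  obtain ⟨_, hh, hu⟩ := hx (p * (vord w (p : E)).toNat + 1)
  obtain ⟨y, rfl⟩ := mem_pows.1 hh
  set u := x * (y ^ p)⁻¹ with hu'
  have hy0 : algebraMap K E (y : K) ≠ 0 := (map_ne_zero _).2 y.ne_zero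
  set g := k.γ / algebraMap K E (y : K) with hg
  have hg0 : g ≠ 0 := div_ne_zero k.γ_ne_zero hy0
  have hgp : g ^ p = algebraMap K E (u : K) := by
    rw [hg, div_pow, k.pow_γ, hu']
    simp [div_eq_mul_inv]
  have h1 : g ^ p - 1 ∈ filt w (p * (vord w (p : E)).toNat + 1) := by
    have h2 := hu.2
    have h3 : g ^ p - 1 = algebraMap K E ((u : K) - 1) := by rw [hgp]; simp
    rw [h3]
    rcases eq_or_ne ((u : K) - 1) 0 with h0 | h0
    · simp [h0]
    rw [mem_filt_iff h0] at h2
    rw [mem_filt_iff ((map_ne_zero _).2 h0), hvw]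
    have he1 : (1 : ℤ) ≤ e := by exact_mod_cast Nat.one_le_iff_ne_zero.2 he
    push_cast at h2
    have : 0 ≤ (p : ℤ) * (vord w (p : E)).toNat := by positivity
    nlinarith
  obtain ⟨i, hi⟩ := exists_close_root hζ (by rw [Int.toNat_of_nonneg hvp]; omega) h1
  have h2 := k.s_pow_mem_filt hinv 1 hi
  have hsg : k.s g = algebraMap K E ζ * g := by
    rw [hg, map_div₀, k.s_γ, k.s.commutes]; ring
  rw [pow_one, map_sub, map_pow, k.s.commutes, hsg] at h2
  have h3 := sub_mem hi h2
  have hvg : vord w g = 0 := by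
    have h4 := congrArg (vord w) hgp
    rw [vord_pow, hvw, hu.1, mul_zero] at h4
    exact (mul_eq_zero.1 h4).resolve_left (by exact_mod_cast hp.out.ne_zero)
  have hlt : 0 < p - 1 := by have := hp.out.two_le; omega
  have h4 := filt_mul h3 (mem_filt_vord (v := w) g⁻¹)
  rw [vord_inv, hvg] at h4
  have h5 : (1 : E) - algebraMap K E ζ ^ (0 + 1) ∈ filt w (vord w (p : E) + 1) := by
    rw [neg_zero, add_zero] at h4
    convert h4 using 1
    have h6 : g - algebraMap K E ζ ^ i - (algebraMap K E ζ * g - algebraMap K E ζ ^ i) =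
      (1 - algebraMap K E ζ) * g := by ring
    rw [h6, mul_assoc, mul_inv_cancel₀ hg0]
    ring
  rw [mem_filt_iff (pow_ne_one_of_lt hζ hlt)] at h5
  have := vord_one_sub_pow_le (v := w) hζ hlt
  omega

end Invariant

end Kum

end

section

open NumberField IsDedekindDomain WithZero

namespace Kum

variable {p : ℕ} [hp : Fact p.Prime] {K E : Type*} [Field K] [Field E] [NumberField K]
  [NumberField E] [Algebra K E] {ζ : K} {x : Kˣ} (k : Kum p E ζ x)

include k in
theorem finrank_eq : Module.finrank K E = p := by
  have h := k.norm_eq (algebraMap K E 2)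
  rw [Algebra.norm_algebraMap, Finset.prod_congr rfl fun i _ => (k.s ^ i).commutes 2,
    Finset.prod_const, Finset.card_range, ← map_pow] at h
  have h2 : ((2 ^ Module.finrank K E : ℕ) : K) = ((2 ^ p : ℕ) : K) := by
    push_cast
    exact (algebraMap K E).injective h
  exact Nat.pow_right_injective le_rfl (Nat.cast_injective h2)

/-- The finite place is stable under the Galois group. -/
def Inv (w : Pl E) : Prop := ∀ y, vord w.val (k.s y) = vord w.val y

/-- The conjugates of a finite place. -/
noncomputable def conj (i : ℕ) (w : Pl E) : Pl E := w.comap ((k.s ^ i : E ≃ₐ[K] E) : E →+* E)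

theorem vord_conj (i : ℕ) (w : Pl E) (y : E) :
    vord (k.conj i w).val y = vord w.val ((k.s ^ i) y) :=
  Pl.vord_comap_equiv ((k.s ^ i : E ≃ₐ[K] E) : E ≃+* E) w y

theorem conj_zero (w : Pl E) : k.conj 0 w = w :=
  Pl.ext_vord fun a => by rw [vord_conj]; rfl

theorem conj_conj (i j : ℕ) (w : Pl E) : k.conj i (k.conj j w) = k.conj (j + i) w :=
  Pl.ext_vord fun a => by rw [vord_conj, vord_conj, vord_conj, pow_add]; rfl

theorem conj_mod (i : ℕ) (w : Pl E) : k.conj (i % p) w = k.conj i w :=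
  Pl.ext_vord fun a => by rw [vord_conj, vord_conj, k.s_pow_mod]

theorem inv_iff (w : Pl E) : k.Inv w ↔ k.conj 1 w = w := by
  constructor
  · exact fun h => Pl.ext_vord fun a => by rw [vord_conj, pow_one, h]
  · intro h y
    rw [← pow_one k.s, ← vord_conj, h]

theorem conj_of_inv {w : Pl E} (h : k.Inv w) (i : ℕ) : k.conj i w = w :=
  Pl.ext_vord fun a => by rw [vord_conj, k.vord_s_pow h]

theorem inv_of_conj_eq {w : Pl E} {i : ℕ} (hi : ¬ p ∣ i) (h : k.conj i w = w) : k.Inv w := by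
  rw [inv_iff]
  have h1 : ∀ n : ℕ, k.conj (i * n) w = w := by
    intro n
    induction n with
    | zero => rw [mul_zero, conj_zero]
    | succ n ih => rw [mul_add, mul_one, ← conj_conj, ih, h]
  have hc : Nat.Coprime i p := (Nat.Coprime.symm ((Nat.Prime.coprime_iff_not_dvd hp.out).2 hi))
  obtain ⟨j, -, hj⟩ := Nat.exists_mul_mod_eq_one_of_coprime hc hp.out.one_lt
  rw [← hj, k.conj_mod, h1]

theorem conj_injective {w : Pl E} (h : ¬ k.Inv w) {i j : ℕ} (hi : i < p) (hj : j < p)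
    (hij : k.conj i w = k.conj j w) : i = j := by
  by_contra hne
  apply h
  have h2 : k.conj (p - j + i) w = w := by
    rw [add_comm, ← conj_conj, hij, conj_conj, Nat.add_sub_cancel' hj.le, ← k.conj_mod, Nat.mod_self, conj_zero]
  refine k.inv_of_conj_eq ?_ h2
  intro hd
  rcases Nat.lt_or_ge i j with hlt | hge
  · exact absurd (Nat.le_of_dvd (by omega) hd) (by omega)
  · have h3 : p ∣ i - j := by
      have : p - j + i = p + (i - j) := by omega
      rw [this] at hd
      exact (Nat.dvd_add_right (dvd_refl p)).1 hd
    exact absurd (Nat.le_of_dvd (by omega) h3) (by omega)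

/-- The place below. -/
abbrev _root_.Pl.below (K : Type*) {E : Type*} [Field K] [NumberField K] [Field E] [NumberField E]
    [Algebra K E] (w : Pl E) : Pl K := w.comap (algebraMap K E)

theorem below_conj (i : ℕ) (w : Pl E) : (k.conj i w).below K = w.below K := by
  obtain ⟨e, he, h⟩ := (k.conj i w).exists_ramification (algebraMap K E)
  refine (Pl.comap_eq_of_vord (algebraMap K E) (w := w) he fun c => ?_).symm
  rw [← h c, vord_conj, (k.s ^ i).commutes]

theorem exists_conj_eq {w w' : Pl E} (h : w.below K = w'.below K) : ∃ i < p, k.conj i w = w' := by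
  classical
  by_contra hcon
  push Not at hcon
  let S : Finset (Pl E) := (Finset.range p).image (fun i => k.conj i w) ∪
    (Finset.range p).image (fun i => k.conj i w')
  have hdis : ∀ i j, k.conj i w ≠ k.conj j w' := by
    intro i j hij
    have h1 : k.conj (i + (p - j % p)) w = w' := by
      rw [← conj_conj, hij, ← k.conj_mod j, conj_conj,
        Nat.add_sub_cancel' (Nat.mod_lt _ hp.out.pos).le, ← k.conj_mod, Nat.mod_self, conj_zero]
    rw [← k.conj_mod] at h1
    exact hcon _ (Nat.mod_lt _ hp.out.pos) h1
  obtain ⟨z, hz⟩ := Pl.exists_approx S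
    (fun u => if u ∈ (Finset.range p).image (fun i => k.conj i w) then 1 else 0) 1
  have hz1 : ∀ i < p, z - 1 ∈ filt (k.conj i w).val 1 := by
    intro i hi
    have hm : k.conj i w ∈ (Finset.range p).image (fun i => k.conj i w) :=
      Finset.mem_image_of_mem (fun i => k.conj i w) (Finset.mem_range.2 hi)
    have := hz _ (Finset.mem_union_left _ hm)
    rwa [if_pos hm] at this
  have hz2 : ∀ i < p, z ∈ filt (k.conj i w').val 1 := by
    intro i hi
    have hm : k.conj i w' ∈ (Finset.range p).image (fun i => k.conj i w') :=
      Finset.mem_image_of_mem (fun i => k.conj i w') (Finset.mem_range.2 hi)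
    have := hz _ (Finset.mem_union_right _ hm)
    rwa [if_neg, sub_zero] at this
    rw [Finset.mem_image]
    rintro ⟨j, -, hj⟩
    exact hdis _ _ hj
  have hz0 : z ≠ 0 := (vord_eq_of_sub_mem (v := (k.conj 0 w).val) one_ne_zero
    (by rw [vord_one]; exact hz1 0 hp.out.pos)).1
  have hN := k.norm_eq z
  have hne : ∀ i ∈ Finset.range p, (k.s ^ i) z ≠ 0 := fun i _ => (map_ne_zero _).2 hz0
  have e1 : vord w.val (algebraMap K E (Algebra.norm K z)) = 0 := by
    rw [hN, vord_prod _ _ hne]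
    refine Finset.sum_eq_zero fun i hi => ?_
    rw [← k.vord_conj, (vord_eq_of_sub_mem (v := (k.conj i w).val) one_ne_zero
      (by rw [vord_one]; exact hz1 i (Finset.mem_range.1 hi))).2, vord_one]
  have e2 : 0 < vord w'.val (algebraMap K E (Algebra.norm K z)) := by
    rw [hN, vord_prod _ _ hne]
    refine Finset.sum_pos (fun i hi => ?_) ⟨0, Finset.mem_range.2 hp.out.pos⟩
    have := (mem_filt_iff hz0).1 (hz2 i (Finset.mem_range.1 hi))
    rw [← k.vord_conj]
    omega
  obtain ⟨e, he, hw⟩ := w.exists_ramification (algebraMap K E)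
  obtain ⟨e', he', hw'⟩ := w'.exists_ramification (algebraMap K E)
  rw [hw] at e1
  have e3 := (mul_eq_zero.1 e1).resolve_left (by exact_mod_cast he)
  change vord (w.below K).val _ = 0 at e3
  rw [hw'] at e2
  change 0 < (e' : ℤ) * vord (w'.below K).val _ at e2
  rw [← h, e3, mul_zero] at e2
  exact lt_irrefl _ e2

/-- The base field is dense at places which are not stable. -/
theorem exists_base_approx {w : Pl E} (h : ¬ k.Inv w) (y : E) (n : ℤ) :
    ∃ c : K, algebraMap K E c - y ∈ filt w.val n := by
  classical
  obtain ⟨z, hz⟩ := Pl.exists_approx ((Finset.range p).image fun i => k.conj i w)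
    (fun u => if u = w then y else 0) n
  obtain ⟨c, hc⟩ := k.exists_trace z
  refine ⟨c, ?_⟩
  have hz' : ∀ i < p, z - (if k.conj i w = w then y else 0) ∈ filt (k.conj i w).val n :=
    fun i hi => hz _ (Finset.mem_image_of_mem (fun i => k.conj i w) (Finset.mem_range.2 hi))
  have hconj : ∀ (i : ℕ) (y : E), y ∈ filt (k.conj i w).val n → (k.s ^ i) y ∈ filt w.val n := by
    intro i y hy
    rcases eq_or_ne y 0 with rfl | hy0
    · simp
    rw [mem_filt_iff hy0, vord_conj] at hy
    rwa [mem_filt_iff ((map_ne_zero _).2 hy0)]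
  rw [hc, ← Finset.add_sum_erase _ _ (Finset.mem_range.2 hp.out.pos), add_sub_right_comm]
  refine add_mem ?_ (sum_mem fun i hi => ?_)
  · have := hz' 0 hp.out.pos
    rw [k.conj_zero, if_pos rfl] at this
    exact this
  · have hi' := Finset.mem_erase.1 hi
    refine hconj _ _ ?_
    have := hz' i (Finset.mem_range.1 hi'.2)
    rwa [if_neg, sub_zero] at this
    intro h2
    exact hi'.1 (k.conj_injective h (Finset.mem_range.1 hi'.2) hp.out.pos (h2.trans (k.conj_zero w).symm))

theorem vord_algebraMap_of_not_inv {w : Pl E} (h : ¬ k.Inv w) (c : K) :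
    vord w.val (algebraMap K E c) = vord (w.below K).val c := by
  obtain ⟨e, he, hw⟩ := w.exists_ramification (algebraMap K E)
  obtain ⟨π, hπ⟩ := w.exists_uniformizer
  have hπ0 : π ≠ 0 := by
    rintro rfl
    simp [vord] at hπ
  obtain ⟨d, hd⟩ := k.exists_base_approx h π 2
  have h1 := (vord_eq_of_sub_mem hπ0 (by rw [hπ]; exact hd)).2
  rw [hw, hπ] at h1
  have he1 : (e : ℤ) = 1 := Int.eq_one_of_mul_eq_one_right (by positivity) h1
  rw [hw, he1, one_mul]

theorem _root_.exists_dominant_term {p : ℕ} (hp : 0 < p) {K E : Type*} [Field K] [Field E] [Algebra K E]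
    {v : Valuation K ℤᵐ⁰} {w : Valuation E ℤᵐ⁰}
    (hvw : ∀ c : K, vord w (algebraMap K E c) = p * vord v c) {ϖ : E} (hϖ : vord w ϖ = 1)
    (c : Fin p → K) (hc : c ≠ 0) : ∃ j, c j ≠ 0 ∧ ∀ i, i ≠ j →
      algebraMap K E (c i) * ϖ ^ (i : ℕ) ∈ filt w (p * vord v (c j) + j + 1) := by
  classical
  have hϖ0 : ϖ ≠ 0 := by
    rintro rfl
    simp [vord] at hϖ
  have hne : (Finset.univ.filter fun i => c i ≠ 0).Nonempty := by
    obtain ⟨i, hi⟩ := Function.ne_iff.1 hc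
    exact ⟨i, by simpa using hi⟩
  obtain ⟨j, hj, hmin⟩ := Finset.exists_min_image _ (fun i => (p : ℤ) * vord v (c i) + (i : ℕ)) hne
  refine ⟨j, by simpa using hj, fun i hi => ?_⟩
  rcases eq_or_ne (c i) 0 with h0 | h0
  · simp [h0]
  rw [mem_filt_iff (mul_ne_zero (by simpa using h0) (pow_ne_zero _ hϖ0)),
    vord_mul (by simpa using h0) (pow_ne_zero _ hϖ0), hvw, vord_pow, hϖ, mul_one]
  have h1 := hmin i (by simpa using h0)
  rcases h1.lt_or_eq with h2 | h2
  · exact h2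
  · exfalso
    apply hi
    have hi2 := i.2
    have hj2 := j.2
    have h3 : ((i : ℕ) : ℤ) % p = ((j : ℕ) : ℤ) % p := by
      have h4 := congrArg (· % (p : ℤ)) h2
      simpa [Int.add_emod] using h4.symm
    rw [Int.emod_eq_of_lt (by positivity) (by exact_mod_cast hi2),
      Int.emod_eq_of_lt (by positivity) (by exact_mod_cast hj2)] at h3
    exact Fin.ext (by exact_mod_cast h3)

theorem inv_cases {w : Pl E} (h : k.Inv w) :
    (∀ c, vord w.val (algebraMap K E c) = vord (w.below K).val c) ∨
    ((∀ c, vord w.val (algebraMap K E c) = p * vord (w.below K).val c) ∧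
      ∀ y, vord w.val y = 0 → ∃ c, y - algebraMap K E c ∈ filt w.val 1) := by
  obtain ⟨e, he, hw⟩ := w.exists_ramification (algebraMap K E)
  obtain ⟨ϖ, hϖ⟩ := w.exists_uniformizer
  have hϖ0 : ϖ ≠ 0 := by
    rintro rfl
    simp [vord] at hϖ
  have h1 := k.vord_norm h ϖ hϖ0
  rw [hw, hϖ, mul_one] at h1
  have hdvd : e ∣ p := by
    rw [← Int.natCast_dvd_natCast]
    exact ⟨_, h1.symm⟩
  rcases (Nat.dvd_prime hp.out).1 hdvd with rfl | rfl
  · left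
    intro c
    rw [hw, Nat.cast_one, one_mul]
  right
  refine ⟨hw, fun y hy => ?_⟩
  have hdom := fun c hc => exists_dominant_term (p := e) hp.out.pos hw hϖ c hc
  have hsum : ∀ c : Fin e → K, c ≠ 0 → ∃ j : Fin e, c j ≠ 0 ∧
      ∑ i, algebraMap K E (c i) * ϖ ^ (i : ℕ) ≠ 0 ∧
      vord w.val (∑ i, algebraMap K E (c i) * ϖ ^ (i : ℕ)) =
        e * vord (w.below K).val (c j) + (j : ℕ) ∧
      ∑ i, algebraMap K E (c i) * ϖ ^ (i : ℕ) - algebraMap K E (c j) * ϖ ^ (j : ℕ) ∈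
        filt w.val (e * vord (w.below K).val (c j) + (j : ℕ) + 1) := by
    intro c hc
    obtain ⟨j, hj, hj2⟩ := hdom c hc
    have e1 : ∑ i, algebraMap K E (c i) * ϖ ^ (i : ℕ) - algebraMap K E (c j) * ϖ ^ (j : ℕ) ∈
        filt w.val (e * vord (w.below K).val (c j) + (j : ℕ) + 1) := by
      rw [← Finset.add_sum_erase _ _ (Finset.mem_univ j), add_sub_cancel_left]
      exact sum_mem fun i hi => hj2 i (Finset.ne_of_mem_erase hi)
    have hne : algebraMap K E (c j) * ϖ ^ (j : ℕ) ≠ 0 :=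
      mul_ne_zero (by simpa using hj) (pow_ne_zero _ hϖ0)
    have e2 : vord w.val (algebraMap K E (c j) * ϖ ^ (j : ℕ)) =
        e * vord (w.below K).val (c j) + (j : ℕ) := by
      rw [vord_mul (by simpa using hj) (pow_ne_zero _ hϖ0), hw, vord_pow, hϖ, mul_one]
    have e3 := vord_eq_of_sub_mem hne (by rw [e2]; exact e1)
    exact ⟨j, hj, e3.1, e3.2.trans e2, e1⟩
  have hli : LinearIndependent K (fun i : Fin e => ϖ ^ (i : ℕ)) := by
    rw [Fintype.linearIndependent_iff]
    intro c hc
    by_contra hcon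
    have hc0 : c ≠ 0 := fun h0 => hcon fun i => by rw [h0]; rfl
    obtain ⟨j, -, hj, -⟩ := hsum c hc0
    apply hj
    simpa only [Algebra.smul_def] using hc
  have : Nonempty (Fin e) := ⟨⟨0, hp.out.pos⟩⟩
  let b := basisOfLinearIndependentOfCardEqFinrank hli (by rw [Fintype.card_fin, k.finrank_eq])
  have hb : ∑ i, algebraMap K E (b.repr y i) * ϖ ^ (i : ℕ) = y := by
    have := b.sum_repr y
    simpa [b, Algebra.smul_def] using this
  rcases eq_or_ne y 0 with rfl | hy0
  · exact ⟨0, by simp⟩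
  obtain ⟨j, hj, -, hj2, hj3⟩ := hsum (fun i => b.repr y i) (by
    intro h0
    apply hy0
    rw [← hb]
    exact Finset.sum_eq_zero fun i _ => by rw [congrFun h0 i]; simp)
  rw [hb] at hj2 hj3
  have hj0 : (j : ℕ) = 0 := by
    rw [hy] at hj2
    have h5 : (e : ℤ) ∣ ((j : ℕ) : ℤ) := ⟨-vord (w.below K).val (b.repr y j), by linarith⟩
    exact Nat.eq_zero_of_dvd_of_lt (by exact_mod_cast h5) j.2
  rw [← hj2, hy, zero_add, hj0, pow_zero, mul_one] at hj3
  exact ⟨_, hj3⟩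

theorem _root_.Pl.exists_above (K E : Type*) [Field K] [NumberField K] [Field E] [NumberField E]
    [Algebra K E] (v : Pl K) : ∃ w : Pl E, w.below K = v := by
  obtain ⟨Q, hQ, hQ2⟩ := Ideal.exists_maximal_ideal_liesOver_of_isIntegral (S := 𝓞 E) v.asIdeal
  have hne : Q ≠ ⊥ := Ideal.ne_bot_of_liesOver_of_ne_bot v.ne_bot Q
  exact ⟨⟨Q, hQ.isPrime, hne⟩, HeightOneSpectrum.ext hQ2.over.symm⟩

end Kum

end

section

open NumberField IsDedekindDomain WithZero

section Glob1

theorem index_iInf_of_forall_exists {ι G : Type*} [CommGroup G] (S : Finset ι)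
    (H : ι → Subgroup G) (hH : ∀ y : ι → G, ∃ z : G, ∀ i ∈ S, z * (y i)⁻¹ ∈ H i) :
    (⨅ i ∈ S, H i).index = ∏ i ∈ S, (H i).index := by
  classical
  let f : G →* (∀ i : S, G ⧸ H i) := MonoidHom.pi fun i => QuotientGroup.mk' (H i)
  have hker : f.ker = ⨅ i ∈ S, H i := by
    ext x
    simp [f, MonoidHom.mem_ker, funext_iff, Subgroup.mem_iInf]
  have hsurj : Function.Surjective f := by
    intro y
    choose y' hy' using fun i : S => QuotientGroup.mk'_surjective (H i) (y i)
    obtain ⟨z, hz⟩ := hH (fun i => if h : i ∈ S then y' ⟨i, h⟩ else 1)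
    refine ⟨z, funext fun i => ?_⟩
    have h1 := hz i i.2
    rw [dif_pos i.2] at h1
    rw [← hy' i]
    change (QuotientGroup.mk z : G ⧸ H i) = QuotientGroup.mk (y' i)
    rw [eq_comm, QuotientGroup.eq, mul_comm]
    exact h1
  have h1 : f.ker.index = Nat.card f.range := Subgroup.index_ker f
  rw [← hker, h1, MonoidHom.range_eq_top.2 hsurj,
    Nat.card_congr Subgroup.topEquiv.toEquiv, Nat.card_pi]
  exact Finset.prod_coe_sort S fun i => (H i).index

variable {K : Type*} [Field K] [NumberField K]

theorem Pl.exists_forall_mul_inv_mem (S : Finset (Pl K)) (H : Pl K → Subgroup Kˣ)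
    (hH : ∀ v ∈ S, ∃ n, punit v.val n ≤ H v) (y : Pl K → Kˣ) :
    ∃ z : Kˣ, ∀ v ∈ S, z * (y v)⁻¹ ∈ H v := by
  choose! n hn using hH
  obtain ⟨z, hz⟩ := Pl.exists_approx_unit S y (S.sup n)
  exact ⟨z, fun v hv => hn v hv (punit_anti (Finset.le_sup hv) (hz v hv))⟩

theorem Pl.index_iInf_eq_prod (S : Finset (Pl K)) (H : Pl K → Subgroup Kˣ)
    (hH : ∀ v ∈ S, ∃ n, punit v.val n ≤ H v) :
    (⨅ v ∈ S, H v).index = ∏ v ∈ S, (H v).index :=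
  index_iInf_of_forall_exists S H (Pl.exists_forall_mul_inv_mem S H hH)

theorem Pl.exists_punit_le_clos_pows (p : ℕ) [hp : Fact p.Prime] (v : Pl K) :
    ∃ n, punit v.val n ≤ clos v.val (pows p K) := by
  refine ⟨(2 * vord v.val (p : K)).toNat + 1, punit_le_clos_pows
    (by exact_mod_cast hp.out.ne_zero) ?_⟩
  have := Int.self_le_toNat (2 * vord v.val (p : K))
  push_cast
  omega

theorem Pl.vord_natCast_nonneg (v : Pl K) {n : ℕ} (hn : n ≠ 0) : 0 ≤ vord v.val (n : K) :=
  (mem_filt_iff (by exact_mod_cast hn)).1 (natCast_mem_filt (v := v.val) n)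

theorem Pl.qres_eq (v : Pl K) : qres v.val = Ideal.absNorm v.asIdeal := by
  let f : 𝓞 K →+ K := (algebraMap (𝓞 K) K : 𝓞 K →+ K)
  have h1 : (filt v.val 1).comap f = v.asIdeal.toAddSubgroup := by
    ext a
    exact v.coe_mem_filt_one_iff a
  have h2 : f.range ⊔ filt v.val 1 = filt v.val 0 := by
    refine le_antisymm (sup_le ?_ (filt_mono zero_le_one)) fun x hx => ?_
    · rintro _ ⟨a, rfl⟩
      exact v.coe_mem_filt_zero a
    · obtain ⟨a, ha⟩ := v.exists_valuation_sub_lt_of_integer (K := K) (x := x)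
        (by simpa [mem_filt_def] using hx) 1
      have h3 : (a : K) - x ∈ filt v.val 1 := by
        rcases eq_or_ne ((a : K) - x) 0 with h0 | h0
        · rw [h0]; exact zero_mem _
        · rw [mem_filt_iff h0]
          rw [valuation_eq_exp_vord h0, Units.val_one, ← exp_zero, exp_lt_exp] at ha
          change -vord v.val _ < 0 at ha
          omega
      have h4 : x = a + -((a : K) - x) := by ring
      rw [h4]
      exact add_mem (AddSubgroup.mem_sup_left ⟨a, rfl⟩)
        (AddSubgroup.mem_sup_right (neg_mem h3))
  rw [qres, ← h2, AddSubgroup.relIndex_sup_right, ← AddSubgroup.index_comap, h1,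
    Ideal.absNorm_eq_index]

theorem Pl.qres_ne_zero (v : Pl K) : qres v.val ≠ 0 := by
  rw [Pl.qres_eq]
  exact (Ideal.absNorm_ne_zero_iff v.asIdeal).2 (Ideal.finiteQuotientOfFreeOfNeBot _ v.ne_bot)

theorem Pl.prod_qres_le (S : Finset (Pl K)) {n : ℕ} (hn : n ≠ 0) :
    ∏ v ∈ S, qres v.val ^ (vord v.val (n : K)).toNat ≤ n ^ Module.finrank ℚ K := by
  have h0 : Ideal.absNorm (Ideal.span {(n : 𝓞 K)}) = n ^ Module.finrank ℚ K := by
    rw [← map_natCast (algebraMap ℤ (𝓞 K)), Ideal.absNorm_span_singleton, Algebra.norm_algebraMap,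
      RingOfIntegers.rank, Int.natAbs_pow, Int.natAbs_natCast]
  have h1 : ∏ v ∈ S, v.asIdeal ^ (vord v.val (n : K)).toNat ∣ Ideal.span {(n : 𝓞 K)} := by
    refine Finset.prod_dvd_of_coprime ?_ fun v _ => ?_
    · intro v _ w _ hvw
      exact HeightOneSpectrum.isCoprime_pow_of_ne v w hvw _ _
    · rw [Ideal.dvd_iff_le, Ideal.span_singleton_le_iff_mem, ← v.coe_mem_filt_iff, mem_filt_iff
        (by simpa using hn), Int.toNat_of_nonneg (v.vord_natCast_nonneg hn)]
      simp
  have h2 := map_dvd Ideal.absNorm h1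
  rw [h0, map_prod] at h2
  simp only [map_pow, ← Pl.qres_eq] at h2
  exact Nat.le_of_dvd (Nat.pow_pos (Nat.pos_of_ne_zero hn)) h2

theorem Pl.index_clos_pows {p : ℕ} [hp : Fact p.Prime] {ζ : K} (hζ : IsPrimitiveRoot ζ p)
    (v : Pl K) : (clos v.val (pows p K)).index ≠ 0 ∧ (clos v.val (pows p K)).index ≤
      p ^ 2 * qres v.val ^ (vord v.val (p : K)).toNat := by
  obtain ⟨π, hπ⟩ := v.exists_uniformizer
  have := _root_.index_clos_pows hζ (by exact_mod_cast hp.out.ne_zero) v.qres_ne_zero hπ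
    (Int.toNat_of_nonneg (v.vord_natCast_nonneg hp.out.ne_zero)).symm
  rw [sq, mul_assoc]
  exact this

theorem Pl.index_iInf_clos_pows {p : ℕ} [hp : Fact p.Prime] {ζ : K} (hζ : IsPrimitiveRoot ζ p)
    (S : Finset (Pl K)) : (⨅ v ∈ S, clos v.val (pows p K)).index ≠ 0 ∧
      (⨅ v ∈ S, clos v.val (pows p K)).index ≤ p ^ (2 * S.card + Module.finrank ℚ K) := by
  rw [Pl.index_iInf_eq_prod S (fun v => clos v.val (pows p K))
    fun v _ => v.exists_punit_le_clos_pows p]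
  refine ⟨Finset.prod_ne_zero_iff.2 fun v _ => (v.index_clos_pows hζ).1, ?_⟩
  refine (Finset.prod_le_prod' fun v _ => (v.index_clos_pows hζ).2).trans ?_
  rw [Finset.prod_mul_distrib, Finset.prod_const, ← pow_mul, pow_add]
  exact Nat.mul_le_mul_left _ (Pl.prod_qres_le S hp.out.ne_zero)

/-- The `S`-class group is trivial. -/
def ClOne (S : Finset (Pl K)) : Prop :=
  ∀ v ∉ S, ∃ π : Kˣ, vord v.val (π : K) = 1 ∧ ∀ w ∉ S, w ≠ v → vord w.val (π : K) = 0

theorem ClOne.mono {S S' : Finset (Pl K)} (h : ClOne S) (hS : S ⊆ S') : ClOne S' := by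
  intro v hv
  obtain ⟨π, h1, h2⟩ := h v fun h => hv (hS h)
  exact ⟨π, h1, fun w hw => h2 w fun h => hw (hS h)⟩

theorem exists_clOne (K : Type*) [Field K] [NumberField K] : ∃ S : Finset (Pl K), ClOne S := by
  classical
  choose I hI using fun c : ClassGroup (𝓞 K) => ClassGroup.mk0_surjective c
  have hfin : ∀ c, {v : Pl K | (I c : Ideal (𝓞 K)) ≤ v.asIdeal}.Finite := by
    intro c
    have := Ideal.finite_factors (I := (I c : Ideal (𝓞 K)))
      (nonZeroDivisors.coe_ne_zero _)
    refine this.subset fun v hv => ?_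
    exact Ideal.dvd_iff_le.2 hv
  refine ⟨Finset.univ.biUnion fun c => (hfin c).toFinset, fun v hv => ?_⟩
  let J : nonZeroDivisors (Ideal (𝓞 K)) := ⟨v.asIdeal, mem_nonZeroDivisors_of_ne_zero v.ne_bot⟩
  let c := (ClassGroup.mk0 J)⁻¹
  have h1 : ClassGroup.mk0 (J * I c) = 1 := by
    rw [map_mul, hI, mul_inv_cancel]
  obtain ⟨a, ha⟩ := ((ClassGroup.mk0_eq_one_iff (J * I c).2).1 h1).principal
  have ha' : v.asIdeal * (I c : Ideal (𝓞 K)) = Ideal.span {a} := ha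
  have ha0 : a ≠ 0 := by
    rintro rfl
    rw [Ideal.span_singleton_eq_bot.2 rfl] at ha'
    rcases mul_eq_zero.1 ha' with h | h
    · exact v.ne_bot h
    · exact nonZeroDivisors.coe_ne_zero _ h
  have ha0' : (a : K) ≠ 0 := by simpa using ha0
  have hnot : ∀ w, w ∉ (Finset.univ.biUnion fun c => (hfin c).toFinset) →
      ¬ (I c : Ideal (𝓞 K)) ≤ w.asIdeal := by
    intro w hw h
    apply hw
    simp only [Finset.mem_biUnion, Finset.mem_univ, true_and, Set.Finite.mem_toFinset]
    exact ⟨c, h⟩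
  refine ⟨Units.mk0 (a : K) ha0', ?_, fun w hw hne => ?_⟩
  · have e1 : a ∈ v.asIdeal := by
      rw [← Ideal.span_singleton_le_iff_mem, ← ha']
      exact Ideal.mul_le_left
    have e2 : a ∉ v.asIdeal ^ 2 := by
      rw [← Ideal.span_singleton_le_iff_mem, ← ha', sq, ← Ideal.dvd_iff_le,
        mul_dvd_mul_iff_left v.ne_bot, Ideal.dvd_iff_le]
      exact hnot v hv
    rw [← v.coe_mem_filt_one_iff, mem_filt_iff ha0'] at e1
    rw [← v.coe_mem_filt_iff, mem_filt_iff ha0'] at e2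
    change vord v.val (a : K) = 1
    push_cast at e2
    omega
  · change vord w.val (a : K) = 0
    rw [w.vord_coe_eq_zero_iff ha0, ← Ideal.span_singleton_le_iff_mem, ← ha', w.isPrime.mul_le, not_or]
    refine ⟨fun h => hne ?_, hnot w hw⟩
    exact HeightOneSpectrum.ext (v.isMaximal.eq_of_le w.isPrime.ne_top h).symm

theorem ClOne.exists_vord_eq {S : Finset (Pl K)} (h : ClOne S) (n : Pl K → ℤ)
    (hn : {v | n v ≠ 0}.Finite) : ∃ c : Kˣ, ∀ v ∉ S, vord v.val (c : K) = n v := by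
  classical
  choose! π h1 h2 using h
  refine ⟨∏ v ∈ hn.toFinset \ S, π v ^ n v, fun v hv => ?_⟩
  rw [Units.coe_prod, vord_prod _ _ fun w _ => Units.ne_zero _]
  simp only [Units.val_zpow_eq_zpow_val, vord_zpow]
  have : ∀ w ∈ hn.toFinset \ S, n w * vord v.val (π w : K) = if v = w then n v else 0 := by
    intro w hw
    have hw' := (Finset.mem_sdiff.1 hw).2
    split_ifs with hvw
    · subst hvw
      rw [h1 v hv, mul_one]
    · rw [h2 w hw' v hv hvw, mul_zero]
  rw [Finset.sum_congr rfl this, Finset.sum_ite_eq]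
  split_ifs with hm
  · rfl
  · by_contra h3
    exact hm (Finset.mem_sdiff.2 ⟨hn.mem_toFinset.2 (Ne.symm h3), hv⟩)

end Glob1

end

section

open NumberField IsDedekindDomain WithZero

section SUnit

variable {K : Type*} [Field K] [NumberField K]

/-- The group of `S`-units. -/
def SU (S : Finset (Pl K)) : Subgroup Kˣ where
  carrier := {x | ∀ v ∉ S, vord v.val (x : K) = 0}
  mul_mem' {x y} hx hy v hv := by
    rw [Units.val_mul, vord_mul x.ne_zero y.ne_zero, hx v hv, hy v hv, add_zero]
  one_mem' v hv := by rw [Units.val_one, vord_one]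
  inv_mem' {x} hx v hv := by
    rw [Units.val_inv_eq_inv_val, vord_inv, hx v hv, neg_zero]

theorem SU_mono {S S' : Finset (Pl K)} (h : S ⊆ S') : SU S ≤ SU S' :=
  fun _ hx v hv => hx v fun h' => hv (h h')

theorem mem_SU_of_pow_mem {S : Finset (Pl K)} {x : Kˣ} {n : ℕ} (hn : n ≠ 0) (h : x ^ n ∈ SU S) :
    x ∈ SU S := by
  intro v hv
  have := h v hv
  rw [Units.val_pow_eq_pow_val, vord_pow] at this
  exact (mul_eq_zero.1 this).resolve_left (by exact_mod_cast hn)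

theorem exists_mem_SU (x : Kˣ) : ∃ S : Finset (Pl K), x ∈ SU S := by
  classical
  refine ⟨(Pl.finite_support x).toFinset, fun v hv => ?_⟩
  by_contra h
  exact hv ((Pl.finite_support x).mem_toFinset.2 h)

/-- The logarithmic embedding of the `S`-units at the places of `S`. -/
noncomputable def SU.ords (S : Finset (Pl K)) : Additive (SU S) →ₗ[ℤ] (S → ℤ) :=
  AddMonoidHom.toIntLinearMap
    { toFun := fun x v => vord v.1.val ((x.toMul : Kˣ) : K)
      map_zero' := by ext v; simp
      map_add' := fun x y => by
        ext v
        simp only [toMul_add, Subgroup.coe_mul, Units.val_mul, Pi.add_apply]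
        rw [vord_mul (Units.ne_zero _) (Units.ne_zero _)] }

theorem SU.ords_apply (S : Finset (Pl K)) (x : Additive (SU S)) (v : S) :
    SU.ords S x v = vord v.1.val ((x.toMul : Kˣ) : K) := rfl

theorem Pl.vord_unit (v : Pl K) (u : (𝓞 K)ˣ) : vord v.val ((u : 𝓞 K) : K) = 0 := by
  rw [v.vord_coe_eq_zero_iff u.ne_zero]
  exact fun h => v.isPrime.ne_top (Ideal.eq_top_of_isUnit_mem _ h u.isUnit)

/-- Units are `S`-units. -/
noncomputable def SU.ofUnits (S : Finset (Pl K)) : Additive (𝓞 K)ˣ →ₗ[ℤ] Additive (SU S) :=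
  AddMonoidHom.toIntLinearMap (MonoidHom.toAdditive
    { toFun := fun u => ⟨Units.map (algebraMap (𝓞 K) K : 𝓞 K →* K) u, fun v _ => v.vord_unit u⟩
      map_one' := by ext; simp
      map_mul' := fun x y => by ext; simp })

theorem SU.ofUnits_injective (S : Finset (Pl K)) : Function.Injective (SU.ofUnits S) := by
  intro x y h
  have h1 : ((x.toMul : 𝓞 K) : K) = (y.toMul : 𝓞 K) :=
    congrArg (fun z : Additive (SU S) => ((z.toMul : Kˣ) : K)) h
  exact Additive.toMul.injective (Units.ext (RingOfIntegers.coe_injective h1))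

theorem exists_unit_of_vord_eq_zero {x : Kˣ} (h : ∀ v : Pl K, vord v.val (x : K) = 0) :
    ∃ u : (𝓞 K)ˣ, ((u : 𝓞 K) : K) = x := by
  have key : ∀ y : Kˣ, (∀ v : Pl K, vord v.val (y : K) = 0) → ∃ a : 𝓞 K, (a : K) = y := by
    intro y hy
    exact HeightOneSpectrum.mem_integers_of_valuation_le_one K (y : K) fun v =>
      ((valuation_eq_one_iff y.ne_zero).2 (hy v)).le
  obtain ⟨a, ha⟩ := key x h
  obtain ⟨b, hb⟩ := key x⁻¹ fun v => by
    rw [Units.val_inv_eq_inv_val, vord_inv, h, neg_zero]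
  have hab : a * b = 1 := RingOfIntegers.coe_injective (by
    rw [map_mul, map_one]
    change (a : K) * (b : K) = 1
    rw [ha, hb, Units.mul_inv])
  exact ⟨⟨a, b, hab, by rw [mul_comm, hab]⟩, ha⟩

theorem SU.range_ofUnits (S : Finset (Pl K)) : (SU.ofUnits S).range = (SU.ords S).ker := by
  ext x
  rw [LinearMap.mem_range, LinearMap.mem_ker]
  constructor
  · rintro ⟨u, rfl⟩
    ext v
    exact v.1.vord_unit u.toMul
  · intro h
    obtain ⟨u, hu⟩ := exists_unit_of_vord_eq_zero (x := (x.toMul : Kˣ)) fun v => by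
      by_cases hv : v ∈ S
      · exact congrFun h ⟨v, hv⟩
      · exact x.toMul.2 v hv
    exact ⟨Additive.ofMul u, Additive.toMul.injective (Subtype.ext (Units.ext hu))⟩

theorem Pl.exists_pow_eq_span (v : Pl K) :
    ∃ h : ℕ, h ≠ 0 ∧ ∃ a : 𝓞 K, v.asIdeal ^ h = Ideal.span {a} := by
  obtain ⟨J, hJ⟩ : ∃ J : nonZeroDivisors (Ideal (𝓞 K)), (J : Ideal (𝓞 K)) = v.asIdeal :=
    ⟨⟨v.asIdeal, mem_nonZeroDivisors_of_ne_zero v.ne_bot⟩, rfl⟩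
  obtain ⟨h, hh, h1⟩ : ∃ h : ℕ, h ≠ 0 ∧ (ClassGroup.mk0 J) ^ h = 1 :=
    ⟨Fintype.card (ClassGroup (𝓞 K)), Fintype.card_ne_zero, pow_card_eq_one⟩
  rw [← map_pow] at h1
  obtain ⟨a, ha⟩ := ((ClassGroup.mk0_eq_one_iff (J ^ h).2).1 h1).principal
  refine ⟨h, hh, a, ?_⟩
  rw [← hJ, ← SubmonoidClass.coe_pow]
  exact ha

theorem Pl.exists_principal (v : Pl K) :
    ∃ x : Kˣ, vord v.val (x : K) ≠ 0 ∧ ∀ w, w ≠ v → vord w.val (x : K) = 0 := by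
  obtain ⟨h, hh, a, ha⟩ := v.exists_pow_eq_span
  have ha0 : a ≠ 0 := by
    rintro rfl
    rw [Ideal.span_singleton_eq_bot.2 rfl] at ha
    exact v.ne_bot (pow_eq_zero_iff hh |>.1 ha)
  have ha0' : (a : K) ≠ 0 := by simpa using ha0
  refine ⟨Units.mk0 (a : K) ha0', ?_, fun w hne => ?_⟩
  · change vord v.val (a : K) ≠ 0
    rw [Ne, v.vord_coe_eq_zero_iff ha0, not_not, ← Ideal.span_singleton_le_iff_mem, ← ha]
    exact Ideal.pow_le_self hh
  · change vord w.val (a : K) = 0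
    rw [w.vord_coe_eq_zero_iff ha0, ← Ideal.span_singleton_le_iff_mem, ← ha, w.isPrime.pow_le_iff hh]
    exact fun hle => hne (HeightOneSpectrum.ext (v.isMaximal.eq_of_le w.isPrime.ne_top hle).symm)

instance SU.finite (S : Finset (Pl K)) : Module.Finite ℤ (Additive (SU S)) := by
  refine ⟨Submodule.fg_of_fg_map_of_fg_inf_ker (SU.ords S) (IsNoetherian.noetherian _) ?_⟩
  rw [top_inf_eq, ← SU.range_ofUnits, ← Submodule.map_top]
  exact Module.Finite.fg_top.map _

theorem SU.finrank_range_ords (S : Finset (Pl K)) :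
    Module.finrank ℤ (SU.ords S).range = S.card := by
  apply le_antisymm
  · have := Submodule.finrank_le (SU.ords S).range
    simpa using this
  · choose x hx hx2 using fun v : Pl K => v.exists_principal
    have hS : ∀ v ∈ S, x v ∈ SU S := fun v hv w hw => hx2 v w fun h => hw (h ▸ hv)
    have hli : LinearIndependent ℤ (fun v : S =>
        (⟨SU.ords S (Additive.ofMul ⟨x v, hS v v.2⟩), LinearMap.mem_range_self _ _⟩ :
          (SU.ords S).range)) := by
      rw [Fintype.linearIndependent_iff]
      intro c hc v
      have h1 := congrFun (congrArg Subtype.val hc) v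
      simp only [AddSubmonoidClass.coe_finsetSum, Submodule.coe_smul, Submodule.coe_zero, Pi.zero_apply,
        Finset.sum_apply, Pi.smul_apply, SU.ords_apply, smul_eq_mul, toMul_ofMul] at h1
      rw [Finset.sum_eq_single v] at h1
      · exact (mul_eq_zero.1 h1).resolve_right (hx v)
      · intro w _ hw
        rw [hx2 w v fun h => hw (Subtype.ext h.symm), mul_zero]
      · simp
    simpa using hli.fintype_card_le_finrank

theorem SU.finrank_eq (S : Finset (Pl K)) :
    Module.finrank ℤ (Additive (SU S)) + 1 = S.card + Fintype.card (InfinitePlace K) := by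
  have h1 := Submodule.finrank_quotient_add_finrank (SU.ords S).ker
  rw [(SU.ords S).quotKerEquivRange.finrank_eq, SU.finrank_range_ords, ← SU.range_ofUnits,
    LinearMap.finrank_range_of_inj (SU.ofUnits_injective S), Units.finrank_eq, Units.rank] at h1
  have : 0 < Fintype.card (InfinitePlace K) := Fintype.card_pos
  omega

theorem SU.relIndex_pows (S : Finset (Pl K)) {p : ℕ} [hp : Fact p.Prime] {ζ : K}
    (hζ : IsPrimitiveRoot ζ p) :
    (pows p K).relIndex (SU S) = p ^ (S.card + Fintype.card (InfinitePlace K)) := by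
  have h0 := (index_range_nsmul (A := Additive (SU S)) hp.out.ne_zero).1
  have h1 : (nsmulAddMonoidHom (α := Additive (SU S)) p).range =
      Subgroup.toAddSubgroup ((pows p K).subgroupOf (SU S)) := by
    ext x
    constructor
    · rintro ⟨y, rfl⟩
      exact ⟨(y.toMul : Kˣ), rfl⟩
    · rintro ⟨y, hy⟩
      have hy' : y ^ p = (x.toMul : Kˣ) := hy
      refine ⟨Additive.ofMul ⟨y, mem_SU_of_pow_mem hp.out.ne_zero (hy' ▸ x.toMul.2)⟩, ?_⟩
      exact Additive.toMul.injective (Subtype.ext hy')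
  have h2 : Nat.card (nsmulAddMonoidHom (α := Additive (SU S)) p).ker = p := by
    have hpos : 0 < p := hp.out.pos
    have hc := hζ.card_rootsOfUnity
    have : NeZero p := ⟨hpos.ne'⟩
    refine Eq.trans (Nat.card_congr ?_) hc
    refine
      { toFun := fun x => ⟨(x.1.toMul : Kˣ), ?_⟩
        invFun := fun x => ⟨Additive.ofMul ⟨x.1, mem_SU_of_pow_mem hpos.ne' (n := p) ?_⟩, ?_⟩
        left_inv := fun x => rfl
        right_inv := fun x => rfl }
    · rw [mem_rootsOfUnity]
      exact congrArg (fun z : Additive (SU S) => (z.toMul : Kˣ)) x.2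
    · rw [(mem_rootsOfUnity _ _).1 x.2]; exact one_mem _
    · exact Additive.toMul.injective (Subtype.ext ((mem_rootsOfUnity _ _).1 x.2))
  rw [h1, h2, ← pow_succ, SU.finrank_eq] at h0
  exact h0

theorem two_mul_card_infinitePlace {n : ℕ} (hn : 2 < n) {ζ : K} (hζ : IsPrimitiveRoot ζ n) :
    2 * Fintype.card (InfinitePlace K) = Module.finrank ℚ K := by
  have h0 : InfinitePlace.nrRealPlaces K = 0 := NumberField.InfinitePlace.IsPrimitiveRoot.nrRealPlaces_eq_zero_of_two_lt hn hζ
  rw [InfinitePlace.card_eq_nrRealPlaces_add_nrComplexPlaces,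
    ← InfinitePlace.card_add_two_mul_card_eq_rank, h0, zero_add, zero_add]

end SUnit

end

section

open WithZero Polynomial

theorem isSplittingField_X_pow_sub_C_of_adjoin_eq_top {K E : Type*} [Field K] [Field E]
    [Algebra K E] {p : ℕ} (hp : p ≠ 0) {ζ a : K} (hζ : IsPrimitiveRoot ζ p) {γ : E}
    (hγ : γ ^ p = algebraMap K E a) (htop : Algebra.adjoin K {γ} = ⊤) :
    IsSplittingField K E (X ^ p - C a) := by
  constructor
  · rw [Polynomial.map_sub, Polynomial.map_pow, Polynomial.map_C, Polynomial.map_X]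
    exact X_pow_sub_C_splits_of_isPrimitiveRoot
      (hζ.map_of_injective (algebraMap K _).injective) hγ
  · rw [eq_top_iff, ← htop]
    apply Algebra.adjoin_mono
    rw [Set.singleton_subset_iff, mem_rootSet_of_ne (X_pow_sub_C_ne_zero (Nat.pos_of_ne_zero hp) a),
      aeval_def, eval₂_sub, eval₂_X_pow, eval₂_C, hγ, sub_self]

theorem irreducible_X_pow_sub_C_of_not_mem_pows {K : Type*} [Field K] {p : ℕ} [hp : Fact p.Prime]
    {x : Kˣ} (hx : x ∉ pows p K) : Irreducible (X ^ p - C (x : K)) := by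
  refine X_pow_sub_C_irreducible_of_prime hp.out fun b hb => hx ?_
  have hb0 : b ≠ 0 := by
    rintro rfl
    rw [zero_pow hp.out.ne_zero] at hb
    exact x.ne_zero hb.symm
  exact mem_pows.2 ⟨Units.mk0 b hb0, Units.ext (by simpa using hb)⟩

namespace Kum

variable {p : ℕ} [hp : Fact p.Prime] {K E : Type*} [Field K] [Field E] [Algebra K E] {ζ : K}
  {x : Kˣ}

theorem isSplittingField (k : Kum p E ζ x) : IsSplittingField K E (X ^ p - C (x : K)) :=
  isSplittingField_X_pow_sub_C_of_adjoin_eq_top hp.out.ne_zero k.prim k.pow_γ k.adjoin_eq_top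

theorem isGalois (k : Kum p E ζ x) : IsGalois K E := by
  have := k.isSplittingField
  exact isGalois_of_isSplittingField_X_pow_sub_C
    ⟨ζ, (mem_primitiveRoots hp.out.pos).2 k.prim⟩ (irreducible_X_pow_sub_C_of_not_mem_pows k.not_pow) E

theorem finiteDimensional (k : Kum p E ζ x) : FiniteDimensional K E := by
  have := k.isSplittingField
  exact Polynomial.IsSplittingField.finiteDimensional E (X ^ p - C (x : K))

theorem finrank_eq_prime (k : Kum p E ζ x) : Module.finrank K E = p := by
  have := k.isSplittingField
  exact finrank_of_isSplittingField_X_pow_sub_C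
    ⟨ζ, (mem_primitiveRoots hp.out.pos).2 k.prim⟩ (irreducible_X_pow_sub_C_of_not_mem_pows k.not_pow) E

theorem s_ne_one (k : Kum p E ζ x) : k.s ≠ 1 := by
  intro h
  have h1 := k.s_γ
  rw [h, AlgEquiv.one_apply] at h1
  have h2 : algebraMap K E ζ = 1 := by
    refine mul_right_cancel₀ k.γ_ne_zero ?_
    rw [← h1, one_mul]
  have h3 : ζ = 1 := (algebraMap K E).injective (by rw [h2, map_one])
  exact k.prim.ne_one hp.out.one_lt h3

theorem mem_zpowers (k : Kum p E ζ x) (g : E ≃ₐ[K] E) : g ∈ Subgroup.zpowers k.s := by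
  have := k.isGalois
  have := k.finiteDimensional
  have hc : Nat.card (E ≃ₐ[K] E) = p := by
    rw [IsGalois.card_aut_eq_finrank, k.finrank_eq_prime]
  exact mem_zpowers_of_prime_card hc k.s_ne_one

theorem hilbert90 {K E : Type} [Field K] [Field E] [Algebra K E] {ζ : K} {x : Kˣ}
    (k : Kum p E ζ x) {y : E} (hy : Algebra.norm K y = 1) :
    ∃ z : Eˣ, y * k.s z = z := by
  have := k.isGalois
  have := k.finiteDimensional
  have : IsCyclic (E ≃ₐ[K] E) := ⟨k.s, k.mem_zpowers⟩
  obtain ⟨z, hz⟩ := groupCohomology.exists_div_of_norm_eq_one k.mem_zpowers hy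
  exact ⟨z, by rw [← hz, div_mul_cancel₀]; exact (map_ne_zero k.s).2 z.ne_zero⟩

theorem exists_of_adjoin_eq_top {ζ : K} (hζ : IsPrimitiveRoot ζ p) {x : Kˣ} (hx : x ∉ pows p K)
    {γ : E} (hγ : γ ^ p = algebraMap K E x) (htop : Algebra.adjoin K {γ} = ⊤) :
    ∃ k : Kum p E ζ x, k.γ = γ := by
  have hS := isSplittingField_X_pow_sub_C_of_adjoin_eq_top hp.out.ne_zero hζ hγ htop
  have H := irreducible_X_pow_sub_C_of_not_mem_pows hx
  have hr : (primitiveRoots p K).Nonempty := ⟨ζ, (mem_primitiveRoots hp.out.pos).2 hζ⟩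
  have hG := isGalois_of_isSplittingField_X_pow_sub_C hr H E
  have hF := Polynomial.IsSplittingField.finiteDimensional E (X ^ p - C (x : K))
  have hγ' := hγ
  set e := autEquivZmod H E hζ with he
  set s : E ≃ₐ[K] E := e.symm (Multiplicative.ofAdd 1) with hs
  have hpow : ∀ i : ℕ, s ^ i = e.symm (Multiplicative.ofAdd (i : ZMod p)) := fun i => by
    rw [hs, ← map_pow, ← ofAdd_nsmul]
    simp
  have hsγ : s γ = algebraMap K E ζ * γ := by
    have := autEquivZmod_symm_apply_natCast H E hγ hζ 1
    rw [Nat.cast_one, pow_one, Algebra.smul_def] at this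
    exact this
  have hsurj : ∀ g : E ≃ₐ[K] E, ∃ i ∈ Finset.range p, s ^ i = g := fun g => by
    refine ⟨(Multiplicative.toAdd (e g)).val, Finset.mem_range.2 (ZMod.val_lt _), ?_⟩
    rw [hpow, ZMod.natCast_zmod_val, ofAdd_toAdd, MulEquiv.symm_apply_apply]
  have hinj : Set.InjOn (fun i : ℕ => s ^ i) (Finset.range p) := by
    intro i hi j hj hij
    simp only [hpow] at hij
    have h1 := Multiplicative.ofAdd.injective (e.symm.injective hij)
    rw [ZMod.natCast_eq_natCast_iff'] at h1
    rwa [Nat.mod_eq_of_lt (by simpa using hi), Nat.mod_eq_of_lt (by simpa using hj)] at h1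
  refine ⟨⟨γ, s, hζ, hx, hγ, hsγ, ?_, ?_, ?_, htop⟩, rfl⟩
  · rw [hpow, ZMod.natCast_self, ofAdd_zero, map_one]
  · intro y hy
    have h1 : y ∈ (⊥ : IntermediateField K E) := by
      rw [IsGalois.mem_bot_iff_fixed]
      intro g
      obtain ⟨i, -, rfl⟩ := hsurj g
      clear hsurj
      induction i with
      | zero => simp
      | succ i ih => rw [pow_succ, AlgEquiv.mul_apply, hy, ih]
    exact IntermediateField.mem_bot.1 h1
  · intro y
    rw [Algebra.norm_eq_prod_automorphisms]
    symm
    refine Finset.prod_nbij (fun i => s ^ i) (by simp) hinj ?_ (by simp)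
    intro g _
    obtain ⟨i, hi, rfl⟩ := hsurj g
    exact ⟨i, by simpa using hi, rfl⟩

end Kum

theorem exists_kum {K : Type} [Field K] [NumberField K] {p : ℕ} [hp : Fact p.Prime] {ζ : K}
    (hζ : IsPrimitiveRoot ζ p) {x : Kˣ} (hx : x ∉ pows p K) :
    ∃ (E : Type) (_ : Field E) (_ : NumberField E) (_ : Algebra K E), Nonempty (Kum p E ζ x) := by
  have H := irreducible_X_pow_sub_C_of_not_mem_pows hx
  have : Fact (Irreducible (X ^ p - C (x : K))) := ⟨H⟩
  have hfin : FiniteDimensional K (AdjoinRoot (X ^ p - C (x : K))) :=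
    Module.Finite.of_basis (AdjoinRoot.powerBasis H.ne_zero).basis
  refine ⟨AdjoinRoot (X ^ p - C (x : K)), inferInstance, NumberField.of_module_finite K _,
    inferInstance, ?_⟩
  obtain ⟨k, -⟩ := Kum.exists_of_adjoin_eq_top (E := AdjoinRoot (X ^ p - C (x : K))) hζ hx
    (γ := AdjoinRoot.root _) (root_X_pow_sub_C_pow p (x : K)) AdjoinRoot.adjoinRoot_eq_top
  exact ⟨k⟩

end

section

/-- The Herbrand quotient computation, for a multiplicatively written lattice `SG` inside `G`
whose `s`-invariants are the image of `SH`. -/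
theorem herbrand_mul {G H : Type*} [CommGroup G] [CommGroup H] {p : ℕ} [hp : Fact p.Prime]
    (SG : Subgroup G) (SH : Subgroup H) [Module.Finite ℤ (Additive SG)]
    (s : G →* G) (hs : ∀ a ∈ SG, s a ∈ SG) (hsp : ∀ a, s^[p] a = a)
    (ι : H →* G) (hι : Function.Injective ι) (Nm : G →* H)
    (hN : ∀ a, ι (Nm a) = ∏ i ∈ Finset.range p, s^[i] a)
    (hιS : ∀ b, ι b ∈ SG ↔ b ∈ SH)
    (hfix : ∀ a, s a = a ↔ ∃ b, ι b = a)
    (h90 : ∀ a ∈ SG, Nm a = 1 → ∃ b ∈ SG, a * s b = b) :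
    ∃ l, Module.finrank ℤ (Additive SG) = Module.finrank ℤ (Additive SH) + l * (p - 1) ∧
      (SG.map Nm).relIndex SH * p ^ l = p ^ Module.finrank ℤ (Additive SH) := by
  have hsi : ∀ i, ∀ a ∈ SG, s^[i] a ∈ SG := by
    intro i a ha
    induction i with
    | zero => exact ha
    | succ i ih => rw [Function.iterate_succ_apply']; exact hs _ ih
  have hNS : ∀ a ∈ SG, Nm a ∈ SH := by
    intro a ha
    rw [← hιS, hN]
    exact Subgroup.prod_mem _ fun i _ => hsi i a ha
  let s' : SG →* SG := (s.comp SG.subtype).codRestrict SG fun a => hs a a.2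
  let S' : AddMonoid.End (Additive SG) := MonoidHom.toAdditive s'
  have hS' : ∀ (i : ℕ) (a : Additive SG), (((S' ^ i) a).toMul : G) = s^[i] (a.toMul : G) := by
    intro i
    induction i with
    | zero => intro a; simp
    | succ i ih =>
      intro a
      rw [pow_succ, Function.iterate_succ_apply]
      exact ih (S' a)
  let j : SH →* SG := (ι.comp SH.subtype).codRestrict SG fun b => (hιS b).2 b.2
  have hj : Function.Injective j := fun a b h => Subtype.ext (hι (congrArg Subtype.val h))
  let N' : SG →* SH := (Nm.comp SG.subtype).codRestrict SH fun a => hNS a a.2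
  let J : Additive SH →+ Additive SG := MonoidHom.toAdditive j
  have hJ : Function.Injective J := fun a b h => Additive.toMul.injective (hj (congrArg Additive.toMul h))
  let N : Additive SG →+ Additive SH := MonoidHom.toAdditive N'
  obtain ⟨l, h1, h2⟩ := herbrand S' (by
      refine AddMonoidHom.ext fun a => ?_
      exact Additive.toMul.injective (Subtype.ext ((hS' p a).trans (hsp _))))
    (J.comp N) (by
      intro a
      apply Additive.toMul.injective
      apply Subtype.ext
      have : ((Additive.toMul (∑ i ∈ Finset.range p, (S' ^ i) a) : SG) : G) =
          ∏ i ∈ Finset.range p, (((S' ^ i) a).toMul : G) := by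
        rw [toMul_sum, SubmonoidClass.coe_finsetProd]
      rw [this]
      simp only [hS']
      exact hN _)
    (by
      intro a ha
      have ha' : N a = 0 := hJ (by rw [map_zero]; exact ha)
      have h3 : Nm (a.toMul : G) = 1 := congrArg (fun z : Additive SH => (z.toMul : H)) ha'
      obtain ⟨b, hb, hab⟩ := h90 _ a.toMul.2 h3
      refine ⟨Additive.ofMul ⟨b, hb⟩, ?_⟩
      rw [eq_sub_iff_add_eq]
      exact Additive.toMul.injective (Subtype.ext hab))
    J.range (by
      intro a
      constructor
      · rintro ⟨b, rfl⟩
        exact Additive.toMul.injective (Subtype.ext ((hfix _).2 ⟨b.toMul, rfl⟩))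
      · intro h
        obtain ⟨b, hb⟩ := (hfix (a.toMul : G)).1 (congrArg (fun z : Additive SG => (z.toMul : G)) h)
        refine ⟨Additive.ofMul ⟨b, (hιS b).1 (by rw [hb]; exact a.toMul.2)⟩, ?_⟩
        exact Additive.toMul.injective (Subtype.ext hb))
  have hr : Module.finrank ℤ J.range = Module.finrank ℤ (Additive SH) :=
    (LinearEquiv.finrank_eq (AddMonoidHom.ofInjective hJ).toIntLinearEquiv).symm
  have hidx : (J.comp N).range.relIndex J.range = (SG.map Nm).relIndex SH := by
    rw [AddMonoidHom.range_comp, AddMonoidHom.range_eq_map J,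
      AddSubgroup.relIndex_map_map_of_injective _ _ hJ, AddSubgroup.relIndex_top_right]
    have h4 : N.range = Subgroup.toAddSubgroup N'.range := by
      ext x
      rfl
    rw [h4, Subgroup.index_toAddSubgroup, Subgroup.relIndex]
    congr 1
    ext b
    rw [Subgroup.mem_subgroupOf]
    constructor
    · rintro ⟨a, rfl⟩
      exact ⟨a, a.2, rfl⟩
    · rintro ⟨a, ha, hab⟩
      exact ⟨⟨a, ha⟩, Subtype.ext hab⟩
  rw [hr, hidx] at h2
  rw [hr] at h1
  exact ⟨l, h1, h2⟩

end

section

open WithZero NumberField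

namespace Kum

section Over

variable {p : ℕ} [hp : Fact p.Prime] {K E : Type} [Field K] [NumberField K] [Field E]
  [NumberField E] [Algebra K E] {ζ : K} {x : Kˣ} (k : Kum p E ζ x)

/-- There is exactly one place of `E` above `v`. -/
def Uniq (v : Pl K) : Prop := ∃ w : Pl E, w.below K = v ∧ k.Inv w

variable {k} in
theorem Uniq.inv {v : Pl K} (h : k.Uniq v) {w : Pl E} (hw : w.below K = v) : k.Inv w := by
  obtain ⟨w', h1, h2⟩ := h
  obtain ⟨i, -, hi⟩ := k.exists_conj_eq (w := w') (w' := w) (h1.trans hw.symm)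
  rw [← hi, k.conj_of_inv h2]
  exact h2

variable {k} in
theorem not_inv_of_not_uniq {w : Pl E} (h : ¬ k.Uniq (w.below K)) : ¬ k.Inv w :=
  fun h' => h ⟨w, rfl, h'⟩

open Classical in
/-- The places above a finite set of places. -/
noncomputable def placesOver (S : Finset (Pl K)) : Finset (Pl E) :=
  S.biUnion fun v => (Finset.range p).image fun i => k.conj i (Pl.exists_above K E v).choose

theorem mem_over {S : Finset (Pl K)} {w : Pl E} : w ∈ k.placesOver S ↔ w.below K ∈ S := by
  classical
  rw [placesOver, Finset.mem_biUnion]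
  constructor
  · rintro ⟨v, hv, h⟩
    obtain ⟨i, -, rfl⟩ := Finset.mem_image.1 h
    rw [k.below_conj, (Pl.exists_above K E v).choose_spec]
    exact hv
  · intro h
    obtain ⟨i, hi, h1⟩ := k.exists_conj_eq (w := (Pl.exists_above K E (w.below K)).choose) (w' := w)
      (Pl.exists_above K E (w.below K)).choose_spec
    exact ⟨_, h, Finset.mem_image.2 ⟨i, Finset.mem_range.2 hi, h1⟩⟩

open Classical in
theorem card_over (S : Finset (Pl K)) :
    (k.placesOver S).card + (p - 1) * (S.filter k.Uniq).card = p * S.card := by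
  have h1 : (k.placesOver S).card = ∑ v ∈ S, if k.Uniq v then 1 else p := by
    rw [placesOver, Finset.card_biUnion]
    · refine Finset.sum_congr rfl fun v hv => ?_
      set w := (Pl.exists_above K E v).choose with hw
      have hwv : w.below K = v := (Pl.exists_above K E v).choose_spec
      split_ifs with h
      · have : ((Finset.range p).image fun i => k.conj i w) = {w} := by
          ext w'
          simp only [Finset.mem_image, Finset.mem_range, Finset.mem_singleton, k.conj_of_inv (h.inv hwv)]
          exact ⟨fun ⟨_, _, h⟩ => h.symm, fun h => ⟨0, hp.out.pos, h.symm⟩⟩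
        rw [this, Finset.card_singleton]
      · rw [Finset.card_image_of_injOn, Finset.card_range]
        intro i hi j hj hij
        refine k.conj_injective (w := w) (fun h' => h ⟨w, hwv, h'⟩) ?_ ?_ hij
        · simpa using hi
        · simpa using hj
    · intro v _ v' _ hne
      rw [Function.onFun, Finset.disjoint_left]
      intro w h h'
      obtain ⟨i, -, rfl⟩ := Finset.mem_image.1 h
      obtain ⟨j, -, hj⟩ := Finset.mem_image.1 h'
      apply hne
      have h2 := congrArg (Pl.below K) hj
      rw [k.below_conj, k.below_conj, (Pl.exists_above K E v).choose_spec,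
        (Pl.exists_above K E v').choose_spec] at h2
      exact h2.symm
  rw [h1, Finset.sum_ite, Finset.sum_const, Finset.sum_const, smul_eq_mul, smul_eq_mul, mul_one]
  have h2 := Finset.card_filter_add_card_filter_not (s := S) k.Uniq
  have h3 := hp.out.pos
  obtain ⟨q, hq⟩ : ∃ q, p = q + 1 := ⟨p - 1, by omega⟩
  rw [← h2]
  generalize (S.filter k.Uniq).card = t
  generalize (S.filter fun v => ¬ k.Uniq v).card = u
  rw [hq, Nat.add_sub_cancel]
  ring

include k in
/-- Away from `p` and the radicand, the extension is unramified. -/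
theorem vord_algebraMap_of_unramified {w : Pl E} (hw : vord (w.below K).val (p : K) = 0)
    (hx : vord (w.below K).val (x : K) = 0) (c : K) :
    vord w.val (algebraMap K E c) = vord (w.below K).val c := by
  by_cases h : k.Inv w
  · rcases k.inv_cases h with h1 | ⟨h1, h2⟩
    · exact h1 c
    · exfalso
      refine k.vord_natCast_ne_zero_of_residue h h2 ?_ ?_
      · have h3 := congrArg (vord w.val) k.pow_γ
        rw [vord_pow, h1, hx, mul_zero] at h3
        exact (mul_eq_zero.1 h3).resolve_left (by exact_mod_cast hp.out.ne_zero)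
      · have := h1 (p : K)
        rw [hw, mul_zero, map_natCast] at this
        exact this
  · exact k.vord_algebraMap_of_not_inv h c

theorem vord_s (w : Pl E) (y : E) : vord w.val (k.s y) = vord (k.conj 1 w).val y := by
  rw [vord_conj, pow_one]

theorem exists_of_norm_eq_one_of_mem_SU {S : Finset (Pl K)} (hS : ClOne S)
    (hp' : ∀ v : Pl K, vord v.val (p : K) ≠ 0 → v ∈ S) (hx : x ∈ SU S)
    {a : Eˣ} (ha : a ∈ SU (k.placesOver S)) (hN : Algebra.norm K (a : E) = 1) :
    ∃ b ∈ SU (k.placesOver S), (a : E) * k.s b = b := by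
  classical
  obtain ⟨z, hz⟩ := k.hilbert90 hN
  have hz0 := z.ne_zero
  have hsz0 : k.s z ≠ 0 := (map_ne_zero k.s).2 hz0
  have h1 : ∀ w : Pl E, w.below K ∉ S → vord (k.conj 1 w).val (z : E) = vord w.val (z : E) := by
    intro w hw
    have h := congrArg (vord w.val) hz
    rw [vord_mul a.ne_zero hsz0, ha w (by rwa [mem_over]), zero_add] at h
    rw [← vord_s, h]
  have h2 : ∀ i, ∀ w : Pl E, w.below K ∉ S → vord (k.conj i w).val (z : E) = vord w.val (z : E) := by
    intro i
    induction i with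
    | zero => intro w _; rw [k.conj_zero]
    | succ i ih =>
      intro w hw
      rw [← k.conj_conj 1 i, h1 _ (by rwa [k.below_conj]), ih w hw]
  let n : Pl K → ℤ := fun v => if v ∈ S then 0 else vord (Pl.exists_above K E v).choose.val (z : E)
  have hn : ∀ w : Pl E, w.below K ∉ S → n (w.below K) = vord w.val (z : E) := by
    intro w hw
    simp only [n, if_neg hw]
    obtain ⟨i, -, hi⟩ := k.exists_conj_eq (w := w) (w' := (Pl.exists_above K E (w.below K)).choose)
      (Pl.exists_above K E (w.below K)).choose_spec.symm
    rw [← hi, h2 i w hw]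
  have hfin : {v | n v ≠ 0}.Finite := by
    refine ((Pl.finite_support z).image (Pl.below K)).subset fun v hv => ?_
    obtain ⟨w, rfl⟩ := Pl.exists_above K E v
    have hw : w.below K ∉ S := fun h => hv (by simp only [n, if_pos h])
    refine ⟨w, ?_, rfl⟩
    rw [Set.mem_ofPred_eq, ← hn w hw]
    exact hv
  obtain ⟨c, hc⟩ := hS.exists_vord_eq n hfin
  have hc0 : algebraMap K E c ≠ 0 := (map_ne_zero _).2 c.ne_zero
  refine ⟨z * (Units.map (algebraMap K E : K →* E) c)⁻¹, ?_, ?_⟩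
  · intro w hw
    rw [mem_over] at hw
    rw [Units.val_mul, Units.val_inv_eq_inv_val, vord_mul hz0 (inv_ne_zero (by exact hc0)), vord_inv]
    have h3 : vord w.val (algebraMap K E c) = n (w.below K) := by
      rw [k.vord_algebraMap_of_unramified (by by_contra h; exact hw (hp' _ h)) (hx _ hw), hc _ hw]
    have h4 := hn w hw
    change _ + -(vord w.val (algebraMap K E c)) = 0
    rw [h3, h4, add_neg_cancel]
  · rw [Units.val_mul, Units.val_inv_eq_inv_val]
    change (a : E) * k.s (z * (algebraMap K E c)⁻¹) = z * (algebraMap K E c)⁻¹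
    rw [map_mul, map_inv₀, k.s.commutes, ← mul_assoc, hz]

open Classical in
theorem relIndex_norm_SU (hp2 : p ≠ 2) {S : Finset (Pl K)} (hS : ClOne S)
    (hp' : ∀ v : Pl K, vord v.val (p : K) ≠ 0 → v ∈ S) (hx : x ∈ SU S) :
    ((SU (k.placesOver S)).map (Units.map (Algebra.norm K : E →* K))).relIndex (SU S) * p =
      p ^ (S.filter k.Uniq).card := by
  have hp3 : 2 < p := lt_of_le_of_ne hp.out.two_le (Ne.symm hp2)
  let ι : Kˣ →* Eˣ := Units.map (algebraMap K E : K →* E)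
  let s : Eˣ →* Eˣ := Units.map (k.s : E →* E)
  have hsi : ∀ (i : ℕ) (a : Eˣ), ((s^[i] a : Eˣ) : E) = (k.s ^ i) a := by
    intro i
    induction i with
    | zero => intro a; rfl
    | succ i ih => intro a; rw [Function.iterate_succ_apply, ih, pow_succ]; rfl
  have hιval : ∀ w : Pl E, w ∉ k.placesOver S → ∀ c : K, vord w.val (algebraMap K E c) = vord (w.below K).val c := by
    intro w hw c
    rw [mem_over] at hw
    exact k.vord_algebraMap_of_unramified (by by_contra h; exact hw (hp' _ h)) (hx _ hw) c
  have hns : ∀ (w : Pl E) (i : ℕ), k.conj i w ∈ k.placesOver S ↔ w ∈ k.placesOver S := by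
    intro w i
    rw [mem_over, mem_over, k.below_conj]
  obtain ⟨l, h1, h2⟩ := herbrand_mul (p := p) (SU (k.placesOver S)) (SU S) s
    (fun a ha w hw => by
      have := ha (k.conj 1 w) (by rwa [hns])
      rwa [← vord_s] at this)
    (fun a => Units.ext (by rw [hsi, k.s_pow]; rfl)) ι
    (Units.map_injective (algebraMap K E).injective) (Units.map (Algebra.norm K : E →* K))
    (fun a => Units.ext (by
      rw [Units.coe_prod]
      simp only [hsi]
      exact k.norm_eq a))
    (fun b => by
      constructor
      · intro h v hv
        obtain ⟨w, rfl⟩ := Pl.exists_above K E v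
        rw [← hιval w (by rwa [mem_over])]
        exact h w (by rwa [mem_over])
      · intro h w hw
        have := hιval w hw b
        rw [h _ (by rwa [mem_over] at hw)] at this
        exact this)
    (fun a => by
      constructor
      · intro h
        obtain ⟨c, hc⟩ := k.fixed a (congrArg Units.val h)
        have hc0 : c ≠ 0 := by
          rintro rfl
          rw [map_zero] at hc
          exact a.ne_zero hc.symm
        exact ⟨Units.mk0 c hc0, Units.ext hc⟩
      · rintro ⟨b, rfl⟩
        exact Units.ext (k.s.commutes b))
    (fun a ha hN => by
      obtain ⟨b, hb, h⟩ := k.exists_of_norm_eq_one_of_mem_SU hS hp' hx ha (congrArg Units.val hN)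
      exact ⟨b, hb, Units.ext h⟩)
  have h3 := SU.finrank_eq S
  have h4 := SU.finrank_eq (k.placesOver S)
  have h5 := k.card_over S
  have h6 := two_mul_card_infinitePlace hp3 k.prim
  have h7 := two_mul_card_infinitePlace (K := E) hp3 (k.prim.map_of_injective (algebraMap K E).injective)
  have h8 : Module.finrank ℚ K * Module.finrank K E = Module.finrank ℚ E := Module.finrank_mul_finrank ℚ K E
  rw [k.finrank_eq] at h8
  generalize Module.finrank ℤ (Additive (SU S)) = m at *
  generalize Module.finrank ℤ (Additive (SU (k.placesOver S))) = M at *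
  generalize Fintype.card (InfinitePlace K) = r at *
  generalize Fintype.card (InfinitePlace E) = R at *
  generalize (S.filter k.Uniq).card = t at *
  have h9 : R = p * r := by
    have : 2 * R = 2 * (p * r) := by rw [h7, ← h8, ← h6]; ring
    omega
  obtain ⟨q, rfl⟩ : ∃ q, p = q + 1 := ⟨p - 1, by omega⟩
  simp only [Nat.add_sub_cancel] at *
  have h10 : l + t = m + 1 := by
    have hq : 0 < q := by omega
    have : q * (l + t) = q * (m + 1) := by
      have e1 : M + 1 + q * t = (q + 1) * S.card + (q + 1) * r := by rw [h4, h9]; linarith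
      rw [h1] at e1
      have e2 : (q + 1) * S.card + (q + 1) * r = (q + 1) * (m + 1) := by rw [← mul_add, h3]
      rw [e2] at e1
      nlinarith
    exact Nat.eq_of_mul_eq_mul_left hq this
  have hpos : 0 < (q + 1) ^ l := by positivity
  refine Nat.eq_of_mul_eq_mul_right hpos ?_
  rw [mul_assoc, mul_comm (q + 1), ← mul_assoc, h2, ← pow_succ, ← pow_add, ← h10, add_comm t]

end Over

end Kum

end

section

open WithZero NumberField

namespace Subgroup

variable {G : Type*} [CommGroup G]

theorem relIndex_eq_pow {p : ℕ} [hp : Fact p.Prime] {H U : Subgroup G}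
    (h : ∀ u ∈ U, u ^ p ∈ H) (h0 : H.relIndex U ≠ 0) : ∃ n, H.relIndex U = p ^ n := by
  have : Finite (U ⧸ H.subgroupOf U) := Nat.finite_of_card_ne_zero h0
  refine (IsPGroup.iff_card (p := p) (G := U ⧸ H.subgroupOf U)).1 fun g => ⟨1, ?_⟩
  obtain ⟨u, rfl⟩ := QuotientGroup.mk_surjective g
  rw [pow_one, ← QuotientGroup.mk_pow, QuotientGroup.eq_one_iff, mem_subgroupOf]
  exact h u u.2

theorem dvd_relIndex {p : ℕ} [hp : Fact p.Prime] {H U : Subgroup G}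
    (h : ∀ u ∈ U, u ^ p ∈ H) (h0 : ¬ U ≤ H) : p ∣ H.relIndex U := by
  rcases eq_or_ne (H.relIndex U) 0 with h1 | h1
  · rw [h1]; exact dvd_zero p
  obtain ⟨n, hn⟩ := relIndex_eq_pow h h1
  rw [hn]
  refine dvd_pow_self p ?_
  rintro rfl
  rw [pow_zero, relIndex_eq_one] at hn
  exact h0 hn

theorem dvd_index {p : ℕ} [hp : Fact p.Prime] {H : Subgroup G}
    (h : ∀ u, u ^ p ∈ H) (h0 : H ≠ ⊤) : p ∣ H.index := by
  rw [← relIndex_top_right]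
  exact dvd_relIndex (fun u _ => h u) fun h1 => h0 (top_le_iff.1 h1)

theorem sup_eq_top_of_index_le {H U : Subgroup G} (h0 : H.index ≠ 0)
    (h : H.index ≤ H.relIndex U) : U ⊔ H = ⊤ := by
  have h1 : H.relIndex U * (U ⊔ H).index = H.index := by
    rw [← relIndex_sup_right, relIndex_mul_index le_sup_right]
  have h2 : (U ⊔ H).index ≠ 0 := fun h2 => h0 (by rw [← h1, h2, mul_zero])
  have h3 : H.relIndex U ≠ 0 := fun h3 => h0 (by rw [← h1, h3, zero_mul])
  rw [← index_eq_one]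
  have h4 : H.relIndex U * (U ⊔ H).index ≤ H.relIndex U * 1 := by rw [h1, mul_one]; exact h
  have := Nat.le_of_mul_le_mul_left h4 (Nat.pos_of_ne_zero h3)
  omega

theorem relIndex_eq_index_of_sup_eq_top {H U : Subgroup G} (h : U ⊔ H = ⊤) :
    H.relIndex U = H.index := by
  rw [← relIndex_sup_right, h, relIndex_top_right]

end Subgroup

section Local

variable {p : ℕ} [hp : Fact p.Prime] {K : Type} [Field K] [NumberField K]

/-- The local `p`-th powers. -/
noncomputable abbrev Pl.D (p : ℕ) (v : Pl K) : Subgroup Kˣ := clos v.val (pows p K)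

theorem pow_mem_pows (p : ℕ) (u : Kˣ) : u ^ p ∈ pows p K := mem_pows.2 ⟨u, rfl⟩

theorem Pl.pow_mem_D (v : Pl K) (u : Kˣ) : u ^ p ∈ Pl.D p v := le_clos _ (pow_mem_pows p u)

theorem Pl.index_iInf_D {ζ : K} (hζ : IsPrimitiveRoot ζ p) (S : Finset (Pl K)) :
    (⨅ v ∈ S, Pl.D p v).index ≠ 0 := (Pl.index_iInf_clos_pows hζ S).1

theorem Pl.relIndex_D_units {ζ : K} (hζ : IsPrimitiveRoot ζ p) {v : Pl K}
    (hv : vord v.val (p : K) = 0) :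
    (Pl.D p v).relIndex (punit v.val 0) ≠ 0 ∧ (Pl.D p v).relIndex (punit v.val 0) ≤ p := by
  obtain ⟨π, hπ⟩ := v.exists_uniformizer
  have := relIndex_clos_pows_units (e := 0) hζ (by exact_mod_cast hp.out.ne_zero) v.qres_ne_zero hπ
    (by exact_mod_cast hv)
  rwa [pow_zero, mul_one] at this

theorem SU_le_punit {S : Finset (Pl K)} {v : Pl K} (hv : v ∉ S) : SU S ≤ punit v.val 0 := by
  intro u hu
  rw [mem_punit_zero]
  exact hu v hv

theorem Pl.relIndex_D_of_le {ζ : K} (hζ : IsPrimitiveRoot ζ p) {v : Pl K}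
    (hv : vord v.val (p : K) = 0) {U : Subgroup Kˣ} (hU : U ≤ punit v.val 0)
    (h : ¬ U ≤ Pl.D p v) : (Pl.D p v).relIndex U = p := by
  obtain ⟨h1, h2⟩ := Pl.relIndex_D_units hζ hv
  have h3 : (Pl.D p v).relIndex U ≠ 0 := fun h3 => h1 (Subgroup.relIndex_eq_zero_of_le_right hU h3)
  refine le_antisymm ((Subgroup.relIndex_le_of_le_right hU h1).trans h2) ?_
  exact Nat.le_of_dvd (Nat.pos_of_ne_zero h3) (Subgroup.dvd_relIndex (fun u _ => v.pow_mem_D u) h)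

/-- Away from `p`, units are locally a power of a given non-`p`-th power unit up to `p`-th
powers. -/
theorem Pl.exists_mul_pow_mem_D {ζ : K} (hζ : IsPrimitiveRoot ζ p) {v : Pl K}
    (hv : vord v.val (p : K) = 0) {x b : Kˣ} (hx : vord v.val (x : K) = 0)
    (hb : vord v.val (b : K) = 0) (hxD : x ∉ Pl.D p v) : ∃ k : ℤ, b * x ^ k ∈ Pl.D p v := by
  have hx' : x ∈ punit v.val 0 := mem_punit_zero.2 hx
  have h1 := Pl.relIndex_D_of_le hζ hv le_rfl fun h => hxD (h hx')
  have h2 := Pl.relIndex_D_of_le (U := Subgroup.zpowers x) hζ hv (by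
    rwa [Subgroup.zpowers_le]) (by rwa [Subgroup.zpowers_le])
  have h3 : punit v.val 0 ≤ Subgroup.zpowers x ⊔ Pl.D p v := by
    have hle : (Subgroup.zpowers x ⊔ Pl.D p v) ⊓ (punit v.val 0 ⊔ Pl.D p v) =
        Subgroup.zpowers x ⊔ Pl.D p v :=
      inf_eq_left.2 (sup_le_sup_right ((Subgroup.zpowers_le).2 hx') _)
    have h4 : (Pl.D p v).relIndex (Subgroup.zpowers x ⊔ Pl.D p v) *
        (Subgroup.zpowers x ⊔ Pl.D p v).relIndex (punit v.val 0 ⊔ Pl.D p v) =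
        (Pl.D p v).relIndex (punit v.val 0 ⊔ Pl.D p v) :=
      Subgroup.relIndex_mul_relIndex _ _ _ le_sup_right (inf_eq_left.1 hle)
    rw [Subgroup.relIndex_sup_right, Subgroup.relIndex_sup_right, h1, h2] at h4
    have h5 := Nat.eq_of_mul_eq_mul_left hp.out.pos (h4.trans (mul_one p).symm)
    rw [Subgroup.relIndex_eq_one] at h5
    exact le_sup_left.trans h5
  obtain ⟨y, hy, d, hd, h⟩ := Subgroup.mem_sup.1 (h3 (mem_punit_zero.2 hb))
  obtain ⟨k, rfl⟩ := Subgroup.mem_zpowers_iff.1 hy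
  refine ⟨-k, ?_⟩
  rw [← h, zpow_neg, mul_right_comm, mul_inv_cancel, one_mul]
  exact hd

end Local

namespace Kum

variable {p : ℕ} [hp : Fact p.Prime] {K E : Type} [Field K] [NumberField K] [Field E]
  [NumberField E] [Algebra K E] {ζ : K} {x : Kˣ} (k : Kum p E ζ x)

/-- The local norms. -/
noncomputable abbrev N (_ : Kum p E ζ x) (v : Pl K) : Subgroup Kˣ := clos v.val (norms K E)

include k in
theorem pows_le_norms : pows p K ≤ norms K E := by
  intro u hu
  obtain ⟨y, rfl⟩ := mem_pows.1 hu
  refine ⟨Units.map (algebraMap K E : K →* E) y, Units.ext ?_⟩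
  change Algebra.norm K (algebraMap K E y) = _
  rw [Algebra.norm_algebraMap, k.finrank_eq, Units.val_pow_eq_pow_val]

theorem D_le_N (v : Pl K) : Pl.D p v ≤ k.N v := clos_mono k.pows_le_norms

theorem exists_punit_le_N (v : Pl K) : ∃ n, punit v.val n ≤ k.N v := by
  obtain ⟨n, hn⟩ := Pl.exists_punit_le_clos_pows p v
  exact ⟨n, hn.trans (k.D_le_N v)⟩

theorem pow_mem_N (v : Pl K) (u : Kˣ) : u ^ p ∈ k.N v := k.D_le_N v (v.pow_mem_D u)

variable {k} in
theorem Uniq.N_ne_top {v : Pl K} (h : k.Uniq v) : k.N v ≠ ⊤ := by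
  obtain ⟨w, rfl, hw⟩ := h
  obtain ⟨π, hπ⟩ := (w.below K).exists_uniformizer
  obtain ⟨ϖ, hϖ⟩ := w.exists_uniformizer
  rcases k.inv_cases hw with h1 | ⟨h1, h2⟩
  · exact k.clos_norms_ne_top_of_inert hw h1 hπ
  · exact k.clos_norms_ne_top_of_ramified hw h1 hπ h2 hϖ (Pl.qres_ne_zero _)

theorem index_N_ne_zero (v : Pl K) : (k.N v).index ≠ 0 :=
  fun h => (Pl.index_clos_pows k.prim v).1
    (Nat.eq_zero_of_zero_dvd (h ▸ Subgroup.index_dvd_of_le (k.D_le_N v)))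

variable {k} in
theorem Uniq.dvd_index {v : Pl K} (h : k.Uniq v) : p ∣ (k.N v).index :=
  Subgroup.dvd_index (k.pow_mem_N v) h.N_ne_top

variable {k} in
theorem Uniq.not_mem_D {v : Pl K} (h : k.Uniq v) : x ∉ Pl.D p v := by
  obtain ⟨w, rfl, hw⟩ := h
  obtain ⟨e, he, h⟩ := w.exists_ramification (algebraMap K E)
  exact k.not_mem_clos_pows hw (by omega) h (by exact_mod_cast hp.out.ne_zero)

theorem norms_le_N (v : Pl K) : norms K E ≤ k.N v := le_clos _

open Classical in
/-- The elements which are local norms at all nonsplit places of `S`. -/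
noncomputable def M (S : Finset (Pl K)) : Subgroup Kˣ := ⨅ v ∈ S.filter k.Uniq, k.N v

open Classical in
theorem index_M (S : Finset (Pl K)) :
    (k.M S).index = ∏ v ∈ S.filter k.Uniq, (k.N v).index :=
  Pl.index_iInf_eq_prod _ _ fun v _ => k.exists_punit_le_N v

theorem norms_le_M (S : Finset (Pl K)) : norms K E ≤ k.M S :=
  le_iInf₂ fun v _ => k.norms_le_N v

theorem index_M_ne_zero (S : Finset (Pl K)) : (k.M S).index ≠ 0 := by
  rw [index_M]
  exact Finset.prod_ne_zero_iff.2 fun v _ => k.index_N_ne_zero v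

open Classical in
theorem pow_le_index_M (S : Finset (Pl K)) : p ^ (S.filter k.Uniq).card ≤ (k.M S).index := by
  rw [index_M, ← Finset.prod_const]
  refine Finset.prod_le_prod' fun v hv => ?_
  exact Nat.le_of_dvd (Nat.pos_of_ne_zero (k.index_N_ne_zero v)) (Finset.mem_filter.1 hv).2.dvd_index

theorem iInf_D_le_M {S S' : Finset (Pl K)} (h : ∀ v ∈ S, k.Uniq v → v ∈ S') :
    ⨅ v ∈ S', Pl.D p v ≤ k.M S := by
  classical
  refine le_iInf₂ fun v hv => (iInf₂_le v (h v ?_ ?_)).trans (k.D_le_N v)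
  · exact (Finset.mem_filter.1 hv).1
  · exact (Finset.mem_filter.1 hv).2

/-- The first inequality for `S`-units. -/
theorem sup_M_ne_top (hp2 : p ≠ 2) {S : Finset (Pl K)} (hS : ClOne S)
    (hp' : ∀ v : Pl K, vord v.val (p : K) ≠ 0 → v ∈ S) (hx : x ∈ SU S) :
    SU S ⊔ k.M S ≠ ⊤ := by
  classical
  intro h
  have h1 := k.relIndex_norm_SU hp2 hS hp' hx
  have h2 := Subgroup.relIndex_eq_index_of_sup_eq_top h
  have h3 := k.pow_le_index_M S
  have hle : (SU (k.placesOver S)).map (Units.map (Algebra.norm K : E →* K)) ≤ k.M S :=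
    le_trans (by rintro _ ⟨y, _, rfl⟩; exact ⟨y, rfl⟩) (k.norms_le_M S)
  have h0 : ((SU (k.placesOver S)).map (Units.map (Algebra.norm K : E →* K))).relIndex (SU S) ≠ 0 := by
    intro h0
    rw [h0, zero_mul] at h1
    exact pow_ne_zero _ hp.out.ne_zero h1.symm
  have h4 := Subgroup.relIndex_le_of_le_left hle h0
  rw [h2] at h4
  rw [← h1] at h3
  have := hp.out.two_le
  have h5 := Nat.pos_of_ne_zero h0
  nlinarith

end Kum

end

section

open WithZero NumberField

namespace Subgroup

variable {G : Type*} [CommGroup G]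

theorem le_sup_of_relIndex_le {H U W : Subgroup G} (hUW : U ≤ W) (h0 : H.relIndex W ≠ 0)
    (h : H.relIndex W ≤ H.relIndex U) : W ≤ U ⊔ H := by
  have h1 : H.relIndex (U ⊔ H) * (U ⊔ H).relIndex (W ⊔ H) = H.relIndex (W ⊔ H) :=
    relIndex_mul_relIndex _ _ _ le_sup_right (sup_le_sup_right hUW _)
  rw [relIndex_sup_right, relIndex_sup_right] at h1
  have h3 : H.relIndex U ≠ 0 := fun h3 => h0 (by rw [← h1, h3, zero_mul])
  have h4 : H.relIndex U * (U ⊔ H).relIndex (W ⊔ H) ≤ H.relIndex U * 1 := by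
    rw [h1, mul_one]; exact h
  have h5 := Nat.le_of_mul_le_mul_left h4 (Nat.pos_of_ne_zero h3)
  have h6 : (U ⊔ H).relIndex (W ⊔ H) ≠ 0 := fun h6 => h0 (by rw [← h1, h6, mul_zero])
  have h7 : (U ⊔ H).relIndex (W ⊔ H) = 1 := by omega
  rw [relIndex_eq_one] at h7
  exact le_sup_left.trans h7

theorem inf_le_of_relIndex_eq {N M U : Subgroup G} (hNM : N ≤ M) (h0 : M.relIndex U ≠ 0)
    (h : N.relIndex U = M.relIndex U) : M ⊓ U ≤ N := by
  have h1 := relIndex_inf_mul_relIndex (H := N) (K := M) (L := U)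
  rw [inf_eq_left.2 hNM, h] at h1
  rw [← relIndex_eq_one]
  exact Nat.eq_of_mul_eq_mul_right (Nat.pos_of_ne_zero h0) (h1.trans (one_mul _).symm)

theorem mem_of_zpow_mem {p : ℕ} (hp : p.Prime) {H : Subgroup G} {z : G} (h : z ^ p ∈ H) {i : ℤ}
    (hi : ¬ (p : ℤ) ∣ i) (h' : z ^ i ∈ H) : z ∈ H := by
  have hc : IsCoprime (p : ℤ) i :=
    ((Nat.prime_iff_prime_int.1 hp).irreducible.coprime_iff_not_dvd).2 hi
  obtain ⟨a, b, hab⟩ := hc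
  rw [← zpow_one z, ← hab, zpow_add, mul_comm a, mul_comm b, zpow_mul, zpow_mul, zpow_natCast]
  exact H.mul_mem (H.zpow_mem h a) (H.zpow_mem h' b)

end Subgroup

section

variable {p : ℕ} [hp : Fact p.Prime] {K : Type} [Field K] [NumberField K]

/-- Sets of places which contain all places above `p` and outside of which there are elements of
prescribed valuations. -/
structure Good (p : ℕ) {K : Type} [Field K] [NumberField K] (S : Finset (Pl K)) : Prop where
  clOne : ClOne S
  mem : ∀ v : Pl K, vord v.val (p : K) ≠ 0 → v ∈ S

theorem Good.mono {S S' : Finset (Pl K)} (h : Good p S) (hS : S ⊆ S') : Good p S' :=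
  ⟨h.clOne.mono hS, fun v hv => hS (h.mem v hv)⟩

theorem Good.vord_eq {S : Finset (Pl K)} (h : Good p S) {v : Pl K} (hv : v ∉ S) :
    vord v.val (p : K) = 0 := by
  by_contra h'
  exact hv (h.mem v h')

variable (p K) in
theorem exists_good : ∃ S : Finset (Pl K), Good p S := by
  classical
  obtain ⟨S, hS⟩ := exists_clOne K
  have hp0 : (p : K) ≠ 0 := by exact_mod_cast hp.out.ne_zero
  refine ⟨S ∪ (Pl.finite_support (Units.mk0 (p : K) hp0)).toFinset,
    hS.mono Finset.subset_union_left, fun v hv => ?_⟩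
  refine Finset.mem_union_right _ ?_
  rw [Set.Finite.mem_toFinset]
  exact hv

theorem exists_SU_sup_eq_top {H : Subgroup Kˣ} (h : H.index ≠ 0) :
    ∃ S : Finset (Pl K), SU S ⊔ H = ⊤ := by
  classical
  have : Finite (Kˣ ⧸ H) := Nat.finite_of_card_ne_zero h
  have := Fintype.ofFinite (Kˣ ⧸ H)
  choose f hf using fun q : Kˣ ⧸ H => exists_mem_SU (Quotient.out q)
  refine ⟨Finset.univ.biUnion f, top_le_iff.1 fun u _ => ?_⟩
  have h1 : (Quotient.out (u : Kˣ ⧸ H))⁻¹ * u ∈ H := by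
    rw [← QuotientGroup.eq]
    exact QuotientGroup.out_eq' _
  rw [← mul_inv_cancel_left (Quotient.out (u : Kˣ ⧸ H)) u]
  refine Subgroup.mul_mem_sup (SU_mono ?_ (hf _)) h1
  exact Finset.subset_biUnion_of_mem f (Finset.mem_univ _)

theorem mem_iInf_D {S : Finset (Pl K)} {x : Kˣ} :
    x ∈ ⨅ v ∈ S, Pl.D p v ↔ ∀ v ∈ S, x ∈ Pl.D p v := by
  simp only [Subgroup.mem_iInf]

theorem pows_le_iInf_D (S : Finset (Pl K)) : pows p K ≤ ⨅ v ∈ S, Pl.D p v :=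
  le_iInf₂ fun _ _ => le_clos _

theorem relIndex_iInf_D_le {ζ : K} (hζ : IsPrimitiveRoot ζ p) (T : Finset (Pl K))
    {W : Subgroup Kˣ} (hT : ∀ v ∈ T, vord v.val (p : K) = 0) (hW : ∀ v ∈ T, W ≤ punit v.val 0) :
    (⨅ v ∈ T, Pl.D p v).relIndex W ≤ p ^ T.card := by
  classical
  induction T using Finset.induction_on with
  | empty => simp
  | insert t T ht ih =>
    rw [Finset.iInf_insert, Finset.card_insert_of_notMem ht, pow_succ']
    refine (Subgroup.relIndex_inf_le).trans (Nat.mul_le_mul ?_ (ih ?_ ?_))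
    · obtain ⟨h1, h2⟩ := Pl.relIndex_D_units hζ (hT t (Finset.mem_insert_self t T))
      exact (Subgroup.relIndex_le_of_le_right (hW t (Finset.mem_insert_self t T)) h1).trans h2
    · exact fun v hv => hT v (Finset.mem_insert_of_mem hv)
    · exact fun v hv => hW v (Finset.mem_insert_of_mem hv)

theorem relIndex_iInf_D_ne_zero {ζ : K} (hζ : IsPrimitiveRoot ζ p) (T : Finset (Pl K))
    (W : Subgroup Kˣ) : (⨅ v ∈ T, Pl.D p v).relIndex W ≠ 0 := fun h =>
  Pl.index_iInf_D hζ T (Nat.eq_zero_of_zero_dvd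
    (h ▸ Subgroup.relIndex_dvd_index_of_normal (⨅ v ∈ T, Pl.D p v) W))

theorem sup_iInf_D_eq_top_of_spanning {ζ : K} (hζ : IsPrimitiveRoot ζ p)
    {S T : Finset (Pl K)} [DecidableEq (Pl K)] (hS : Good p S) (hST : Disjoint S T)
    (hT : T.card = S.card + Fintype.card (InfinitePlace K))
    (hinj : ∀ b ∈ SU S, (∀ v ∈ T, b ∈ Pl.D p v) → b ∈ pows p K) :
    SU (S ∪ T) ⊔ ⨅ v ∈ T, Pl.D p v = ⊤ := by
  have hT' : ∀ v ∈ T, v ∉ S := fun v hv hv' => Finset.disjoint_left.1 hST hv' hv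
  have hle : SU S ≤ ⨅ v ∈ T, punit v.val 0 := le_iInf₂ fun v hv => SU_le_punit (hT' v hv)
  have h1 : (⨅ v ∈ T, punit v.val 0 : Subgroup Kˣ) ≤ SU S ⊔ ⨅ v ∈ T, Pl.D p v := by
    refine Subgroup.le_sup_of_relIndex_le hle (relIndex_iInf_D_ne_zero hζ T _) ?_
    refine (relIndex_iInf_D_le hζ T (fun v hv => hS.vord_eq (hT' v hv))
      fun v hv => iInf₂_le v hv).trans ?_
    rw [hT, ← SU.relIndex_pows S hζ, ← Subgroup.inf_relIndex_right (⨅ v ∈ T, Pl.D p v)]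
    refine Subgroup.relIndex_le_of_le_left ?_ ?_
    · rintro b ⟨hb1, hb2⟩
      exact hinj b hb2 (mem_iInf_D.1 hb1)
    · rw [Subgroup.inf_relIndex_right]
      exact relIndex_iInf_D_ne_zero hζ T _
  refine top_le_iff.1 fun y _ => ?_
  obtain ⟨c, hc⟩ := hS.clOne.exists_vord_eq (fun v => if v ∈ T then vord v.val (y : K) else 0)
    (T.finite_toSet.subset fun v hv => by
      by_contra h'
      exact hv (if_neg h'))
  have hc1 : c ∈ SU (S ∪ T) := by
    intro v hv
    rw [Finset.mem_union, not_or] at hv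
    rw [hc v hv.1, if_neg hv.2]
  have hc2 : c⁻¹ * y ∈ (⨅ v ∈ T, punit v.val 0 : Subgroup Kˣ) := by
    simp only [Subgroup.mem_iInf]
    intro v hv
    rw [mem_punit_zero, Units.val_mul, vord_mul (Units.ne_zero _) (Units.ne_zero _),
      Units.val_inv_eq_inv_val, vord_inv, hc v (hT' v hv), if_pos hv]
    ring
  rw [← mul_inv_cancel_left c y]
  refine Subgroup.mul_mem _ (Subgroup.mem_sup_left hc1) ?_
  exact sup_le_sup_right (SU_mono Finset.subset_union_left) _ (h1 hc2)

theorem sup_iInf_D_eq_top (hp2 : p ≠ 2) {ζ : K} (hζ : IsPrimitiveRoot ζ p)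
    {S T : Finset (Pl K)} [DecidableEq (Pl K)] (hS : Good p S) (hST : Disjoint S T)
    (hT : T.card = S.card + Fintype.card (InfinitePlace K))
    (hinj : ∀ b ∈ SU S, (∀ v ∈ T, b ∈ Pl.D p v) → b ∈ pows p K) :
    SU (S ∪ T) ⊔ ⨅ v ∈ S, Pl.D p v = ⊤ := by
  have hST' : Good p (S ∪ T) := hS.mono Finset.subset_union_left
  have h1 := sup_iInf_D_eq_top_of_spanning hζ hS hST hT hinj
  have h2 : (⨅ v ∈ S, Pl.D p v) ⊓ SU (S ∪ T) ≤ pows p K := by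
    rintro x ⟨hx1, hx2⟩
    by_contra hx
    obtain ⟨E, _, _, _, ⟨k⟩⟩ := exists_kum hζ hx
    refine k.sup_M_ne_top hp2 hST'.clOne hST'.mem hx2 (top_le_iff.1 ?_)
    rw [← h1]
    refine sup_le_sup_left (k.iInf_D_le_M fun v hv hu => ?_) _
    refine (Finset.mem_union.1 hv).resolve_left fun hv' => ?_
    exact hu.not_mem_D (mem_iInf_D.1 hx1 v hv')
  obtain ⟨h3, h4⟩ := Pl.index_iInf_clos_pows hζ S
  refine Subgroup.sup_eq_top_of_index_le h3 (h4.trans ?_)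
  have hp3 : 2 < p := lt_of_le_of_ne hp.out.two_le (Ne.symm hp2)
  rw [← two_mul_card_infinitePlace hp3 hζ, ← mul_add, two_mul]
  nth_rewrite 1 [← hT]
  have h5 : T.card + (S.card + Fintype.card (InfinitePlace K)) =
      (S ∪ T).card + Fintype.card (InfinitePlace K) := by
    rw [Finset.card_union_of_disjoint hST]; ring
  rw [h5, ← SU.relIndex_pows (S ∪ T) hζ, ← Subgroup.inf_relIndex_right (⨅ v ∈ S, Pl.D p v)]
  refine Subgroup.relIndex_le_of_le_left h2 ?_
  rw [Subgroup.inf_relIndex_right]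
  exact relIndex_iInf_D_ne_zero hζ S _

theorem Kum.exists_uniq (hp2 : p ≠ 2) {E : Type} [Field E] [NumberField E] [Algebra K E] {ζ : K}
    {x : Kˣ} (k : Kum p E ζ x) (S : Finset (Pl K)) : ∃ v ∉ S, k.Uniq v := by
  classical
  by_contra! h
  obtain ⟨S1, h1⟩ := exists_SU_sup_eq_top (Pl.index_iInf_D k.prim S)
  obtain ⟨S2, h2⟩ := exists_good p K
  obtain ⟨S3, h3⟩ := exists_mem_SU x
  have hg : Good p (S1 ∪ S2 ∪ S3) := h2.mono fun v hv => by simp [hv]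
  refine k.sup_M_ne_top hp2 hg.clOne hg.mem
    (SU_mono Finset.subset_union_right h3) (top_le_iff.1 ?_)
  rw [← h1]
  refine sup_le_sup (SU_mono fun v hv => by simp [hv]) (k.iInf_D_le_M fun v _ hu => ?_)
  by_contra h'
  exact h v h' hu

theorem exists_not_mem_D (hp2 : p ≠ 2) {ζ : K} (hζ : IsPrimitiveRoot ζ p) {x : Kˣ}
    (hx : x ∉ pows p K) (S : Finset (Pl K)) : ∃ v ∉ S, x ∉ Pl.D p v := by
  obtain ⟨E, _, _, _, ⟨k⟩⟩ := exists_kum hζ hx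
  obtain ⟨v, hv, hu⟩ := k.exists_uniq hp2 S
  exact ⟨v, hv, hu.not_mem_D⟩

open Classical in
theorem exists_spanning {ζ : K} (hζ : IsPrimitiveRoot ζ p) {S : Finset (Pl K)} (hS : Good p S)
    (Q : Pl K → Prop) (T₀ : Finset (Pl K))
    (step : ∀ T : Finset (Pl K), T₀ ⊆ T → Disjoint S T → (∀ t ∈ T, t ∉ T₀ → Q t) →
      ∀ b ∈ SU S, (∀ t ∈ T, b ∈ Pl.D p t) → b ∉ pows p K →
        ∃ t, t ∉ S ∧ t ∉ T ∧ Q t ∧ b ∉ Pl.D p t)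
    (hT₀ : Disjoint S T₀) (h₀ : (⨅ v ∈ T₀, Pl.D p v).relIndex (SU S) = p ^ T₀.card) :
    ∃ T, T₀ ⊆ T ∧ Disjoint S T ∧ T.card = S.card + Fintype.card (InfinitePlace K) ∧
      (∀ t ∈ T, t ∉ T₀ → Q t) ∧ ∀ b ∈ SU S, (∀ v ∈ T, b ∈ Pl.D p v) → b ∈ pows p K := by
  suffices H : ∀ n : ℕ, ∀ T : Finset (Pl K), T₀ ⊆ T → Disjoint S T → (∀ t ∈ T, t ∉ T₀ → Q t) →
      (⨅ v ∈ T, Pl.D p v).relIndex (SU S) = p ^ T.card →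
      S.card + Fintype.card (InfinitePlace K) ≤ T.card + n →
      ∃ T, T₀ ⊆ T ∧ Disjoint S T ∧ T.card = S.card + Fintype.card (InfinitePlace K) ∧
      (∀ t ∈ T, t ∉ T₀ → Q t) ∧ ∀ b ∈ SU S, (∀ v ∈ T, b ∈ Pl.D p v) → b ∈ pows p K from
    H _ T₀ subset_rfl hT₀ (fun t h h' => absurd h h') h₀ (Nat.le_add_left _ _)
  have hle : ∀ T : Finset (Pl K), (⨅ v ∈ T, Pl.D p v).relIndex (SU S) = p ^ T.card →
      T.card ≤ S.card + Fintype.card (InfinitePlace K) := by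
    intro T hT
    rw [← Nat.pow_le_pow_iff_right hp.out.one_lt, ← hT, ← SU.relIndex_pows S hζ]
    refine Subgroup.relIndex_le_of_le_left (pows_le_iInf_D T) ?_
    rw [SU.relIndex_pows S hζ]
    exact pow_ne_zero _ hp.out.ne_zero
  intro n
  induction n with
  | zero =>
    intro T h1 h2 h3 h4 h5
    refine ⟨T, h1, h2, le_antisymm (hle T h4) h5, h3, ?_⟩
    by_contra! h6
    obtain ⟨b, hb, hb', hbn⟩ := h6
    obtain ⟨t, htS, htT, -, htb⟩ := step T h1 h2 h3 b hb hb' hbn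
    have h7 := hle (insert t T) (by
      rw [Finset.iInf_insert, Finset.card_insert_of_notMem htT, pow_succ', ← h4,
        ← Subgroup.relIndex_inf_mul_relIndex, Pl.relIndex_D_of_le hζ (hS.vord_eq htS)
          (inf_le_right.trans (SU_le_punit htS)) fun h => htb (h ⟨mem_iInf_D.2 hb', hb⟩)])
    rw [Finset.card_insert_of_notMem htT] at h7
    omega
  | succ n ih =>
    intro T h1 h2 h3 h4 h5
    by_cases h6 : ∀ b ∈ SU S, (∀ v ∈ T, b ∈ Pl.D p v) → b ∈ pows p K
    · refine ⟨T, h1, h2, ?_, h3, h6⟩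
      refine Nat.pow_right_injective hp.out.two_le ?_
      change p ^ _ = p ^ _
      rw [← h4, ← SU.relIndex_pows S hζ]
      refine le_antisymm ?_ ?_
      · refine Subgroup.relIndex_le_of_le_left (pows_le_iInf_D T) ?_
        rw [SU.relIndex_pows S hζ]
        exact pow_ne_zero _ hp.out.ne_zero
      · rw [← Subgroup.inf_relIndex_right (⨅ v ∈ T, Pl.D p v)]
        refine Subgroup.relIndex_le_of_le_left ?_ ?_
        · rintro b ⟨hb1, hb2⟩
          exact h6 b hb2 (mem_iInf_D.1 hb1)
        · rw [Subgroup.inf_relIndex_right]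
          exact relIndex_iInf_D_ne_zero hζ T _
    · push Not at h6
      obtain ⟨b, hb, hb', hbn⟩ := h6
      obtain ⟨t, htS, htT, htQ, htb⟩ := step T h1 h2 h3 b hb hb' hbn
      refine ih (insert t T) (h1.trans (Finset.subset_insert _ _))
        (Finset.disjoint_insert_right.2 ⟨htS, h2⟩) ?_ ?_ ?_
      · intro t' ht' ht0
        rcases Finset.mem_insert.1 ht' with rfl | ht'
        · exact htQ
        · exact h3 t' ht' ht0
      · rw [Finset.iInf_insert, Finset.card_insert_of_notMem htT, pow_succ', ← h4,
          ← Subgroup.relIndex_inf_mul_relIndex, Pl.relIndex_D_of_le hζ (hS.vord_eq htS)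
            (inf_le_right.trans (SU_le_punit htS)) fun h => htb (h ⟨mem_iInf_D.2 hb', hb⟩)]
      · rw [Finset.card_insert_of_notMem htT]
        omega

end

end

section

open WithZero NumberField

section

variable {p : ℕ} [hp : Fact p.Prime] {K E : Type} [Field K] [NumberField K] [Field E]
  [NumberField E] [Algebra K E]

/-- The inclusion of multiplicative groups. -/
abbrev incl (K E : Type) [Field K] [Field E] [Algebra K E] : Kˣ →* Eˣ :=
  Units.map (algebraMap K E : K →* E)

theorem coe_incl (u : Kˣ) : (incl K E u : E) = algebraMap K E u := rfl

theorem incl_mem_punit {w : Pl E} {n : ℕ} {u : Kˣ} (h : u ∈ punit (w.below K).val n) :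
    incl K E u ∈ punit w.val n := by
  obtain ⟨e, he, hf⟩ := w.exists_ramification (algebraMap K E)
  rw [mem_punit] at h ⊢
  refine ⟨by rw [coe_incl, hf, h.1, mul_zero], ?_⟩
  have h1 : (incl K E u : E) - 1 = algebraMap K E ((u : K) - 1) := by
    rw [coe_incl, map_sub, map_one]
  rw [h1]
  rcases eq_or_ne ((u : K) - 1) 0 with h0 | h0
  · rw [h0, map_zero]; exact zero_mem _
  rw [mem_filt_iff ((map_ne_zero _).2 h0), hf]
  have h2 := (mem_filt_iff h0).1 h.2
  have h3 : (1 : ℤ) ≤ e := by omega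
  nlinarith

theorem incl_mem_D {w : Pl E} {u : Kˣ} (h : u ∈ Pl.D p (w.below K)) :
    incl K E u ∈ Pl.D p w := by
  rw [mem_clos] at h ⊢
  intro n
  obtain ⟨y, hy, h1⟩ := h n
  obtain ⟨z, rfl⟩ := mem_pows.1 hy
  refine ⟨incl K E (z ^ p), by rw [map_pow]; exact pow_mem_pows p _, ?_⟩
  rw [← map_inv, ← map_mul]
  exact incl_mem_punit h1

namespace Kum

variable {ζ : K} {x : Kˣ} (k : Kum p E ζ x)

include k in
theorem incl_mem_pows : incl K E x ∈ pows p E := by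
  refine mem_pows.2 ⟨Units.mk0 k.γ k.γ_ne_zero, Units.ext ?_⟩
  rw [Units.val_pow_eq_pow_val, Units.val_mk0, k.pow_γ]
  rfl

include k in
theorem exists_of_incl_mem_pows {b : Kˣ} (h : incl K E b ∈ pows p E) :
    ∃ (i : ℕ) (c : Kˣ), b = x ^ i * c ^ p := by
  obtain ⟨z, hz⟩ := mem_pows.1 h
  have hz' : (z : E) ^ p = algebraMap K E b := by
    rw [← Units.val_pow_eq_pow_val, hz]; rfl
  have hprim : IsPrimitiveRoot (algebraMap K E ζ) p :=
    k.prim.map_of_injective (algebraMap K E).injective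
  have h1 : (k.s z / z) ^ p = 1 := by
    rw [div_pow, ← map_pow, hz', AlgEquiv.commutes, div_self]
    simp
  obtain ⟨i, -, hi⟩ := hprim.eq_pow_of_pow_eq_one h1
  have hγ := k.γ_ne_zero
  have hz0 := z.ne_zero
  obtain ⟨c, hc⟩ := k.fixed (z / k.γ ^ i) (by
    have h3 : k.s z = algebraMap K E ζ ^ i * z := by rw [hi, div_mul_cancel₀ _ hz0]
    have h4 : algebraMap K E ζ ≠ 0 := hprim.ne_zero hp.out.ne_zero
    rw [map_div₀, map_pow, k.s_γ, h3, mul_pow]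
    field_simp)
  have hc0 : c ≠ 0 := by
    rintro rfl
    rw [map_zero] at hc
    exact div_ne_zero hz0 (pow_ne_zero _ hγ) hc.symm
  refine ⟨i, Units.mk0 c hc0, Units.ext ((algebraMap K E).injective ?_)⟩
  simp only [Units.val_mul, Units.val_pow_eq_pow_val, Units.val_mk0, map_mul, map_pow, hc]
  rw [← hz', ← k.pow_γ, div_pow]
  field_simp
  rw [← pow_mul, ← pow_mul, mul_comm]

end Kum

theorem exists_not_mem_D_both (hp2 : p ≠ 2) {ζ : K} (hζ : IsPrimitiveRoot ζ p) {a b : Kˣ}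
    (ha : a ∉ pows p K) (hb : b ∉ Subgroup.zpowers a ⊔ pows p K) (S : Finset (Pl K)) :
    ∃ v ∉ S, a ∉ Pl.D p v ∧ b ∉ Pl.D p v := by
  classical
  have hab : a / b ∉ pows p K := by
    intro h
    apply hb
    have : b = a * (a / b)⁻¹ := by rw [inv_div, mul_div_cancel]
    rw [this]
    exact Subgroup.mul_mem_sup (Subgroup.mem_zpowers a) (inv_mem h)
  obtain ⟨M, _, _, _, ⟨k⟩⟩ := exists_kum hζ hab
  have haM : incl K M a ∉ pows p M := by
    intro h
    obtain ⟨i, c, hc⟩ := k.exists_of_incl_mem_pows h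
    have h1 : b ^ (i : ℤ) = a ^ ((i : ℤ) - 1) * c ^ p := by
      rw [zpow_sub_one, zpow_natCast, zpow_natCast, mul_right_comm, eq_mul_inv_iff_mul_eq]
      nth_rewrite 1 [hc]
      rw [div_pow, ← mul_assoc]
      congr 1
      rw [mul_div_cancel]
    by_cases hi : (p : ℤ) ∣ i
    · refine ha (Subgroup.mem_of_zpow_mem hp.out (pow_mem_pows p a) (i := i - 1) ?_ ?_)
      · intro h'
        have := (Int.dvd_sub hi h')
        rw [sub_sub_cancel] at this
        exact hp.out.one_lt.ne' (by exact_mod_cast Int.eq_one_of_dvd_one (by positivity) this)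
      · have : a ^ ((i : ℤ) - 1) = b ^ (i : ℤ) * (c ^ p)⁻¹ := by rw [h1]; group
        rw [this]
        obtain ⟨j, hj⟩ := hi
        rw [hj, zpow_mul, zpow_natCast]
        exact mul_mem (zpow_mem (pow_mem_pows p b) j) (inv_mem (pow_mem_pows p c))
    · refine hb (Subgroup.mem_of_zpow_mem hp.out
        (Subgroup.mem_sup_right (pow_mem_pows p b)) hi ?_)
      rw [h1]
      exact Subgroup.mul_mem_sup (zpow_mem (Subgroup.mem_zpowers a) _) (pow_mem_pows p c)
  have hζM : IsPrimitiveRoot (algebraMap K M ζ) p :=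
    hζ.map_of_injective (algebraMap K M).injective
  obtain ⟨w, hw, haw⟩ := exists_not_mem_D hp2 hζM haM (k.placesOver S)
  refine ⟨w.below K, fun h => hw (k.mem_over.2 h), fun h => haw (incl_mem_D h), fun h => haw ?_⟩
  have h1 : incl K M a = incl K M b * incl K M (a / b) := by
    rw [← map_mul, mul_div_cancel]
  rw [h1]
  exact mul_mem (incl_mem_D h) (le_clos _ k.incl_mem_pows)

namespace Kum

variable {ζ : K} {x : Kˣ} (k : Kum p E ζ x)

open Classical in
theorem exists_norm_spanning (hp2 : p ≠ 2) {S : Finset (Pl K)} (hS : Good p S) (hx : x ∈ SU S) :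
    ∃ T, Disjoint S T ∧ T.card = S.card + Fintype.card (InfinitePlace K) ∧
      (∀ b ∈ SU S, (∀ v ∈ T, b ∈ Pl.D p v) → b ∈ pows p K) ∧
      (T.filter k.Uniq).card = 1 := by
  obtain ⟨t₀, ht₀, hu⟩ := k.exists_uniq hp2 S
  have hx₀ := hu.not_mem_D
  have hE : IsPrimitiveRoot (algebraMap K E ζ) p :=
    k.prim.map_of_injective (algebraMap K E).injective
  obtain ⟨T, hT₀, hST, hT, hQ, hinj⟩ := exists_spanning k.prim hS (fun v => x ∈ Pl.D p v) {t₀}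
    (by
      intro T hT hST _ b hb hbT hbp
      have hbE : incl K E b ∉ pows p E := by
        intro h
        obtain ⟨i, c, hc⟩ := k.exists_of_incl_mem_pows h
        have h1 : x ^ (i : ℤ) ∈ Pl.D p t₀ := by
          have : x ^ (i : ℤ) = b * (c ^ p)⁻¹ := by rw [hc, zpow_natCast]; group
          rw [this]
          exact mul_mem (hbT t₀ (hT (Finset.mem_singleton_self _))) (inv_mem (t₀.pow_mem_D c))
        by_cases hi : (p : ℤ) ∣ i
        · refine hbp ?_
          obtain ⟨j, hj⟩ := hi
          rw [hc, ← zpow_natCast, hj, zpow_mul, zpow_natCast]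
          exact mul_mem (zpow_mem (pow_mem_pows p x) j) (pow_mem_pows p c)
        · exact hx₀ (Subgroup.mem_of_zpow_mem hp.out (t₀.pow_mem_D x) hi h1)
      obtain ⟨w, hw, hbw⟩ := exists_not_mem_D hp2 hE hbE (k.placesOver (S ∪ T))
      rw [k.mem_over, Finset.mem_union, not_or] at hw
      refine ⟨w.below K, hw.1, hw.2, ?_, fun h => hbw (incl_mem_D h)⟩
      by_contra hxD
      obtain ⟨j, hj⟩ := Pl.exists_mul_pow_mem_D k.prim (hS.vord_eq hw.1) (hx _ hw.1) (hb _ hw.1) hxD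
      refine hbw ?_
      have h2 : incl K E b = incl K E (b * x ^ j) * (incl K E x ^ j)⁻¹ := by
        rw [map_mul, map_zpow, mul_inv_cancel_right]
      rw [h2]
      exact mul_mem (incl_mem_D hj) (inv_mem (zpow_mem (le_clos _ k.incl_mem_pows) j)))
    (Finset.disjoint_singleton_right.2 ht₀)
    (by
      rw [Finset.iInf_singleton, Finset.card_singleton, pow_one]
      exact Pl.relIndex_D_of_le k.prim (hS.vord_eq ht₀) (SU_le_punit ht₀) fun h => hx₀ (h hx))
  refine ⟨T, hST, hT, hinj, Finset.card_eq_one.2 ⟨t₀, ?_⟩⟩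
  ext t
  rw [Finset.mem_filter, Finset.mem_singleton]
  refine ⟨fun h => ?_, fun h => ?_⟩
  · by_contra h'
    exact h.2.not_mem_D (hQ t h.1 (by rwa [Finset.mem_singleton]))
  · rw [h]
    exact ⟨hT₀ (Finset.mem_singleton_self _), hu⟩

/-- A local-global principle for norms, together with the local indices. -/
theorem mem_norms (hp2 : p ≠ 2) {S : Finset (Pl K)} (hS : Good p S) (hx : x ∈ SU S) :
    (∀ v ∈ S, k.Uniq v → (k.N v).index = p) ∧
      ∀ b ∈ SU S, (∀ v ∈ S, k.Uniq v → b ∈ k.N v) → b ∈ norms K E := by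
  classical
  obtain ⟨T, hST, hT, hinj, hTu⟩ := k.exists_norm_spanning hp2 hS hx
  have h1 := sup_iInf_D_eq_top hp2 k.prim hS hST hT hinj
  have hST' : Good p (S ∪ T) := hS.mono Finset.subset_union_left
  have hxT : x ∈ SU (S ∪ T) := SU_mono Finset.subset_union_left hx
  have h2 := k.relIndex_norm_SU hp2 hST'.clOne hST'.mem hxT
  set NU := (SU (k.placesOver (S ∪ T))).map (Units.map (Algebra.norm K : E →* K)) with hNU
  have h3 : ((S ∪ T).filter k.Uniq).card = (S.filter k.Uniq).card + 1 := by
    rw [Finset.filter_union, Finset.card_union_of_disjoint, hTu]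
    exact Finset.disjoint_filter_filter hST
  rw [h3, pow_succ] at h2
  have h4 : NU.relIndex (SU (S ∪ T)) = p ^ (S.filter k.Uniq).card :=
    Nat.eq_of_mul_eq_mul_right hp.out.pos h2
  have h5 : NU ≤ norms K E := by rintro _ ⟨y, _, rfl⟩; exact ⟨y, rfl⟩
  have h6 : NU ≤ k.M S := h5.trans (k.norms_le_M S)
  have h7 : SU (S ∪ T) ⊔ k.M S = ⊤ :=
    top_le_iff.1 (h1 ▸ sup_le_sup_left (k.iInf_D_le_M fun v hv _ => hv) _)
  have h8 := Subgroup.relIndex_eq_index_of_sup_eq_top h7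
  have h9 : (k.M S).index = p ^ (S.filter k.Uniq).card := by
    refine le_antisymm ?_ (k.pow_le_index_M S)
    rw [← h8, ← h4]
    exact Subgroup.relIndex_le_of_le_left h6 (by rw [h4]; exact pow_ne_zero _ hp.out.ne_zero)
  have hle : ∀ v ∈ S.filter k.Uniq, p ≤ (k.N v).index := fun v hv =>
    Nat.le_of_dvd (Nat.pos_of_ne_zero (k.index_N_ne_zero v)) (Finset.mem_filter.1 hv).2.dvd_index
  refine ⟨fun v hv hu => ?_, fun b hb hbN => ?_⟩
  · by_contra hne
    have hv' : v ∈ S.filter k.Uniq := Finset.mem_filter.2 ⟨hv, hu⟩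
    have := Finset.prod_lt_prod (f := fun _ => p) (g := fun v => (k.N v).index)
      (fun _ _ => hp.out.pos) hle ⟨v, hv', lt_of_le_of_ne (hle v hv') (Ne.symm hne)⟩
    rw [Finset.prod_const, ← k.index_M, h9] at this
    exact lt_irrefl _ this
  · refine h5 (Subgroup.inf_le_of_relIndex_eq h6 (U := SU (S ∪ T)) ?_ ?_ ⟨?_, ?_⟩)
    · rw [h8]; exact k.index_M_ne_zero S
    · rw [h4, h8, h9]
    · change b ∈ k.M S
      simp only [M, Subgroup.mem_iInf]
      intro v hv
      exact hbN v (Finset.mem_filter.1 hv).1 (Finset.mem_filter.1 hv).2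
    · exact SU_mono Finset.subset_union_left hb

end Kum

end

end

section

open WithZero NumberField

theorem exists_ringHom_of_isSplittingField {K L L' : Type*} [Field K] [Field L] [Field L']
    [Algebra K L] {p : ℕ} {x ζ : K} (hζ : IsPrimitiveRoot ζ p)
    (h : Polynomial.IsSplittingField K L (Polynomial.X ^ p - Polynomial.C x)) (j : K →+* L')
    {γ : L'} (hγ : γ ^ p = j x) : ∃ τ : L →+* L', ∀ c, τ (algebraMap K L c) = j c := by
  let _ := j.toAlgebra
  have h1 : ((Polynomial.X ^ p - Polynomial.C x : Polynomial K).map (algebraMap K L')).Splits := by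
    rw [Polynomial.map_sub, Polynomial.map_pow, Polynomial.map_C, Polynomial.map_X]
    exact X_pow_sub_C_splits_of_isPrimitiveRoot
      (hζ.map_of_injective (algebraMap K L').injective) hγ
  let τ := Polynomial.IsSplittingField.lift L (Polynomial.X ^ p - Polynomial.C x) h1
  exact ⟨τ, τ.commutes⟩

theorem Subgroup.prod_iterate_mem_of_index_eq {G : Type*} [CommGroup G] {p : ℕ}
    [hp : Fact p.Prime] {H : Subgroup G} (hH : H.index = p) (σ : G →* G)
    (hσ : ∀ h ∈ H, σ h ∈ H) (hσp : ∀ g, σ^[p] g = g) (y : G) :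
    ∏ i ∈ Finset.range p, σ^[i] y ∈ H := by
  let τ : G ⧸ H →* G ⧸ H := QuotientGroup.map H H σ hσ
  have hτ : ∀ g : G, τ g = (σ g : G) := fun g => rfl
  have hcard : Nat.card (G ⧸ H) = p := hH
  have : IsCyclic (G ⧸ H) := isCyclic_of_prime_card hcard
  have hpow : ∀ q : G ⧸ H, q ^ p = 1 := fun q => hcard ▸ pow_card_eq_one'
  obtain ⟨m, hm⟩ := MonoidHom.map_cyclic τ
  have hit : ∀ (i : ℕ) (g : G), ((σ^[i] g : G) : G ⧸ H) = (g : G ⧸ H) ^ (m ^ i) := by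
    intro i g
    induction i with
    | zero => simp
    | succ i ih =>
      rw [Function.iterate_succ_apply', ← hτ, hm, ih, ← zpow_mul, ← pow_succ]
  have hfix : ∀ g : G, (g : G ⧸ H) ^ m = g := by
    intro g
    have h1 := hit p g
    rw [hσp] at h1
    have h2 : (p : ℤ) ∣ m ^ p - m := by
      rw [← ZMod.intCast_zmod_eq_zero_iff_dvd]
      push_cast
      rw [ZMod.pow_card, sub_self]
    obtain ⟨j, hj⟩ := h2
    have h3 : (g : G ⧸ H) ^ (m ^ p - m) = 1 := by
      rw [hj, zpow_mul, zpow_natCast, hpow, one_zpow]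
    rw [zpow_sub, ← h1, mul_inv_eq_one] at h3
    exact h3.symm
  have hit' : ∀ (i : ℕ) (g : G), ((σ^[i] g : G) : G ⧸ H) = g := by
    intro i g
    induction i with
    | zero => rfl
    | succ i ih => rw [Function.iterate_succ_apply', ← hτ, hm, ih, hfix]
  rw [← QuotientGroup.eq_one_iff, ← QuotientGroup.mk'_apply, map_prod]
  simp only [QuotientGroup.mk'_apply, hit']
  rw [Finset.prod_const, Finset.card_range, hpow]

namespace Kum

variable {p : ℕ} [hp : Fact p.Prime] {F K : Type} [Field F] [NumberField F] [Field K]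
  [NumberField K] [Algebra F K]

theorem map_mem_norms {L : Type} [Field L] [NumberField L] [Algebra K L] {ζ : K} {x : Kˣ}
    (k : Kum p L ζ x) (σ : K ≃+* K) {t : K} (ht : σ x = t ^ p * x) {u : Kˣ}
    (hu : u ∈ norms K L) : Units.map (σ : K →* K) u ∈ norms K L := by
  obtain ⟨e, rfl⟩ := hu
  obtain ⟨τ, hτ⟩ : ∃ τ : L →+* L, ∀ c : K, τ (algebraMap K L c) = algebraMap K L (σ c) := by
    refine exists_ringHom_of_isSplittingField k.prim k.isSplittingField
      ((algebraMap K L).comp (σ : K →+* K)) (γ := algebraMap K L t * k.γ) ?_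
    rw [mul_pow, k.pow_γ, ← map_pow, ← map_mul, ← ht]
    rfl
  have hbij : Function.Bijective τ := by
    have h1 : Function.Injective τ := τ.injective
    exact ⟨h1, (LinearMap.injective_iff_surjective
      (f := (RingHom.toRatAlgHom τ).toLinearMap)).1 h1⟩
  let τe : L ≃+* L := RingEquiv.ofBijective τ hbij
  refine ⟨Units.map (τ : L →* L) e, Units.ext ?_⟩
  have h2 := Algebra.norm_eq_of_equiv_equiv σ τe (RingHom.ext fun c => (hτ c).symm) (e : L)
  change Algebra.norm K (τe e) = σ (Algebra.norm K (e : L))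
  rw [h2, RingEquiv.apply_symm_apply]

variable {ζ : F} {a : Fˣ} (k : Kum p K ζ a)

/-- The automorphism of the Kummer extension, acting on units. -/
noncomputable def sU : Kˣ →* Kˣ := Units.map (k.s : K →* K)

theorem coe_sU (u : Kˣ) : (k.sU u : K) = k.s u := rfl

theorem coe_sU_iterate (i : ℕ) (u : Kˣ) : (k.sU^[i] u : K) = (k.s ^ i) u := by
  induction i with
  | zero => rfl
  | succ i ih => rw [Function.iterate_succ_apply', coe_sU, ih, pow_succ']; rfl

theorem sU_iterate_prime (u : Kˣ) : k.sU^[p] u = u :=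
  Units.ext (by rw [coe_sU_iterate, k.s_pow]; rfl)

theorem incl_norm (y : Kˣ) : incl F K (Units.map (Algebra.norm F : K →* F) y) =
    ∏ i ∈ Finset.range p, k.sU^[i] y := by
  apply Units.ext
  rw [Units.coe_prod]
  simp only [coe_sU_iterate]
  exact k.norm_eq y

theorem mem_punit_conj {w : Pl K} {i n : ℕ} {u : Kˣ} :
    u ∈ punit (k.conj i w).val n ↔ k.sU^[i] u ∈ punit w.val n := by
  have h : (k.sU^[i] u : K) - 1 = (k.s ^ i) ((u : K) - 1) := by
    rw [coe_sU_iterate, map_sub, map_one]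
  rw [mem_punit, mem_punit, h, coe_sU_iterate, vord_conj]
  refine and_congr_right fun _ => ?_
  rcases eq_or_ne ((u : K) - 1) 0 with h0 | h0
  · rw [h0, map_zero]
    exact iff_of_true (zero_mem _) (zero_mem _)
  · rw [mem_filt_iff h0, mem_filt_iff ((map_ne_zero _).2 h0), vord_conj]

theorem sU_mem_clos {w : Pl K} (hw : k.Inv w) {H : Subgroup Kˣ} (hH : ∀ h ∈ H, k.sU h ∈ H)
    {u : Kˣ} (hu : u ∈ clos w.val H) : k.sU u ∈ clos w.val H := by
  rw [mem_clos] at hu ⊢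
  intro n
  obtain ⟨h, hh, h1⟩ := hu n
  refine ⟨k.sU h, hH h hh, ?_⟩
  rw [← map_inv, ← map_mul]
  rw [← k.conj_of_inv hw 1, mem_punit_conj] at h1
  exact h1

theorem incl_mem_punit_iff {w : Pl K} (h : ¬ k.Inv w) {n : ℕ} {u : Fˣ} :
    incl F K u ∈ punit w.val n ↔ u ∈ punit (w.below F).val n := by
  have h1 : (incl F K u : K) - 1 = algebraMap F K ((u : F) - 1) := by
    rw [coe_incl, map_sub, map_one]
  rw [mem_punit, mem_punit, h1, coe_incl, k.vord_algebraMap_of_not_inv h]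
  refine and_congr_right fun _ => ?_
  rcases eq_or_ne ((u : F) - 1) 0 with h0 | h0
  · rw [h0, map_zero]
    exact iff_of_true (zero_mem _) (zero_mem _)
  · rw [mem_filt_iff h0, mem_filt_iff ((map_ne_zero _).2 h0), k.vord_algebraMap_of_not_inv h]

theorem exists_base_approx_unit {w : Pl K} (h : ¬ k.Inv w) (y : Kˣ) (n : ℕ) :
    ∃ c : Fˣ, incl F K c * y⁻¹ ∈ punit w.val n := by
  obtain ⟨c, hc⟩ := k.exists_base_approx h y ((n + 1 : ℕ) + vord w.val (y : K))
  have hc0 : c ≠ 0 := by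
    have := (vord_eq_of_sub_mem y.ne_zero (filt_mono (by push_cast; omega) hc)).1
    rintro rfl
    exact this (map_zero _)
  exact ⟨Units.mk0 c hc0, punit_anti (Nat.le_succ n) (div_mem_punit (Nat.succ_ne_zero n) hc)⟩

/-- The radical as a unit. -/
noncomputable def γU : Kˣ := Units.mk0 k.γ k.γ_ne_zero

theorem γU_pow : k.γU ^ p = incl F K a := Units.ext k.pow_γ

theorem mem_D_of_not_uniq {v : Pl F} (h : ¬ k.Uniq v) : a ∈ Pl.D p v := by
  by_contra ha
  obtain ⟨w, rfl⟩ := Pl.exists_above F K v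
  have hw := k.not_inv_of_not_uniq h
  apply ha
  rw [mem_clos]
  intro n
  obtain ⟨c, hc⟩ := k.exists_base_approx_unit hw k.γU n
  refine ⟨c ^ p, pow_mem_pows p c, ?_⟩
  rw [← k.incl_mem_punit_iff hw, map_mul, map_inv, map_pow, ← k.γU_pow, ← inv_pow, ← mul_pow]
  exact pow_mem (by simpa [mul_comm] using inv_mem hc) p

theorem sU_iterate_γU {z : Fˣ} (hz : (z : F) = ζ) (i : ℕ) :
    k.sU^[i] k.γU = incl F K z ^ i * k.γU := by
  apply Units.ext
  induction i with
  | zero => simp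
  | succ i ih =>
    rw [Function.iterate_succ_apply', coe_sU, ih, Units.val_mul, Units.val_mul,
      Units.val_pow_eq_pow_val, Units.val_pow_eq_pow_val, coe_incl, hz, map_mul, map_pow,
      AlgEquiv.commutes]
    change _ * k.s k.γ = _ * k.γ
    rw [k.s_γ, pow_succ]
    ring

theorem sU_iterate_incl (u : Fˣ) (i : ℕ) : k.sU^[i] (incl F K u) = incl F K u :=
  Units.ext (by rw [coe_sU_iterate, coe_incl, AlgEquiv.commutes])

theorem exists_mul_inv_γU_mem_D {θ : Fˣ} (hθ : (θ : F) ^ p = ζ) {v : Pl F} (h : ¬ k.Uniq v) :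
    ∃ z : Fˣ, ∀ w : Pl K, w.below F = v → incl F K z * k.γU⁻¹ ∈ Pl.D p w := by
  obtain ⟨w₀, rfl⟩ := Pl.exists_above F K v
  have hw₀ := k.not_inv_of_not_uniq h
  choose n hn using fun w : Pl K => Pl.exists_punit_le_clos_pows p w
  obtain ⟨z, hz⟩ := k.exists_base_approx_unit hw₀ k.γU
    ((Finset.range p).sup fun i => n (k.conj i w₀))
  refine ⟨z, fun w hw => ?_⟩
  obtain ⟨i, hi, rfl⟩ := k.exists_conj_eq hw.symm
  have h1 : incl F K z * k.γU⁻¹ * (incl F K θ ^ i) ^ p ∈ Pl.D p (k.conj i w₀) := by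
    refine hn _ (punit_anti (Finset.le_sup (f := fun i => n (k.conj i w₀))
      (Finset.mem_range.2 hi)) ?_)
    rw [mem_punit_conj, iterate_map_mul, iterate_map_mul, iterate_map_inv, ← map_pow, ← map_pow,
      sU_iterate_incl, sU_iterate_incl, k.sU_iterate_γU (z := θ ^ p)
        (by rw [Units.val_pow_eq_pow_val, hθ])]
    convert hz using 1
    rw [map_pow, map_pow, map_pow, ← pow_mul, ← pow_mul, mul_inv, mul_comm i p, mul_assoc,
      inv_mul_cancel_comm]
  have h2 := mul_mem h1 (inv_mem (Pl.pow_mem_D (p := p) (k.conj i w₀) (incl F K θ ^ i)))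
  rwa [mul_inv_cancel_right] at h2

theorem vord_γU_eq_zero {w : Pl K} (h : vord (w.below F).val (a : F) = 0) :
    vord w.val (k.γU : K) = 0 := by
  obtain ⟨e, he, hf⟩ := w.exists_ramification (algebraMap F K)
  have h1 := congrArg (vord w.val) k.pow_γ
  rw [vord_pow, hf, h, mul_zero] at h1
  exact (mul_eq_zero.1 h1).resolve_left (by exact_mod_cast hp.out.ne_zero)

theorem incl_mem_SU {S : Finset (Pl F)} {u : Fˣ} (h : u ∈ SU S) :
    incl F K u ∈ SU (k.placesOver S) := by
  intro w hw
  rw [k.mem_over] at hw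
  obtain ⟨e, he, hf⟩ := w.exists_ramification (algebraMap F K)
  rw [coe_incl, hf, h _ hw, mul_zero]

theorem exists_good_placesOver : ∃ S : Finset (Pl F), Good p S ∧ Good p (k.placesOver S) := by
  classical
  obtain ⟨S, hS⟩ := exists_good p F
  obtain ⟨S', hS'⟩ := exists_good p K
  refine ⟨S ∪ S'.image (Pl.below F), hS.mono Finset.subset_union_left, hS'.mono fun w hw => ?_⟩
  rw [k.mem_over]
  exact Finset.mem_union_right _ (Finset.mem_image_of_mem _ hw)

theorem placesOver_mono {S S' : Finset (Pl F)} (h : S ⊆ S') :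
    k.placesOver S ⊆ k.placesOver S' := fun w hw => by
  rw [k.mem_over] at hw ⊢
  exact h hw

include k in
theorem exists_spanning_inert (hp2 : p ≠ 2) {S : Finset (Pl F)} (hS : Good p S) :
    ∃ T, Disjoint S T ∧ T.card = S.card + Fintype.card (InfinitePlace F) ∧
      (∀ t ∈ T, a ∉ Pl.D p t) ∧
      (∀ b ∈ SU S, (∀ v ∈ T, b ∈ Pl.D p v) → b ∈ pows p F) := by
  classical
  obtain ⟨T, -, hST, hT, hQ, hinj⟩ := exists_spanning k.prim hS (fun v => a ∉ Pl.D p v) ∅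
    (by
      intro T _ hST _ b hb hbT hbp
      suffices ∃ t ∉ S ∪ T, a ∉ Pl.D p t ∧ b ∉ Pl.D p t by
        obtain ⟨t, ht, h⟩ := this
        rw [Finset.mem_union, not_or] at ht
        exact ⟨t, ht.1, ht.2, h⟩
      by_cases hba : b ∈ Subgroup.zpowers a ⊔ pows p F
      · obtain ⟨_, ⟨i, rfl⟩, _, h, hc⟩ := Subgroup.mem_sup.1 hba
        obtain ⟨c, rfl⟩ := mem_pows.1 h
        obtain ⟨t, ht, hat⟩ := exists_not_mem_D hp2 k.prim k.not_pow (S ∪ T)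
        refine ⟨t, ht, hat, fun hbt => hat ?_⟩
        dsimp only at hc
        have hi : ¬ (p : ℤ) ∣ i := by
          rintro ⟨j, rfl⟩
          apply hbp
          rw [← hc, zpow_mul, zpow_natCast]
          exact mul_mem (zpow_mem (pow_mem_pows p a) j) (pow_mem_pows p c)
        refine Subgroup.mem_of_zpow_mem hp.out (t.pow_mem_D a) hi ?_
        rw [← eq_mul_inv_iff_mul_eq] at hc
        rw [hc]
        exact mul_mem hbt (inv_mem (t.pow_mem_D c))
      · exact exists_not_mem_D_both hp2 k.prim k.not_pow hba (S ∪ T))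
    (Finset.disjoint_empty_right S) (by simp)
  exact ⟨T, hST, hT, fun t ht => hQ t ht (Finset.notMem_empty t), hinj⟩

/-- Norms from a Kummer extension `K / F` become norms from a suitable cyclic extension
`L / K`. -/
theorem exists_incl_norm_mem_norms (hp2 : p ≠ 2) {θ : F} (hθ : θ ^ p = ζ) (y : Kˣ) :
    ∃ u : Fˣ, ∀ (L : Type) [Field L] [NumberField L] [Algebra K L],
      ∀ _ : Kum p L (algebraMap F K ζ) (incl F K u * k.γU),
        incl F K (Units.map (Algebra.norm F : K →* F) y) ∈ norms K L := by
  classical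
  have hθ0 : θ ≠ 0 := by
    rintro rfl
    rw [zero_pow hp.out.ne_zero] at hθ
    exact k.prim.ne_zero hp.out.ne_zero hθ.symm
  set b := Units.map (Algebra.norm F : K →* F) y with hb
  obtain ⟨S₀, hS₀, hS₀'⟩ := k.exists_good_placesOver
  obtain ⟨Sa, ha⟩ := exists_mem_SU a
  obtain ⟨Sb, hbS⟩ := exists_mem_SU b
  set S := S₀ ∪ Sa ∪ Sb with hSdef
  have hS : Good p S := hS₀.mono fun v hv => by simp [hSdef, hv]
  have haS : a ∈ SU S := SU_mono (fun v hv => by simp [hSdef, hv]) ha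
  have hbS : b ∈ SU S := SU_mono (fun v hv => by simp [hSdef, hv]) hbS
  obtain ⟨T, hST, hT, haT, hinj⟩ := k.exists_spanning_inert hp2 hS
  have h1 := sup_iInf_D_eq_top hp2 k.prim hS hST hT hinj
  have hz : ∀ v : Pl F, ∃ z : Fˣ, ¬ k.Uniq v →
      ∀ w : Pl K, w.below F = v → incl F K z * k.γU⁻¹ ∈ Pl.D p w := by
    intro v
    by_cases hv : k.Uniq v
    · exact ⟨1, fun h => absurd hv h⟩
    · obtain ⟨z, hz⟩ := k.exists_mul_inv_γU_mem_D (θ := Units.mk0 θ hθ0) hθ hv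
      exact ⟨z, fun _ => hz⟩
  choose z hz using hz
  obtain ⟨Z, hZ⟩ := Pl.exists_forall_mul_inv_mem S (fun v => Pl.D p v)
    (fun v _ => Pl.exists_punit_le_clos_pows p v) fun v => (z v)⁻¹
  obtain ⟨u, hu, d, hd, hud⟩ := Subgroup.mem_sup.1 (h1 ▸ Subgroup.mem_top Z)
  rw [mem_iInf_D] at hd
  have huz : ∀ v ∈ S, u * z v ∈ Pl.D p v := by
    intro v hv
    have h2 := mul_mem (hZ v hv) (inv_mem (hd v hv))
    rw [← hud, inv_inv] at h2
    convert h2 using 1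
    rw [mul_right_comm, mul_inv_cancel_right]
  refine ⟨u, fun L _ _ _ l => ?_⟩
  set x := incl F K u * k.γU with hx
  have hxD : ∀ w : Pl K, w.below F ∈ S → ¬ k.Uniq (w.below F) → x ∈ Pl.D p w := by
    intro w hw hwu
    have h2 := mul_mem (incl_mem_D (E := K) (huz _ hw)) (inv_mem (hz _ hwu w rfl))
    rw [map_mul, mul_inv, inv_inv, mul_assoc, mul_inv_cancel_left] at h2
    exact h2
  have hgood : Good p (k.placesOver (S ∪ T)) := hS₀'.mono <| k.placesOver_mono fun v hv => by
    simp [hSdef, hv]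
  have hxS : x ∈ SU (k.placesOver (S ∪ T)) := by
    refine mul_mem (k.incl_mem_SU hu) fun w hw => k.vord_γU_eq_zero ?_
    rw [k.mem_over] at hw
    exact SU_mono Finset.subset_union_left haS _ hw
  obtain ⟨h2, h3⟩ := l.mem_norms hp2 hgood hxS
  refine h3 _ (k.incl_mem_SU (SU_mono Finset.subset_union_left hbS)) fun w hw hwu => ?_
  have hku : k.Uniq (w.below F) := by
    by_contra hk
    rw [k.mem_over, Finset.mem_union] at hw
    rcases hw with hw | hw
    · exact hwu.not_mem_D (hxD w hw hk)
    · exact haT _ hw (k.mem_D_of_not_uniq hk)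
  have hInv : k.Inv w := hku.inv rfl
  rw [k.incl_norm]
  refine Subgroup.prod_iterate_mem_of_index_eq (h2 w hw hwu) k.sU (fun g hg => ?_)
    k.sU_iterate_prime y
  refine k.sU_mem_clos hInv (fun g hg => ?_) hg
  refine l.map_mem_norms k.s.toRingEquiv (t := algebraMap F K θ) ?_ hg
  change k.s (algebraMap F K u * k.γ) = _
  rw [map_mul, AlgEquiv.commutes, k.s_γ, ← map_pow, hθ, mul_left_comm]
  rfl

end Kum

end

section

/-- A function on `Ω ≃ₐ[F] Ω` is finitely determined if its value at `g` only depends on the values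
of `g` at finitely many elements of `Ω`. -/
def FinDet {F Ω X : Type*} [Field F] [Field Ω] [Algebra F Ω] (f : (Ω ≃ₐ[F] Ω) → X) : Prop :=
  ∃ S : Finset Ω, ∀ g h : Ω ≃ₐ[F] Ω, (∀ x ∈ S, g x = h x) → f g = f h

section FinDet

variable {F Ω X Y Z : Type*} [Field F] [Field Ω] [Algebra F Ω]

theorem FinDet.comp {f : (Ω ≃ₐ[F] Ω) → X} (hf : FinDet f) (u : X → Y) :
    FinDet fun g => u (f g) := by
  obtain ⟨S, hS⟩ := hf
  exact ⟨S, fun g h hgh => congrArg u (hS g h hgh)⟩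

theorem FinDet.comp₂ {f : (Ω ≃ₐ[F] Ω) → X} (hf : FinDet f) {f' : (Ω ≃ₐ[F] Ω) → Y} (hf' : FinDet f')
    (u : X → Y → Z) : FinDet fun g => u (f g) (f' g) := by
  classical
  obtain ⟨S, hS⟩ := hf
  obtain ⟨S', hS'⟩ := hf'
  refine ⟨S ∪ S', fun g h hgh => ?_⟩
  exact congrArg₂ u (hS g h fun x hx => hgh x (Finset.mem_union_left _ hx))
    (hS' g h fun x hx => hgh x (Finset.mem_union_right _ hx))

theorem FinDet.of_comp {f : (Ω ≃ₐ[F] Ω) → X} {u : X → Y} (hu : Function.Injective u)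
    (hf : FinDet fun g => u (f g)) : FinDet f := by
  obtain ⟨S, hS⟩ := hf
  exact ⟨S, fun g h hgh => hu (hS g h hgh)⟩

theorem finDet_apply (x : Ω) : FinDet fun g : Ω ≃ₐ[F] Ω => g x :=
  ⟨{x}, fun _ _ hgh => hgh x (Finset.mem_singleton_self x)⟩

/-- Linear independence of characters: a finitely determined multiplicative function on a group of
automorphisms with values fixed by that group is a coboundary. -/
theorem exists_eigenvector [Algebra.IsAlgebraic F Ω] (H : Subgroup (Ω ≃ₐ[F] Ω))
    (f : (Ω ≃ₐ[F] Ω) → Ω) (hf : FinDet f) (h0 : ∀ g ∈ H, f g ≠ 0)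
    (hmul : ∀ g ∈ H, ∀ h ∈ H, f (g * h) = f g * f h) (hfix : ∀ g ∈ H, ∀ h ∈ H, g (f h) = f h) :
    ∃ β : Ω, β ≠ 0 ∧ ∀ g ∈ H, g β = f g * β := by
  classical
  obtain ⟨S, hS⟩ := hf
  let E := IntermediateField.adjoin F (S : Set Ω)
  have : FiniteDimensional F E :=
    IntermediateField.finiteDimensional_adjoin fun x _ => Algebra.IsIntegral.isIntegral x
  let r : H → E →ₐ[F] Ω := fun h => (h : Ω ≃ₐ[F] Ω).toAlgHom.comp E.val
  let T : Set (E →ₐ[F] Ω) := Set.range r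
  have : Finite T := Set.toFinite T
  have : Fintype T := Fintype.ofFinite T
  have hr : ∀ g h : H, r g = r h → f g = f h := fun g h hgh =>
    hS g h fun x hx => DFunLike.congr_fun hgh ⟨x, IntermediateField.subset_adjoin F _ hx⟩
  choose q hq using fun t : T => t.2
  have hlin := (linearIndependent_toLinearMap F E Ω).comp (fun t : T => (t : E →ₐ[F] Ω))
    Subtype.val_injective
  rw [Fintype.linearIndependent_iff] at hlin
  have hne : ∃ z : E, ∑ t : T, (f (q t))⁻¹ * (t : E →ₐ[F] Ω) z ≠ 0 := by
    by_contra! hcon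
    have := hlin (fun t => (f (q t))⁻¹) (by
      ext z
      simpa using hcon z) ⟨r 1, 1, rfl⟩
    exact inv_ne_zero (h0 _ (q _).2) this
  obtain ⟨z, hz⟩ := hne
  refine ⟨_, hz, fun g hg => ?_⟩
  let e : T ≃ T := Equiv.ofBijective
    (fun t => ⟨r (⟨g, hg⟩ * q t), _, rfl⟩) (Finite.injective_iff_bijective.mp fun t t' htt => by
      have h1 : r (⟨g, hg⟩ * q t) = r (⟨g, hg⟩ * q t') := congrArg Subtype.val htt
      have h2 : r (q t) = r (q t') := by
        ext x
        exact g.injective (DFunLike.congr_fun h1 x)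
      rw [hq, hq] at h2
      exact Subtype.ext h2)
  rw [map_sum, Finset.mul_sum]
  refine Fintype.sum_equiv e _ _ fun t => ?_
  have h1 : f (q (e t)) = f g * f (q t) := by
    rw [← hmul g hg _ (q t).2]
    exact hr (q (e t)) (⟨g, hg⟩ * q t) (hq (e t))
  have h2 : ((e t : T) : E →ₐ[F] Ω) z = g ((t : E →ₐ[F] Ω) z) := by
    conv_rhs => rw [← hq t]
    rfl
  rw [h1, h2, map_mul, map_inv₀, hfix g hg _ (q t).2, mul_inv, ← mul_assoc, ← mul_assoc,
    mul_inv_cancel₀ (h0 g hg), one_mul]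

end FinDet

/-- The character of `ZMod n` attached to a primitive `n`-th root of unity. -/
def rootChar {n : ℕ} [NeZero n] {F : Type*} [Field F] {θ : F} (hθ : IsPrimitiveRoot θ n) :
    AddChar (ZMod n) F :=
  AddChar.zmodChar n hθ.pow_eq_one

section rootChar

variable {n : ℕ} [NeZero n] {F Ω : Type*} [Field F] [Field Ω] [Algebra F Ω] {θ : F}
  (hθ : IsPrimitiveRoot θ n)

theorem rootChar_natCast (a : ℕ) : rootChar hθ a = θ ^ a :=
  AddChar.zmodChar_apply' hθ.pow_eq_one a

theorem rootChar_injective : Function.Injective (rootChar hθ) := by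
  intro x y hxy
  rw [← ZMod.natCast_zmod_val x, ← ZMod.natCast_zmod_val y, rootChar_natCast,
    rootChar_natCast] at hxy
  exact ZMod.val_injective n (hθ.pow_inj (ZMod.val_lt x) (ZMod.val_lt y) hxy)

theorem rootChar_ne_zero (z : ZMod n) : rootChar hθ z ≠ 0 := by
  rw [← ZMod.natCast_zmod_val z, rootChar_natCast]
  exact pow_ne_zero _ (hθ.ne_zero (NeZero.ne n))

theorem rootChar_pow_eq_one (z : ZMod n) : rootChar hθ z ^ n = 1 := by
  rw [← AddChar.map_nsmul_eq_pow, nsmul_eq_mul, ZMod.natCast_self, zero_mul,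
    AddChar.map_zero_eq_one]

theorem exists_rootChar_eq {y : Ω} (hy : y ^ n = 1) :
    ∃ z, algebraMap F Ω (rootChar hθ z) = y := by
  obtain ⟨i, _, hi⟩ := (hθ.map_of_injective (algebraMap F Ω).injective).eq_pow_of_pow_eq_one hy
  exact ⟨i, by rw [rootChar_natCast, map_pow, hi]⟩

/-- The Kummer character of an `n`-th root of an element of the base field. -/
theorem exists_kummerChar {x : Ω} (hx : x ≠ 0) (hfix : ∀ g : Ω ≃ₐ[F] Ω, g (x ^ n) = x ^ n) :
    ∃ χ : (Ω ≃ₐ[F] Ω) → ZMod n, (∀ g h, χ (g * h) = χ g + χ h) ∧ FinDet χ ∧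
      ∀ g, g x = algebraMap F Ω (rootChar hθ (χ g)) * x := by
  have h1 : ∀ g : Ω ≃ₐ[F] Ω, ∃ z, algebraMap F Ω (rootChar hθ z) = g x / x := fun g =>
    exists_rootChar_eq hθ (by rw [div_pow, ← map_pow, hfix, div_self (pow_ne_zero _ hx)])
  choose χ hχ using h1
  have h2 : ∀ g, g x = algebraMap F Ω (rootChar hθ (χ g)) * x := fun g => by
    rw [hχ, div_mul_cancel₀ _ hx]
  have hinj : Function.Injective fun z => algebraMap F Ω (rootChar hθ z) :=
    (algebraMap F Ω).injective.comp (rootChar_injective hθ)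
  refine ⟨χ, fun g h => hinj ?_, FinDet.of_comp hinj ?_, h2⟩
  · apply mul_right_cancel₀ hx
    simp only
    rw [← h2, AlgEquiv.mul_apply, h2 h, map_mul, AlgEquiv.commutes, h2 g,
      AddChar.map_add_eq_mul, map_mul]
    ring
  · simp only [hχ]
    exact (finDet_apply x).comp fun y => y / x

end rootChar

theorem rootChar_pow {p : ℕ} [NeZero p] {F : Type*} [Field F] {θ : F}
    (hθ : IsPrimitiveRoot θ (p ^ 2)) (hζ : IsPrimitiveRoot (θ ^ p) p) (z : ZMod (p ^ 2)) :
    rootChar hθ z ^ p =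
      rootChar hζ (ZMod.castHom (dvd_pow_self p two_ne_zero) (ZMod p) z) := by
  obtain ⟨a, rfl⟩ : ∃ a : ℕ, (a : ZMod (p ^ 2)) = z := ⟨z.val, ZMod.natCast_zmod_val z⟩
  rw [map_natCast (ZMod.castHom _ (ZMod p)), rootChar_natCast, rootChar_natCast, ← pow_mul,
    ← pow_mul, mul_comm]

/-- Characters to `ZMod p` lift to `ZMod (p ^ 2)`, with radicals. -/
theorem exists_lift_character {p : ℕ} [NeZero p] {F Ω : Type*} [Field F] [Field Ω] [Algebra F Ω]
    [Algebra.IsAlgebraic F Ω] {θ : F} (hθ : IsPrimitiveRoot θ (p ^ 2))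
    (hζ : IsPrimitiveRoot (θ ^ p) p) (hroot : ∀ x : Ω, ∃ y, y ^ p = x)
    (χ : (Ω ≃ₐ[F] Ω) → ZMod p) (hχ : ∀ g h, χ (g * h) = χ g + χ h) (hfin : FinDet χ) :
    ∃ χ' : (Ω ≃ₐ[F] Ω) → ZMod (p ^ 2), (∀ g h, χ' (g * h) = χ' g + χ' h) ∧ FinDet χ' ∧
      ∀ g, ZMod.castHom (dvd_pow_self p two_ne_zero) (ZMod p) (χ' g) = χ g := by
  obtain ⟨β, hβ, h1⟩ := exists_eigenvector ⊤ (fun g => algebraMap F Ω (rootChar hζ (χ g)))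
    (hfin.comp fun z => algebraMap F Ω (rootChar hζ z)) (fun g _ => by simpa using rootChar_ne_zero hζ _)
    (fun g _ h _ => by rw [hχ, AddChar.map_add_eq_mul, map_mul]) (fun g _ h _ => by simp)
  obtain ⟨γ, rfl⟩ := hroot β
  have hγ : γ ≠ 0 := by
    rintro rfl
    exact hβ (zero_pow (NeZero.ne p))
  obtain ⟨χ', h2, h3, h4⟩ := exists_kummerChar hθ hγ fun g => by
    rw [pow_two, pow_mul, map_pow, h1 g trivial, mul_pow, ← map_pow, rootChar_pow_eq_one,
      map_one, one_mul]
  refine ⟨χ', h2, h3, fun g => rootChar_injective hζ ((algebraMap F Ω).injective ?_)⟩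
  apply mul_right_cancel₀ hβ
  rw [← h1 g trivial, map_pow, h4, mul_pow, ← rootChar_pow hθ hζ, map_pow]

end

section

open Finset

/-- The explicit unitriangular cocycle attached to an element whose twisted norm is an `n`-th
power. -/
theorem exists_heisenberg_cochain {n : ℕ} [NeZero n] {F Ω : Type*} [Field F] [Field Ω]
    [Algebra F Ω] {θ : F} (hθ : IsPrimitiveRoot θ n) (hroot : ∀ x : Ω, ∃ y, y ^ n = x)
    (A B : (Ω ≃ₐ[F] Ω) → ZMod n) (hA : ∀ g h, A (g * h) = A g + A h)
    (hB : ∀ g h, B (g * h) = B g + B h) (hfin : FinDet A) {s : Ω ≃ₐ[F] Ω} (hs : A s = 1)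
    {f β : Ω} (hf : f ≠ 0) (hβ : β ≠ 0) (hAf : ∀ g, A g = 0 → g f = f)
    (hBβ : ∀ g, g β = algebraMap F Ω (rootChar hθ (B g)) * β)
    (hfβ : β ^ n = ∏ i ∈ range n, (s ^ i) f) :
    ∃ C : (Ω ≃ₐ[F] Ω) → ZMod n, FinDet C ∧ ∀ g h, C (g * h) = C g + C h - B g * A h := by
  have hA1 : A 1 = 0 := by simpa using hA 1 1
  have hB1 : B 1 = 0 := by simpa using hB 1 1
  have hAinv : ∀ g, A g⁻¹ = - A g := fun g => by
    rw [eq_neg_iff_add_eq_zero, ← hA, inv_mul_cancel, hA1]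
  have hAs : ∀ i : ℕ, A (s ^ i) = i := fun i => by
    induction i with
    | zero => simpa using hA1
    | succ i ih => rw [pow_succ, hA, ih, hs, Nat.cast_succ]
  have hAeq : ∀ g h, A g = A h → g f = h f := fun g h hgh => by
    have h1 := hAf (h⁻¹ * g) (by rw [hA, hAinv, hgh, neg_add_cancel])
    rw [AlgEquiv.mul_apply] at h1
    rw [← h.injective.eq_iff.mpr h1, ← AlgEquiv.mul_apply, mul_inv_cancel, AlgEquiv.one_apply]
  have h1 : ∀ (g) (j k : ℕ), A g = j → g ((s ^ k) f) = (s ^ (j + k)) f := fun g j k hg => by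
    rw [← AlgEquiv.mul_apply]
    exact hAeq _ _ (by rw [hA, hAs, hAs, hg, Nat.cast_add])
  have hne : ∀ (g : Ω ≃ₐ[F] Ω), g f ≠ 0 := fun g => (map_ne_zero g).mpr hf
  let ψ : ZMod n → Ω := fun z => algebraMap F Ω (rootChar hθ z)
  have hψ : ∀ x y, ψ (x + y) = ψ x * ψ y := fun x y => by
    simp only [ψ, AddChar.map_add_eq_mul, map_mul]
  have hψ0 : ψ 0 = 1 := by simp [ψ]
  have hψne : ∀ x, ψ x ≠ 0 := fun x =>
    (map_ne_zero (algebraMap F Ω)).mpr (rootChar_ne_zero hθ x)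
  have hψn : ∀ x, ψ x ^ n = 1 := fun x => by
    simp only [ψ]
    rw [← map_pow, rootChar_pow_eq_one, map_one]
  have hψg : ∀ (g : Ω ≃ₐ[F] Ω) x, g (ψ x) = ψ x := fun g x => g.commutes _
  have hψinj : Function.Injective ψ := (algebraMap F Ω).injective.comp (rootChar_injective hθ)
  have hψpow : ∀ (m : ℕ) x, ψ x ^ m = ψ (m * x) := fun m x => by
    simp only [ψ]
    rw [← map_pow, ← AddChar.map_nsmul_eq_pow, nsmul_eq_mul]
  obtain ⟨E, hE⟩ : ∃ E : ℕ → Ω, ∀ j, E j = (∏ k ∈ range j, (s ^ k) f) / β ^ j := ⟨_, fun _ => rfl⟩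
  have hE0 : E 0 = 1 := by simp [hE]
  have hEne : ∀ j, E j ≠ 0 := fun j => by
    rw [hE]
    exact div_ne_zero (prod_ne_zero_iff.mpr fun k _ => hne _) (pow_ne_zero _ hβ)
  have h2 : ∀ g (j m : ℕ), A g = j → ψ (m * B g) * (E j * g (E m)) = E (j + m) :=
    fun g j m hg => by
      have h3 : g (β ^ m) = ψ (m * B g) * β ^ m := by
        rw [map_pow, hBβ, mul_pow, ← hψpow]
      have h4 := hψne (m * B g)
      rw [hE, hE, hE, map_div₀, map_prod, prod_range_add, h3,
        prod_congr rfl fun k _ => h1 g j k hg]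
      field_simp
      ring
  have hEn : E n = 1 := by rw [hE, ← hfβ, div_self (pow_ne_zero _ hβ)]
  have hper : Function.Periodic E n := fun m => by
    have := h2 1 n m (by rw [hA1, ZMod.natCast_self])
    rw [hB1, mul_zero, hψ0, hEn, one_mul, one_mul, AlgEquiv.one_apply] at this
    rw [add_comm, ← this]
  have hEcongr : ∀ a b : ℕ, (a : ZMod n) = b → E a = E b := fun a b hab => by
    rw [← hper.map_mod_nat a, ← hper.map_mod_nat b, (ZMod.natCast_eq_natCast_iff' a b n).mp hab]
  obtain ⟨D, hD⟩ : ∃ D : Ω, D = ∏ i ∈ range n, (s ^ i) f ^ i := ⟨_, rfl⟩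
  have hsD : s D = D * E 1 ^ n := by
    have h3 : s (β ^ n) = β ^ n := by
      rw [map_pow, hBβ, mul_pow]
      exact (congrArg (· * β ^ n) (hψn _)).trans (one_mul _)
    have h4 : (s ^ n) f = f := hAf _ (by rw [hAs, ZMod.natCast_self])
    have h5 : s D * β ^ n = D * f ^ n := by
      conv_lhs => rw [← h3, hfβ]
      rw [hD, map_prod, map_prod, ← prod_mul_distrib]
      have h6 : ∀ i, s ((s ^ i) f ^ i) * s ((s ^ i) f) = (s ^ (i + 1)) f ^ (i + 1) := fun i => by
        rw [map_pow, ← pow_succ, pow_succ' s i, AlgEquiv.mul_apply]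
      rw [prod_congr rfl fun i _ => h6 i]
      have h7 := prod_range_succ' (fun i => (s ^ i) f ^ i) n
      rw [pow_zero, mul_one] at h7
      rw [← h7, prod_range_succ, h4]
    rw [hE, prod_range_one, pow_zero, AlgEquiv.one_apply, pow_one, div_pow, ← mul_div_assoc, ← h5,
      mul_div_cancel_right₀ _ (pow_ne_zero _ hβ)]
  have h3 : ∀ (j : ℕ) (g), A g = j → g D = D * E j ^ n := by
    intro j
    induction j with
    | zero =>
      intro g hg
      rw [hE0, one_pow, mul_one, hD, map_prod]
      refine prod_congr rfl fun i _ => ?_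
      rw [map_pow, h1 g 0 i hg, zero_add]
    | succ j ih =>
      intro g hg
      have h4 := ih (s⁻¹ * g) (by rw [hA, hAinv, hg, hs]; push_cast; ring)
      have h5 : g D = s ((s⁻¹ * g) D) := by
        rw [← AlgEquiv.mul_apply, mul_inv_cancel_left]
      have h6 := h2 s 1 j (by rw [hs, Nat.cast_one])
      rw [h5, h4, map_mul, hsD, add_comm j 1, ← h6, mul_pow, hψn, one_mul, mul_pow, map_pow,
        mul_assoc]
  obtain ⟨d, hd⟩ := hroot D
  have hd0 : d ≠ 0 := by
    rintro rfl
    rw [zero_pow (NeZero.ne n), hD] at hd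
    exact prod_ne_zero_iff.mpr (fun k _ => pow_ne_zero _ (hne _)) hd.symm
  have hC : ∀ g, ∃ z, ψ z = g d / (d * E (A g).val) := fun g => by
    refine exists_rootChar_eq hθ ?_
    rw [div_pow, mul_pow, ← map_pow, hd, h3 _ g (ZMod.natCast_zmod_val _).symm]
    refine div_self (mul_ne_zero ?_ (pow_ne_zero _ (hEne _)))
    rw [← hd]
    exact pow_ne_zero _ hd0
  choose C hC using hC
  have hC' : ∀ g, g d = ψ (C g) * (d * E (A g).val) := fun g => by
    rw [hC, div_mul_cancel₀ _ (mul_ne_zero hd0 (hEne _))]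
  refine ⟨C, FinDet.of_comp hψinj ?_, fun g h => hψinj ?_⟩
  · simp only [hC]
    exact (finDet_apply d).comp₂ hfin fun x z => x / (d * E z.val)
  · have h4 := hC' (g * h)
    rw [AlgEquiv.mul_apply, hC' h, map_mul, map_mul, hC' g, hψg] at h4
    have h5 := h2 g (A g).val (A h).val (ZMod.natCast_zmod_val _).symm
    rw [ZMod.natCast_zmod_val] at h5
    have h6 : E ((A g).val + (A h).val) = E (A (g * h)).val := hEcongr _ _ (by
      rw [Nat.cast_add, ZMod.natCast_zmod_val, ZMod.natCast_zmod_val, ZMod.natCast_zmod_val, hA])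
    rw [← h6, ← h5] at h4
    have h7 : ψ (C g) * ψ (C h) = ψ (C (g * h)) * ψ (A h * B g) := by
      apply mul_right_cancel₀ (mul_ne_zero hd0
        (mul_ne_zero (hEne (A g).val) ((map_ne_zero g).mpr (hEne (A h).val))))
      linear_combination h4
    apply mul_right_cancel₀ (hψne (A h * B g))
    rw [← h7, ← hψ, ← hψ]
    congr 1
    ring

end

section

open Finset

section character

variable {F Ω : Type*} [Field F] [Field Ω] [Algebra F Ω] {n : ℕ}

theorem character_one {A : (Ω ≃ₐ[F] Ω) → ZMod n} (hA : ∀ g h, A (g * h) = A g + A h) : A 1 = 0 := by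
  simpa using hA 1 1

theorem character_inv {A : (Ω ≃ₐ[F] Ω) → ZMod n} (hA : ∀ g h, A (g * h) = A g + A h)
    (g : Ω ≃ₐ[F] Ω) : A g⁻¹ = - A g := by
  rw [eq_neg_iff_add_eq_zero, ← hA, inv_mul_cancel, character_one hA]

theorem character_pow {A : (Ω ≃ₐ[F] Ω) → ZMod n} (hA : ∀ g h, A (g * h) = A g + A h)
    (g : Ω ≃ₐ[F] Ω) (i : ℕ) : A (g ^ i) = i * A g := by
  induction i with
  | zero => simpa using character_one hA
  | succ i ih =>
    rw [pow_succ, hA, ih]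
    push_cast
    ring

/-- The kernel of a character. -/
def characterKer {A : (Ω ≃ₐ[F] Ω) → ZMod n} (hA : ∀ g h, A (g * h) = A g + A h) :
    Subgroup (Ω ≃ₐ[F] Ω) where
  carrier := {g | A g = 0}
  mul_mem' {g h} hg hh := by
    change A (g * h) = 0
    rw [hA, hg, hh, add_zero]
  one_mem' := character_one hA
  inv_mem' {g} hg := by
    change A g⁻¹ = 0
    rw [character_inv hA, hg, neg_zero]

end character

/-- A unitriangular homomorphism modulo `p` expresses `β ^ p` as a norm. -/
theorem exists_twisted_norm_eq {p : ℕ} [NeZero p] {F Ω : Type*} [Field F] [Field Ω] [Algebra F Ω]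
    [Algebra.IsAlgebraic F Ω] {θ : F} (hζ : IsPrimitiveRoot (θ ^ p) p)
    (A B c : (Ω ≃ₐ[F] Ω) → ZMod p) (hA : ∀ g h, A (g * h) = A g + A h)
    (hB : ∀ g h, B (g * h) = B g + B h) (hc : ∀ g h, c (g * h) = c g + c h + A g * B h)
    (hcfin : FinDet c) {β : Ω} (hβ : β ≠ 0)
    (hBβ : ∀ g, g β = algebraMap F Ω (rootChar hζ (B g)) * β)
    {s : Ω ≃ₐ[F] Ω} (hs : A s = 1) :
    ∃ y : Ω, y ≠ 0 ∧ (∀ h, A h = 0 → h y = y) ∧ ∏ i ∈ range p, (s ^ i) y = β ^ p := by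
  let ψ : ZMod p → Ω := fun z => algebraMap F Ω (rootChar hζ z)
  have hψ : ∀ x y, ψ (x + y) = ψ x * ψ y := fun x y => by
    simp only [ψ, AddChar.map_add_eq_mul, map_mul]
  have hψne : ∀ x, ψ x ≠ 0 := fun x =>
    (map_ne_zero (algebraMap F Ω)).mpr (rootChar_ne_zero hζ x)
  have hψg : ∀ (g : Ω ≃ₐ[F] Ω) x, g (ψ x) = ψ x := fun g x => g.commutes _
  obtain ⟨δ, hδ, h1⟩ := exists_eigenvector (characterKer hA) (fun g => ψ (c g)) (hcfin.comp ψ)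
    (fun g _ => hψne _) (fun g hg h _ => by
      rw [hc, show A g = 0 from hg, zero_mul, add_zero, hψ]) (fun g _ h _ => hψg _ _)
  replace h1 : ∀ g, A g = 0 → g δ = ψ (c g) * δ := h1
  have hsδ : s δ ≠ 0 := (map_ne_zero s).mpr hδ
  have hk : ∀ h, A h = 0 → h (s δ * β / δ) = s δ * β / δ := fun h hh => by
    have h2 : A (s⁻¹ * h * s) = 0 := by
      rw [hA, hA, character_inv hA, hh]
      ring
    have h3 : h (s δ) = ψ (c (s⁻¹ * h * s)) * s δ := by
      rw [← hψg s, ← map_mul, ← h1 _ h2, ← AlgEquiv.mul_apply, ← AlgEquiv.mul_apply]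
      congr 1
      group
    have h4 : c (s⁻¹ * h * s) + B h = c h := by
      have h5 : h * s = s * (s⁻¹ * h * s) := by group
      have h6 := hc h s
      rw [h5, hc, hs, hh, zero_mul, add_zero, one_mul, hB, hB, character_inv hB] at h6
      linear_combination h6
    rw [map_div₀, map_mul, h3, h1 h hh, show h β = ψ (B h) * β from hBβ h, ← h4, hψ]
    have := hψne (c (s⁻¹ * h * s))
    have := hψne (B h)
    field_simp
  have h2 : ∀ m : ℕ, ∃ x : ZMod p, ∏ i ∈ range m, (s ^ i) (s δ * β / δ) =
      ψ x * ((s ^ m) δ / δ * β ^ m) := fun m => by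
    induction m with
    | zero => exact ⟨0, by simp [ψ, hδ]⟩
    | succ m ih =>
      obtain ⟨x, hx⟩ := ih
      refine ⟨x + B (s ^ m), ?_⟩
      have h3 : (s ^ m) δ ≠ 0 := (map_ne_zero (s ^ m)).mpr hδ
      rw [prod_range_succ, hx, hψ, map_div₀, map_mul, pow_succ s m, AlgEquiv.mul_apply,
        show (s ^ m) β = ψ (B (s ^ m)) * β from hBβ _]
      field_simp
      ring
  obtain ⟨x, hx⟩ := h2 p
  rw [h1 (s ^ p) (by rw [character_pow hA, ZMod.natCast_self, zero_mul]),
    mul_div_cancel_right₀ _ hδ, ← mul_assoc, ← hψ] at hx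
  obtain ⟨j, hj⟩ : ∃ j : ZMod p, j = x + c (s ^ p) := ⟨_, rfl⟩
  rw [← hj] at hx
  have h3 : algebraMap F Ω (θ ^ j.val) ^ p = ψ j := by
    rw [← map_pow, ← pow_mul, mul_comm, pow_mul, ← rootChar_natCast hζ, ZMod.natCast_zmod_val]
  have h4 : algebraMap F Ω (θ ^ j.val) ≠ 0 := fun h => hψne j (by
    rw [← h3, h, zero_pow (NeZero.ne p)])
  refine ⟨s δ * β / δ / algebraMap F Ω (θ ^ j.val),
    div_ne_zero (div_ne_zero (mul_ne_zero hsδ hβ) hδ) h4, fun h hh => ?_, ?_⟩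
  · rw [map_div₀, hk h hh, AlgEquiv.commutes]
  · simp only [map_div₀ _ _ (algebraMap F Ω (θ ^ j.val)), AlgEquiv.commutes]
    rw [prod_div_distrib, hx, prod_const, card_range, h3, mul_div_cancel_left₀ _ (hψne j)]

/-- Correcting an element with norm `β ^ p` by Hilbert 90. -/
theorem exists_prod_eq_of_hilbert90 {p : ℕ} [NeZero p] {F Ω : Type*} [Field F] [Field Ω]
    [Algebra F Ω] (A : (Ω ≃ₐ[F] Ω) → ZMod (p ^ 2)) (hA : ∀ g h, A (g * h) = A g + A h)
    {s : Ω ≃ₐ[F] Ω} (hs : A s = 1) {b e : Ω} (hb : s b = b) (he : e ≠ 0)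
    (hAe : ∀ g, A g = 0 → g e = e) (hbe : ∏ i ∈ range p, ((s ^ p) ^ i) e = b)
    (h90 : ∀ w : Ω, (∀ g, A g = 0 → g w = w) → ∏ i ∈ range p, ((s ^ p) ^ i) w = 1 →
      ∃ z : Ω, z ≠ 0 ∧ (∀ g, A g = 0 → g z = z) ∧ w * (s ^ p) z = z) :
    ∃ f v : Ω, f ≠ 0 ∧ v ≠ 0 ∧ (∀ g, A g = 0 → g f = f) ∧ (∀ g : Ω ≃ₐ[F] Ω, g v = v) ∧
      b = v ^ p * ∏ i ∈ range (p ^ 2), (s ^ i) f := by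
  have hconj : ∀ w : Ω, (∀ g, A g = 0 → g w = w) → ∀ (k : Ω ≃ₐ[F] Ω) (g), A g = 0 →
      g (k w) = k w := fun w hw k g hg => by
    have h1 := hw (k⁻¹ * g * k) (by
      rw [hA, hA, character_inv hA, hg]
      ring)
    conv_rhs => rw [← h1]
    rw [← AlgEquiv.mul_apply, ← AlgEquiv.mul_apply]
    congr 1
    group
  have hse : s e ≠ 0 := (map_ne_zero s).mpr he
  have hb0 : b ≠ 0 := by
    rw [← hbe]
    exact prod_ne_zero_iff.mpr fun i _ => (map_ne_zero _).mpr he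
  obtain ⟨f, hf, hAf, hf'⟩ := h90 (e / s e)
    (fun g hg => by rw [map_div₀, hAe g hg, hconj e hAe s g hg]) (by
      simp only [map_div₀]
      rw [prod_div_distrib, hbe]
      have h1 : ∏ i ∈ range p, ((s ^ p) ^ i) (s e) = s b := by
        rw [← hbe, map_prod]
        refine prod_congr rfl fun i _ => ?_
        rw [← AlgEquiv.mul_apply, ← AlgEquiv.mul_apply, ← pow_mul, ← pow_succ, ← pow_succ']
      rw [h1, hb, div_self hb0])
  have hne : ∀ g : Ω ≃ₐ[F] Ω, g f ≠ 0 := fun g => (map_ne_zero g).mpr hf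
  obtain ⟨P, hP⟩ : ∃ P : Ω, P = ∏ i ∈ range p, (s ^ i) f := ⟨_, rfl⟩
  have hP0 : P ≠ 0 := by
    rw [hP]
    exact prod_ne_zero_iff.mpr fun i _ => hne _
  have hsP : s P * f = P * (s ^ p) f := by
    rw [hP, map_prod, ← prod_range_succ, prod_range_succ']
    simp only [pow_zero, AlgEquiv.one_apply, pow_succ', AlgEquiv.mul_apply]
  have hsv : s (e / P) = e / P := by
    have h1 : e * (s ^ p) f = f * s e := by
      rw [div_mul_eq_mul_div, div_eq_iff hse] at hf'
      exact hf'
    have h2 := hne (s ^ p)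
    have h3 : s P ≠ 0 := (map_ne_zero s).mpr hP0
    rw [map_div₀, div_eq_div_iff h3 hP0]
    apply mul_right_cancel₀ hf
    linear_combination P * (-h1) - e * hsP
  have hspow : ∀ i : ℕ, (s ^ i) (e / P) = e / P := fun i => by
    induction i with
    | zero => simp
    | succ i ih => rw [pow_succ, AlgEquiv.mul_apply, hsv, ih]
  have hAv : ∀ g, A g = 0 → g (e / P) = e / P := fun g hg => by
    rw [map_div₀, hAe g hg, hP, map_prod]
    congr 1
    exact prod_congr rfl fun i _ => hconj f hAf _ g hg
  refine ⟨f, e / P, hf, div_ne_zero he hP0, hAf, fun g => ?_, ?_⟩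
  · have h1 := hAv ((s ^ (A g).val)⁻¹ * g) (by
      rw [hA, character_inv hA, character_pow hA, hs, ZMod.natCast_zmod_val]
      ring)
    have h2 : g = s ^ (A g).val * ((s ^ (A g).val)⁻¹ * g) := by group
    conv_lhs => rw [h2]
    rw [AlgEquiv.mul_apply, h1, hspow]
  · have h1 : ∀ m : ℕ, ∏ i ∈ range (p * m), (s ^ i) f = ∏ i ∈ range m, ((s ^ p) ^ i) P := by
      intro m
      induction m with
      | zero => simp
      | succ m ih =>
        rw [mul_add, mul_one, prod_range_add, ih, prod_range_succ]
        congr 1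
        rw [hP, map_prod]
        refine prod_congr rfl fun i _ => ?_
        rw [← AlgEquiv.mul_apply, ← pow_mul, ← pow_add]
    rw [pow_two p, h1, ← hbe]
    have h2 : (e / P) ^ p = ∏ i ∈ range p, ((s ^ p) ^ i) (e / P) := by
      simp only [← pow_mul, hspow, prod_const, card_range]
    rw [h2, ← prod_mul_distrib]
    refine prod_congr rfl fun i _ => ?_
    rw [← map_mul, div_mul_cancel₀ _ hP0]

end

section

open IntermediateField

namespace Kum

variable {p : ℕ} [hp : Fact p.Prime]

theorem algebraMap_s_pow {F K E Ω : Type*} [Field F] [Field K] [Field E] [Field Ω] [Algebra K E]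
    [Algebra K Ω] [Algebra E Ω] [IsScalarTower K E Ω] [Algebra F Ω] {ζ : K} {x : Kˣ}
    (k : Kum p E ζ x) {g : Ω ≃ₐ[F] Ω} (hK : ∀ c : K, g (algebraMap K Ω c) = algebraMap K Ω c)
    (hγ : g (algebraMap E Ω k.γ) = algebraMap K Ω ζ * algebraMap E Ω k.γ) (i : ℕ) (y : E) :
    (g ^ i) (algebraMap E Ω y) = algebraMap E Ω ((k.s ^ i) y) := by
  let φ : E →ₐ[K] Ω :=
    { (g : Ω →+* Ω).comp (algebraMap E Ω) with
      commutes' := fun c => by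
        change g (algebraMap E Ω (algebraMap K E c)) = _
        rw [← IsScalarTower.algebraMap_apply, hK] }
  have h1 : φ = (IsScalarTower.toAlgHom K E Ω).comp (k.s : E →ₐ[K] E) := by
    refine AlgHom.ext_of_adjoin_eq_top k.adjoin_eq_top fun z hz => ?_
    obtain rfl : z = k.γ := hz
    change g (algebraMap E Ω k.γ) = algebraMap E Ω (k.s k.γ)
    rw [hγ, k.s_γ, map_mul, ← IsScalarTower.algebraMap_apply]
  have h2 : ∀ y, g (algebraMap E Ω y) = algebraMap E Ω (k.s y) := fun y =>
    DFunLike.congr_fun h1 y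
  induction i generalizing y with
  | zero => simp
  | succ i ih => rw [pow_succ, pow_succ, AlgEquiv.mul_apply, AlgEquiv.mul_apply, h2, ih]

theorem algebraMap_norm {F K E Ω : Type*} [Field F] [Field K] [Field E] [Field Ω] [Algebra K E]
    [Algebra K Ω] [Algebra E Ω] [IsScalarTower K E Ω] [Algebra F Ω] {ζ : K} {x : Kˣ}
    (k : Kum p E ζ x) {g : Ω ≃ₐ[F] Ω} (hK : ∀ c : K, g (algebraMap K Ω c) = algebraMap K Ω c)
    (hγ : g (algebraMap E Ω k.γ) = algebraMap K Ω ζ * algebraMap E Ω k.γ) (y : E) :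
    algebraMap K Ω (Algebra.norm K y) = ∏ i ∈ Finset.range p, (g ^ i) (algebraMap E Ω y) := by
  rw [IsScalarTower.algebraMap_apply K E Ω, k.norm_eq, map_prod]
  exact Finset.prod_congr rfl fun i _ => (k.algebraMap_s_pow hK hγ i y).symm

theorem exists_adjoin {K Ω : Type*} [Field K] [Field Ω] [Algebra K Ω] {ζ : K}
    (hζ : IsPrimitiveRoot ζ p) {x : Kˣ} (hx : x ∉ pows p K) {γ : Ω}
    (hγ : γ ^ p = algebraMap K Ω x) :
    ∃ k : Kum p K⟮γ⟯ ζ x, algebraMap K⟮γ⟯ Ω k.γ = γ := by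
  have hi : IsIntegral K γ := by
    refine IsIntegral.of_pow hp.out.pos ?_
    rw [hγ]
    exact isIntegral_algebraMap
  obtain ⟨k, hk⟩ := exists_of_adjoin_eq_top hζ hx (γ := AdjoinSimple.gen K γ)
    (Subtype.ext (by simpa using hγ)) (adjoin.powerBasis hi).adjoin_gen_eq_top
  exact ⟨k, by rw [hk]; rfl⟩

end Kum

theorem mem_adjoin_simple_of_fixed {F Ω : Type*} [Field F] [Field Ω] [Algebra F Ω] [IsGalois F Ω]
    {γ x : Ω} (h : ∀ g : Ω ≃ₐ[F] Ω, g γ = γ → g x = x) : x ∈ F⟮γ⟯ := by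
  rw [← InfiniteGalois.fixedField_fixingSubgroup F⟮γ⟯, mem_fixedField_iff]
  exact fun g hg => h g (hg ⟨γ, mem_adjoin_simple_self F γ⟩)

theorem apply_eq_of_mem_adjoin_simple {F K Ω : Type*} [Field F] [Field K] [Field Ω] [Algebra F Ω]
    [Algebra K Ω] {γ : Ω} {g : Ω ≃ₐ[F] Ω} (hK : ∀ c : K, g (algebraMap K Ω c) = algebraMap K Ω c)
    (hγ : g γ = γ) {x : Ω} (hx : x ∈ K⟮γ⟯) : g x = x := by
  induction hx using adjoin_induction with
  | mem x hx =>
    obtain rfl : x = γ := hx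
    exact hγ
  | algebraMap c => exact hK c
  | add x y _ _ hx hy => rw [map_add, hx, hy]
  | inv x _ hx => rw [map_inv₀, hx]
  | mul x y _ _ hx hy => rw [map_mul, hx, hy]

end

section

open IntermediateField

theorem rootChar_one {n : ℕ} [NeZero n] {F : Type*} [Field F] {θ : F} (hθ : IsPrimitiveRoot θ n) :
    rootChar hθ 1 = θ := by
  have := rootChar_natCast hθ 1
  rwa [Nat.cast_one, pow_one] at this

theorem natCast_prime_ne_zero {p : ℕ} [hp : Fact p.Prime] : (p : ZMod (p ^ 2)) ≠ 0 := by
  rw [Ne, ZMod.natCast_eq_zero_iff, Nat.pow_dvd_iff_le_padicValNat hp.out.ne_one hp.out.ne_zero]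
  simp

/-- If `x ^ p = z ^ p` then `x` and `z` have the same stabiliser. -/
theorem apply_eq_of_pow_eq {p : ℕ} [NeZero p] {F Ω : Type*} [Field F] [Field Ω] [Algebra F Ω]
    {ζ : F} (hζ : IsPrimitiveRoot ζ p) {x z : Ω} (hz : z ≠ 0) (h : x ^ p = z ^ p)
    {g : Ω ≃ₐ[F] Ω} (hg : g z = z) : g x = x := by
  obtain ⟨i, hi⟩ := exists_rootChar_eq (Ω := Ω) (y := x / z) hζ
    (by rw [div_pow, h, div_self (pow_ne_zero _ hz)])
  rw [eq_div_iff hz] at hi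
  rw [← hi, map_mul, AlgEquiv.commutes, hg]

theorem isUnit_of_castHom_eq_one {p : ℕ} [hp : Fact p.Prime] {z : ZMod (p ^ 2)}
    (hz : ZMod.castHom (dvd_pow_self p two_ne_zero) (ZMod p) z = 1) : IsUnit z := by
  have : NeZero p := ⟨hp.out.ne_zero⟩
  obtain ⟨a, rfl⟩ : ∃ a : ℕ, (a : ZMod (p ^ 2)) = z := ⟨z.val, ZMod.natCast_zmod_val z⟩
  rw [map_natCast] at hz
  rw [ZMod.isUnit_iff_coprime]
  refine Nat.Coprime.pow_right 2 ((ZMod.isUnit_iff_coprime a p).mp ?_)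
  rw [hz]
  exact isUnit_one

/-- The arithmetic input: a twisted norm for a character modulo `p` becomes a twisted norm for
a suitable lift of the character modulo `p ^ 2`. -/
theorem exists_lift_twisted_norm {p : ℕ} [hp : Fact p.Prime] (hp2 : p ≠ 2) {F Ω : Type} [Field F]
    [NumberField F] [Field Ω] [Algebra F Ω] [IsGalois F Ω] {θ : F}
    (hθ : IsPrimitiveRoot θ (p ^ 2)) (hζ : IsPrimitiveRoot (θ ^ p) p)
    (hroot : ∀ x : Ω, ∃ y, y ^ p = x) (A₁ : (Ω ≃ₐ[F] Ω) → ZMod p)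
    (hA₁ : ∀ g h, A₁ (g * h) = A₁ g + A₁ h) {α : Ω} (hα : α ≠ 0)
    (hA₁α : ∀ g, g α = algebraMap F Ω (rootChar hζ (A₁ g)) * α)
    {s₁ : Ω ≃ₐ[F] Ω} (hs₁ : A₁ s₁ = 1) {y : Ω} (hy : y ≠ 0) (hA₁y : ∀ g, A₁ g = 0 → g y = y) :
    ∃ A : (Ω ≃ₐ[F] Ω) → ZMod (p ^ 2), (∀ g h, A (g * h) = A g + A h) ∧ FinDet A ∧
      (∀ g, ZMod.castHom (dvd_pow_self p two_ne_zero) (ZMod p) (A g) = A₁ g) ∧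
      ∃ s, A s = 1 ∧ ∃ e : Ω, e ≠ 0 ∧ (∀ g, A g = 0 → g e = e) ∧
        ∏ i ∈ Finset.range p, ((s ^ p) ^ i) e = ∏ i ∈ Finset.range p, (s₁ ^ i) y ∧
        ∀ w : Ω, (∀ g, A g = 0 → g w = w) → ∏ i ∈ Finset.range p, ((s ^ p) ^ i) w = 1 →
          ∃ z : Ω, z ≠ 0 ∧ (∀ g, A g = 0 → g z = z) ∧ w * (s ^ p) z = z := by
  have hp0 : NeZero p := ⟨hp.out.ne_zero⟩
  have hψinj : ∀ {x z}, algebraMap F Ω (rootChar hζ x) = algebraMap F Ω (rootChar hζ z) → x = z :=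
    fun h => rootChar_injective hζ ((algebraMap F Ω).injective h)
  have hαfix : ∀ g, A₁ g = 0 → g α = α := fun g hg => by
    rw [hA₁α, hg, AddChar.map_zero_eq_one, map_one, one_mul]
  obtain ⟨a, ha⟩ : α ^ p ∈ Set.range (algebraMap F Ω) := by
    rw [InfiniteGalois.mem_range_algebraMap_iff_fixed]
    intro g
    rw [map_pow, hA₁α, mul_pow, ← map_pow, rootChar_pow_eq_one, map_one, one_mul]
  have ha0 : a ≠ 0 := by
    rintro rfl
    rw [map_zero] at ha
    exact pow_ne_zero p hα ha.symm
  have hs₁α : s₁ α = algebraMap F Ω (θ ^ p) * α := by rw [hA₁α, hs₁, rootChar_one]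
  obtain ⟨k, hk⟩ := Kum.exists_adjoin (Ω := Ω) hζ (x := Units.mk0 a ha0) (γ := α) (by
    intro h
    obtain ⟨c, hc⟩ := mem_pows.mp h
    have h1 : (c : F) ^ p = a := congrArg Units.val hc
    have h2 : s₁ α = α := apply_eq_of_pow_eq hζ (z := algebraMap F Ω c)
      ((map_ne_zero _).mpr c.ne_zero) (by rw [← map_pow, h1, ha]) (s₁.commutes _)
    rw [hA₁α, mul_eq_right₀ hα] at h2
    have h3 : A₁ s₁ = 0 := hψinj (by rw [h2, AddChar.map_zero_eq_one, map_one])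
    rw [hs₁] at h3
    exact one_ne_zero h3) ha.symm
  have := k.finiteDimensional
  have : NumberField F⟮α⟯ := NumberField.of_module_finite F _
  have hfixK : ∀ g, A₁ g = 0 → ∀ c : F⟮α⟯, g (algebraMap F⟮α⟯ Ω c) = algebraMap F⟮α⟯ Ω c :=
    fun g hg c => apply_eq_of_mem_adjoin_simple g.commutes (hαfix g hg) c.2
  have hyK : y ∈ F⟮α⟯ := mem_adjoin_simple_of_fixed fun g hg => hA₁y g (hψinj (by
    rw [hA₁α, mul_eq_right₀ hα] at hg
    rw [hg, AddChar.map_zero_eq_one, map_one]))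
  obtain ⟨Y, hY⟩ : ∃ Y : F⟮α⟯ˣ, algebraMap F⟮α⟯ Ω Y = y :=
    ⟨Units.mk0 ⟨y, hyK⟩ fun h => hy (congrArg Subtype.val h), rfl⟩
  have hnormY : algebraMap F Ω (Algebra.norm F (Y : F⟮α⟯)) =
      ∏ i ∈ Finset.range p, (s₁ ^ i) y := by
    rw [k.algebraMap_norm s₁.commutes (by rw [hk, hs₁α]), hY]
  obtain ⟨u, hu⟩ := k.exists_incl_norm_mem_norms hp2 rfl Y
  obtain ⟨γ, hγ⟩ := hroot (algebraMap F Ω u * α)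
  have hu0 : algebraMap F Ω u ≠ 0 := (map_ne_zero _).mpr u.ne_zero
  have hγp : γ ^ p ≠ 0 := by
    rw [hγ]
    exact mul_ne_zero hu0 hα
  have hγ0 : γ ≠ 0 := fun h => hγp (by rw [h, zero_pow hp.out.ne_zero])
  obtain ⟨A, hA, hAfin, hAγ⟩ := exists_kummerChar hθ hγ0 fun g => by
    rw [pow_two, pow_mul, hγ, mul_pow, ← ha, ← map_pow, ← map_mul, AlgEquiv.commutes]
  have hcast : ∀ g, ZMod.castHom (dvd_pow_self p two_ne_zero) (ZMod p) (A g) = A₁ g := fun g => by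
    apply hψinj
    apply mul_right_cancel₀ hγp
    rw [← rootChar_pow hθ hζ, map_pow, ← mul_pow, ← hAγ, ← map_pow, hγ, map_mul,
      AlgEquiv.commutes, hA₁α]
    ring
  have hA0 : ∀ g, A g = 0 → A₁ g = 0 := fun g hg => by rw [← hcast, hg, map_zero]
  have hγfix : ∀ g, A g = 0 → g γ = γ := fun g hg => by
    rw [hAγ, hg, AddChar.map_zero_eq_one, map_one, one_mul]
  obtain ⟨z, hz⟩ := (isUnit_of_castHom_eq_one ((hcast s₁).trans hs₁)).exists_left_inv
  obtain ⟨s, hs⟩ : ∃ s, A s = 1 :=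
    ⟨s₁ ^ z.val, by rw [character_pow hA, ZMod.natCast_zmod_val, hz]⟩
  have hsp : A₁ (s ^ p) = 0 := by
    rw [character_pow hA₁, ZMod.natCast_self, zero_mul]
  have hspγ : (s ^ p) γ = algebraMap F Ω (θ ^ p) * γ := by
    rw [hAγ, character_pow hA, hs, mul_one, rootChar_natCast]
  have hx : ((incl F F⟮α⟯ u * k.γU : F⟮α⟯ˣ) : F⟮α⟯) = algebraMap F F⟮α⟯ u * k.γ := rfl
  obtain ⟨k', hk'⟩ := Kum.exists_adjoin (Ω := Ω)
    (hζ.map_of_injective (algebraMap F F⟮α⟯).injective) (x := incl F F⟮α⟯ u * k.γU) (γ := γ) (by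
      intro h
      obtain ⟨c, hc⟩ := mem_pows.mp h
      have h1 : (c : F⟮α⟯) ^ p = algebraMap F F⟮α⟯ u * k.γ := congrArg Units.val hc
      have h2 : (s ^ p) γ = γ := apply_eq_of_pow_eq hζ (z := algebraMap F⟮α⟯ Ω c)
        ((map_ne_zero _).mpr c.ne_zero)
        (by rw [← map_pow, h1, map_mul, hk, hγ, ← IsScalarTower.algebraMap_apply])
        (hfixK _ hsp _)
      rw [hAγ, mul_eq_right₀ hγ0] at h2
      have h3 : A (s ^ p) = 0 := rootChar_injective hθ ((algebraMap F Ω).injective (by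
        rw [h2, AddChar.map_zero_eq_one, map_one]))
      rw [character_pow hA, hs, mul_one] at h3
      exact natCast_prime_ne_zero h3)
    (by rw [hx, map_mul, hk, hγ, ← IsScalarTower.algebraMap_apply])
  have := k'.finiteDimensional
  have : NumberField F⟮α⟯⟮γ⟯ := NumberField.of_module_finite F⟮α⟯ _
  obtain ⟨e, he⟩ := hu F⟮α⟯⟮γ⟯ k'
  have hfixL : ∀ g, A g = 0 → ∀ c : F⟮α⟯⟮γ⟯,
      g (algebraMap F⟮α⟯⟮γ⟯ Ω c) = algebraMap F⟮α⟯⟮γ⟯ Ω c :=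
    fun g hg c => apply_eq_of_mem_adjoin_simple (hfixK g (hA0 g hg)) (hγfix g hg) c.2
  have hnorm := fun c => k'.algebraMap_norm (hfixK _ hsp)
    (by rw [hk', hspγ, ← IsScalarTower.algebraMap_apply]) c
  refine ⟨A, hA, hAfin, hcast, s, hs, algebraMap F⟮α⟯⟮γ⟯ Ω e, (map_ne_zero _).mpr e.ne_zero,
    fun g hg => hfixL g hg _, ?_, fun w hw hw1 => ?_⟩
  · rw [← hnorm, ← hnormY, IsScalarTower.algebraMap_apply F F⟮α⟯ Ω]
    exact congrArg (algebraMap F⟮α⟯ Ω) (congrArg Units.val he)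
  · have hwL : w ∈ F⟮α⟯⟮γ⟯ := by
      have h1 : F⟮γ⟯ ≤ (F⟮α⟯⟮γ⟯).restrictScalars F :=
        adjoin_simple_le_iff.mpr (mem_adjoin_simple_self F⟮α⟯ γ)
      refine h1 (mem_adjoin_simple_of_fixed fun g hg => hw g ?_)
      rw [hAγ, mul_eq_right₀ hγ0] at hg
      exact rootChar_injective hθ ((algebraMap F Ω).injective (by
        rw [hg, AddChar.map_zero_eq_one, map_one]))
    obtain ⟨W, rfl⟩ : ∃ W : F⟮α⟯⟮γ⟯, algebraMap F⟮α⟯⟮γ⟯ Ω W = w := ⟨⟨w, hwL⟩, rfl⟩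
    rw [← hnorm, ← map_one (algebraMap F⟮α⟯ Ω)] at hw1
    obtain ⟨z, hz⟩ := k'.hilbert90 ((algebraMap F⟮α⟯ Ω).injective hw1)
    refine ⟨algebraMap F⟮α⟯⟮γ⟯ Ω z, (map_ne_zero _).mpr z.ne_zero, fun g hg => hfixL g hg _, ?_⟩
    have h1 := k'.algebraMap_s_pow (hfixK _ hsp)
      (by rw [hk', hspγ, ← IsScalarTower.algebraMap_apply]) 1 (z : F⟮α⟯⟮γ⟯)
    rw [pow_one, pow_one] at h1
    rw [h1, ← map_mul, hz]

end

section

/-- Unitriangular `3 × 3` homomorphisms lift from `ZMod p` to `ZMod (p ^ 2)`. -/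
theorem exists_heisenberg_lift {p : ℕ} [hp : Fact p.Prime] (hp2 : p ≠ 2) {F Ω : Type} [Field F]
    [NumberField F] [Field Ω] [Algebra F Ω] [IsGalois F Ω] {θ : F}
    (hθ : IsPrimitiveRoot θ (p ^ 2)) (hroot : ∀ x : Ω, ∃ y, y ^ p = x)
    (A₁ B₁ C₁ : (Ω ≃ₐ[F] Ω) → ZMod p)
    (hA₁ : ∀ g h, A₁ (g * h) = A₁ g + A₁ h) (hB₁ : ∀ g h, B₁ (g * h) = B₁ g + B₁ h)
    (hC₁ : ∀ g h, C₁ (g * h) = C₁ g + C₁ h + A₁ g * B₁ h)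
    (hA₁f : FinDet A₁) (hB₁f : FinDet B₁) (hC₁f : FinDet C₁) :
    ∃ A B C : (Ω ≃ₐ[F] Ω) → ZMod (p ^ 2),
      (∀ g h, A (g * h) = A g + A h) ∧ (∀ g h, B (g * h) = B g + B h) ∧
      (∀ g h, C (g * h) = C g + C h + A g * B h) ∧ FinDet A ∧ FinDet B ∧ FinDet C ∧
      (∀ g, ZMod.castHom (dvd_pow_self p two_ne_zero) (ZMod p) (A g) = A₁ g) ∧
      (∀ g, ZMod.castHom (dvd_pow_self p two_ne_zero) (ZMod p) (B g) = B₁ g) ∧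
      (∀ g, ZMod.castHom (dvd_pow_self p two_ne_zero) (ZMod p) (C g) = C₁ g) := by
  have hp0 : NeZero p := ⟨hp.out.ne_zero⟩
  have hζ : IsPrimitiveRoot (θ ^ p) p :=
    hθ.pow (pow_pos hp.out.pos 2) (by rw [pow_two])
  by_cases hA0 : ∀ g, A₁ g = 0
  · obtain ⟨B, hB, hBf, hB'⟩ := exists_lift_character hθ hζ hroot B₁ hB₁ hB₁f
    obtain ⟨C, hC, hCf, hC'⟩ := exists_lift_character hθ hζ hroot C₁
      (fun g h => by rw [hC₁, hA0, zero_mul, add_zero]) hC₁f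
    exact ⟨fun _ => 0, B, C, fun _ _ => (add_zero _).symm, hB,
      fun g h => by rw [hC, zero_mul, add_zero], ⟨∅, fun _ _ _ => rfl⟩, hBf, hCf,
      fun g => by rw [hA0, map_zero], hB', hC'⟩
  push Not at hA0
  obtain ⟨g₀, hg₀⟩ := hA0
  obtain ⟨s₁, hs₁⟩ : ∃ s₁, A₁ s₁ = 1 :=
    ⟨g₀ ^ (A₁ g₀)⁻¹.val, by
      rw [character_pow hA₁, ZMod.natCast_zmod_val, inv_mul_cancel₀ hg₀]⟩
  have hrad : ∀ D : (Ω ≃ₐ[F] Ω) → ZMod p, (∀ g h, D (g * h) = D g + D h) → FinDet D →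
      ∃ α : Ω, α ≠ 0 ∧ ∀ g, g α = algebraMap F Ω (rootChar hζ (D g)) * α := fun D hD hDf => by
    obtain ⟨α, hα, h⟩ := exists_eigenvector ⊤ (fun g => algebraMap F Ω (rootChar hζ (D g)))
      (hDf.comp fun z => algebraMap F Ω (rootChar hζ z))
      (fun g _ => by simpa using rootChar_ne_zero hζ _)
      (fun g _ h _ => by rw [hD, AddChar.map_add_eq_mul, map_mul]) (fun g _ h _ => by simp)
    exact ⟨α, hα, fun g => h g trivial⟩
  obtain ⟨α, hα, hAα⟩ := hrad A₁ hA₁ hA₁f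
  obtain ⟨β, hβ, hBβ⟩ := hrad B₁ hB₁ hB₁f
  have hβp : ∀ g : Ω ≃ₐ[F] Ω, g (β ^ p) = β ^ p := fun g => by
    rw [map_pow, hBβ, mul_pow, ← map_pow, rootChar_pow_eq_one, map_one, one_mul]
  obtain ⟨y, hy, hAy, hyβ⟩ :=
    exists_twisted_norm_eq hζ A₁ B₁ C₁ hA₁ hB₁ hC₁ hC₁f hβ hBβ hs₁
  obtain ⟨A, hA, hAf, hA', s, hs, e, he, hAe, heβ, h90⟩ :=
    exists_lift_twisted_norm hp2 hθ hζ hroot A₁ hA₁ hα hAα hs₁ hy hAy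
  rw [hyβ] at heβ
  obtain ⟨f, v, hf, hv, hAf', hv', hfv⟩ :=
    exists_prod_eq_of_hilbert90 A hA hs (hβp s) he hAe heβ h90
  have hβv : β / v ≠ 0 := div_ne_zero hβ hv
  obtain ⟨γ, hγ⟩ := hroot (β / v)
  have hγ0 : γ ≠ 0 := by
    rintro rfl
    rw [zero_pow hp.out.ne_zero] at hγ
    exact hβv hγ.symm
  have hγn : γ ^ p ^ 2 = ∏ i ∈ Finset.range (p ^ 2), (s ^ i) f := by
    rw [pow_two, pow_mul, hγ, div_pow, hfv, mul_div_cancel_left₀ _ (pow_ne_zero p hv), pow_two]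
  obtain ⟨B, hB, hBf, hBγ⟩ := exists_kummerChar hθ hγ0 fun g => by
    rw [pow_two, pow_mul, hγ, div_pow, map_div₀, hβp, map_pow, hv']
  have hB' : ∀ g, ZMod.castHom (dvd_pow_self p two_ne_zero) (ZMod p) (B g) = B₁ g := fun g => by
    apply rootChar_injective hζ
    apply (algebraMap F Ω).injective
    apply mul_right_cancel₀ hβv
    conv_lhs => rw [← hγ]
    rw [← rootChar_pow hθ hζ, map_pow, ← mul_pow, ← hBγ, ← map_pow, hγ, map_div₀, hBβ, hv',
      mul_div_assoc]
  obtain ⟨C, hCf, hC⟩ := exists_heisenberg_cochain hθ (fun x => by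
    obtain ⟨w, rfl⟩ := hroot x
    obtain ⟨w, rfl⟩ := hroot w
    exact ⟨w, by rw [pow_two, pow_mul]⟩) A B hA hB hAf hs hf hγ0 hAf' hBγ hγn
  obtain ⟨H, hH, hHf, hH'⟩ := exists_lift_character hθ hζ hroot
    (fun g => C₁ g - ZMod.castHom (dvd_pow_self p two_ne_zero) (ZMod p) (C g + A g * B g))
    (fun g h => by
      rw [hC₁, hC, hA, hB, ← hA', ← hB']
      simp only [map_add, map_sub, map_mul]
      ring)
    (hC₁f.comp₂ (hCf.comp₂ (hAf.comp₂ hBf fun x z => x * z) fun x z => x + z)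
      fun x z => x - ZMod.castHom (dvd_pow_self p two_ne_zero) (ZMod p) z)
  refine ⟨A, B, fun g => C g + A g * B g + H g, hA, hB, fun g h => ?_, hAf, hBf,
    (hCf.comp₂ (hAf.comp₂ hBf fun x z => x * z) fun x z => x + z).comp₂ hHf fun x z => x + z,
    hA', hB', fun g => ?_⟩
  · simp only [hC, hA, hB, hH]
    ring
  · rw [map_add, hH', add_sub_cancel]

end

section

/-- Averaging over cosets: along a ring homomorphism with square-zero kernel, a multiplicative map
lifts as soon as its restriction to a subgroup of invertible index does. -/
theorem exists_lift_of_index_isUnit {G M N : Type*} [Group G] [Ring M] [Ring N] (π : M →+* N)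
    (hπ : ∀ a b, π a = 0 → π b = 0 → a * b = 0) (H : Subgroup G) [H.FiniteIndex]
    (hH : IsUnit (H.index : M)) (ρ : G →* N) (hρ : ∀ g, ∃ u : Mˣ, π u = ρ g) (r : H →* M)
    (hr : ∀ h, π (r h) = ρ h) :
    ∃ Φ : G →* M, (∀ g, π (Φ g) = ρ g) ∧ ∃ T : Finset G, ∀ g₁ g₂ : G,
      (∀ x ∈ T, ∃ k : H, (k : G) = (g₁ * x)⁻¹ * (g₂ * x) ∧ r k = 1) → Φ g₁ = Φ g₂ := by
  classical
  have := H.fintypeQuotientOfFiniteIndex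
  choose L hL using hρ
  have hmem : ∀ g : G, (QuotientGroup.mk g : G ⧸ H).out⁻¹ * g ∈ H := fun g =>
    QuotientGroup.eq.mp (Quotient.out_eq' _)
  let t : G → Mˣ := fun g =>
    L (QuotientGroup.mk g : G ⧸ H).out * r.toHomUnits ⟨_, hmem g⟩
  have htπ : ∀ g, π (t g) = ρ g := fun g => by
    change π ((L (QuotientGroup.mk g : G ⧸ H).out : M) * r ⟨_, hmem g⟩) = _
    rw [map_mul, hL, hr, ← map_mul, mul_inv_cancel_left]
  have htmul : ∀ (g : G) (k : H), t (g * k) = t g * r.toHomUnits k := fun g k => by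
    have h1 : (QuotientGroup.mk (g * k) : G ⧸ H) = QuotientGroup.mk g := by simp
    simp only [t]
    rw [mul_assoc, ← map_mul]
    congr 2
    · rw [h1]
    · congr 1
      change (QuotientGroup.mk (g * k) : G ⧸ H).out⁻¹ * (g * k) =
        (QuotientGroup.mk g : G ⧸ H).out⁻¹ * g * k
      rw [h1, mul_assoc]
  let f : G → G → M := fun x g => (t (g * x) * (t x)⁻¹ : Mˣ)
  have hfinv : ∀ x y g, (QuotientGroup.mk x : G ⧸ H) = QuotientGroup.mk y → f x g = f y g := by
    intro x y g hxy
    obtain ⟨k, hk⟩ : ∃ k : H, (k : G) = x⁻¹ * y := ⟨⟨_, QuotientGroup.eq.mp hxy⟩, rfl⟩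
    have h1 : y = x * k := by rw [hk, mul_inv_cancel_left]
    simp only [f]
    rw [h1, ← mul_assoc g, htmul, htmul]
    congr 1
    group
  have hfmul : ∀ x g g', f x (g * g') = f (g' * x) g * f x g' := fun x g g' => by
    simp only [f]
    rw [← Units.val_mul]
    congr 1
    rw [mul_assoc g]
    group
  have hfπ : ∀ x g, π (f x g) = ρ g := fun x g => by
    have h1 : f x g * t x = t (g * x) := by simp only [f]; simp
    have h2 := congrArg π h1
    rw [map_mul, htπ, htπ, map_mul] at h2
    have h3 : ρ x * ρ x⁻¹ = 1 := by rw [← map_mul, mul_inv_cancel, map_one]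
    calc π (f x g) = π (f x g) * ρ x * ρ x⁻¹ := by rw [mul_assoc, h3, mul_one]
      _ = ρ g := by rw [h2, mul_assoc, h3, mul_one]
  have hcard : ((Fintype.card (G ⧸ H) : ℕ) : M) = H.index := by
    rw [Subgroup.index, Nat.card_eq_fintype_card]
  obtain ⟨c, hc⟩ := hH.exists_left_inv
  obtain ⟨Ψ, hΨ⟩ : ∃ Ψ : G → M, ∀ g, Ψ g = c * ∑ q : G ⧸ H, f q.out g := ⟨_, fun _ => rfl⟩
  have hΨsum : ∀ g, ∑ q : G ⧸ H, f q.out g = H.index * Ψ g := fun g => by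
    rw [hΨ, ← mul_assoc]
    have : (H.index : M) * c = 1 :=
      hH.mul_right_cancel (by rw [mul_assoc, hc, mul_one, one_mul])
    rw [this, one_mul]
  have hΨπ : ∀ g, π (Ψ g) = ρ g := fun g => by
    rw [hΨ, map_mul, map_sum]
    simp only [hfπ]
    rw [Finset.sum_const, Finset.card_univ, nsmul_eq_mul, ← mul_assoc, ← map_natCast π, ← map_mul,
      hcard, hc, map_one, one_mul]
  have hδ : ∀ g, ∑ q : G ⧸ H, (f q.out g - Ψ g) = 0 := fun g => by
    rw [Finset.sum_sub_distrib, hΨsum, Finset.sum_const, Finset.card_univ, nsmul_eq_mul, hcard,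
      sub_self]
  have hmul : ∀ g g', Ψ (g * g') = Ψ g * Ψ g' := fun g g' => by
    have h1 : ∀ q : G ⧸ H, f q.out (g * g') = Ψ g * Ψ g' + Ψ g * (f q.out g' - Ψ g') +
        (f (g' • q).out g - Ψ g) * Ψ g' := fun q => by
      have h2 : f (g' * q.out) g = f (g' • q).out g := hfinv _ _ _ (by
        rw [QuotientGroup.out_eq', ← smul_eq_mul, ← MulAction.Quotient.smul_mk,
          QuotientGroup.out_eq'])
      have h3 : (f (g' • q).out g - Ψ g) * (f q.out g' - Ψ g') = 0 :=
        hπ _ _ (by rw [map_sub, hfπ, hΨπ, sub_self]) (by rw [map_sub, hfπ, hΨπ, sub_self])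
      rw [hfmul, h2]
      rw [sub_mul, mul_sub, mul_sub] at h3
      rw [mul_sub, sub_mul]
      rw [← sub_eq_zero, ← h3]
      abel
    have h2 : ∑ q : G ⧸ H, (f (g' • q).out g - Ψ g) = 0 :=
      (Equiv.sum_comp (MulAction.toPerm g') fun q : G ⧸ H => f q.out g - Ψ g).trans (hδ g)
    rw [hΨ, Finset.sum_congr rfl fun q _ => h1 q, Finset.sum_add_distrib, Finset.sum_add_distrib,
      Finset.sum_const, ← Finset.mul_sum, hδ, mul_zero, ← Finset.sum_mul,
      h2, zero_mul, add_zero, add_zero, Finset.card_univ, nsmul_eq_mul, hcard, ← mul_assoc, hc,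
      one_mul]
  have hone : Ψ 1 = 1 := by
    have h1 : ∀ x, f x 1 = 1 := fun x => by simp [f]
    rw [hΨ]
    simp only [h1]
    rw [Finset.sum_const, Finset.card_univ, nsmul_eq_mul, mul_one, hcard, hc]
  refine ⟨⟨⟨Ψ, hone⟩, hmul⟩, hΨπ, Finset.univ.image fun q : G ⧸ H => q.out, fun g₁ g₂ h => ?_⟩
  change Ψ g₁ = Ψ g₂
  rw [hΨ, hΨ]
  congr 1
  refine Finset.sum_congr rfl fun q _ => ?_
  obtain ⟨k, hk, hk'⟩ := h q.out (Finset.mem_image_of_mem _ (Finset.mem_univ q))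
  have h1 : g₂ * q.out = g₁ * q.out * k := by rw [hk, mul_inv_cancel_left]
  have h2 : r.toHomUnits k = 1 := Units.ext hk'
  simp only [f]
  rw [h1, htmul, h2, mul_one]

end

section

open scoped Pointwise

section uni

variable {R : Type*} [CommRing R]

theorem uni_mul_uni (a b c a' b' c' : R) :
    (!![1, a, c; 0, 1, b; 0, 0, 1] : Matrix (Fin 3) (Fin 3) R) *
      !![1, a', c'; 0, 1, b'; 0, 0, 1] =
      !![1, a + a', c + c' + a * b'; 0, 1, b + b'; 0, 0, 1] := by
  ext i j
  fin_cases i <;> fin_cases j <;> simp [Matrix.mul_apply, Fin.sum_univ_three] <;> ring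

theorem uni_zero : (!![1, 0, 0; 0, 1, 0; 0, 0, 1] : Matrix (Fin 3) (Fin 3) R) = 1 := by
  ext i j
  fin_cases i <;> fin_cases j <;> simp

/-- The unitriangular matrix with prescribed entries. -/
def uni (a b c : R) : GL (Fin 3) R where
  val := !![1, a, c; 0, 1, b; 0, 0, 1]
  inv := !![1, -a, a * b - c; 0, 1, -b; 0, 0, 1]
  val_inv := by rw [uni_mul_uni, ← uni_zero]; congr <;> ring
  inv_val := by rw [uni_mul_uni, ← uni_zero]; congr <;> ring

theorem uni_mul (a b c a' b' c' : R) :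
    uni a b c * uni a' b' c' = uni (a + a') (b + b') (c + c' + a * b') :=
  Units.ext (uni_mul_uni a b c a' b' c')

theorem uni_one : uni (0 : R) 0 0 = 1 := Units.ext uni_zero

theorem uni_inj {a b c a' b' c' : R} (h : uni a b c = uni a' b' c') : a = a' ∧ b = b' ∧ c = c' := by
  have h1 := fun i j => congrArg (fun g : GL (Fin 3) R => (g : Matrix (Fin 3) (Fin 3) R) i j) h
  exact ⟨h1 0 1, h1 1 2, h1 0 2⟩

/-- The subgroup of unitriangular matrices. -/
def uniSubgroup (R : Type*) [CommRing R] : Subgroup (GL (Fin 3) R) where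
  carrier := {g | ∃ a b c, uni a b c = g}
  mul_mem' := by
    rintro _ _ ⟨a, b, c, rfl⟩ ⟨a', b', c', rfl⟩
    exact ⟨_, _, _, (uni_mul a b c a' b' c').symm⟩
  one_mem' := ⟨0, 0, 0, uni_one⟩
  inv_mem' := by
    rintro _ ⟨a, b, c, rfl⟩
    refine ⟨-a, -b, a * b - c, ?_⟩
    rw [eq_inv_iff_mul_eq_one, uni_mul, ← uni_one]
    congr <;> ring

theorem card_uniSubgroup : Nat.card (uniSubgroup R) = Nat.card R ^ 3 := by
  have h : Function.Bijective fun x : R × R × R =>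
      (⟨uni x.1 x.2.1 x.2.2, _, _, _, rfl⟩ : uniSubgroup R) := by
    constructor
    · rintro ⟨a, b, c⟩ ⟨a', b', c'⟩ hx
      obtain ⟨rfl, rfl, rfl⟩ := uni_inj (congrArg Subtype.val hx)
      rfl
    · rintro ⟨_, a, b, c, rfl⟩
      exact ⟨(a, b, c), rfl⟩
  rw [← Nat.card_congr (Equiv.ofBijective _ h), Nat.card_prod, Nat.card_prod]
  ring

end uni

theorem not_dvd_index_uniSubgroup {p : ℕ} [hp : Fact p.Prime] :
    ¬ p ∣ (uniSubgroup (ZMod p)).index := by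
  have h1 := (uniSubgroup (ZMod p)).card_mul_index
  rw [card_uniSubgroup, Nat.card_zmod, Matrix.card_GL_field, Fin.prod_univ_three, ZMod.card] at h1
  obtain ⟨q, rfl⟩ : ∃ q, p = q + 1 := ⟨p - 1, (Nat.sub_add_cancel hp.out.pos).symm⟩
  have h2 : (uniSubgroup (ZMod (q + 1))).index =
      ((q + 1) ^ 3 - 1) * (((q + 1) ^ 2 - 1) * (q + 1 - 1)) := by
    apply Nat.eq_of_mul_eq_mul_left (n := (q + 1) ^ 3) (pow_pos (Nat.succ_pos q) 3)
    rw [h1]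
    have e1 : (q + 1) ^ 3 - (q + 1) ^ ((1 : Fin 3) : ℕ) = (q + 1) * ((q + 1) ^ 2 - 1) := by
      change (q + 1) ^ 3 - (q + 1) ^ 1 = _
      rw [Nat.mul_sub, mul_one, pow_one, pow_succ' (q + 1) 2]
    have e2 : (q + 1) ^ 3 - (q + 1) ^ ((2 : Fin 3) : ℕ) = (q + 1) ^ 2 * (q + 1 - 1) := by
      change (q + 1) ^ 3 - (q + 1) ^ 2 = _
      rw [Nat.mul_sub, mul_one, pow_succ (q + 1) 2]
    rw [e1, e2]
    change ((q + 1) ^ 3 - 1) * _ * _ = _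
    ring
  have h3 : ∀ k ≠ 0, ¬ (q + 1) ∣ (q + 1) ^ k - 1 := fun k hk hd => by
    have h4 : (q + 1) ∣ 1 := by
      have := Nat.dvd_sub (dvd_pow_self (q + 1) hk) hd
      rwa [Nat.sub_sub_self (Nat.one_le_pow _ _ (Nat.succ_pos q))] at this
    exact hp.out.one_lt.ne' (Nat.dvd_one.mp h4)
  rw [h2, hp.out.dvd_mul, hp.out.dvd_mul, not_or, not_or]
  refine ⟨h3 3 (by decide), h3 2 (by decide), ?_⟩
  have := h3 1 one_ne_zero
  rwa [pow_one] at this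

theorem exists_conj_mem_uniSubgroup {p : ℕ} [hp : Fact p.Prime] {P : Subgroup (GL (Fin 3) (ZMod p))}
    (hP : IsPGroup p P) : ∃ x : GL (Fin 3) (ZMod p), ∀ g ∈ P, x⁻¹ * g * x ∈ uniSubgroup (ZMod p) := by
  have hU : IsPGroup p (uniSubgroup (ZMod p)) :=
    IsPGroup.of_card (n := 3) (by rw [card_uniSubgroup, Nat.card_zmod])
  obtain ⟨Q, hQ⟩ := hP.exists_le_sylow
  obtain ⟨x, hx⟩ := MulAction.exists_smul_eq (GL (Fin 3) (ZMod p))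
    (hU.toSylow not_dvd_index_uniSubgroup) Q
  refine ⟨x, fun g hg => ?_⟩
  have h1 := hQ hg
  rw [← hx, Sylow.coe_subgroup_smul, Subgroup.mem_pointwise_smul_iff_inv_smul_mem] at h1
  simpa [MulAut.smul_def] using h1

end

section

section FinDetHom

variable {F Ω G : Type*} [Field F] [Field Ω] [Algebra F Ω] [Group G]

theorem finDet_of_isOpen_ker [Algebra.IsAlgebraic F Ω] (f : (Ω ≃ₐ[F] Ω) →* G)
    (hf : IsOpen (f.ker : Set (Ω ≃ₐ[F] Ω))) : FinDet f := by
  obtain ⟨E, hE, hle⟩ := (krullTopology_mem_nhds_one_iff F Ω _).mp (hf.mem_nhds (one_mem f.ker))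
  obtain ⟨S, hS⟩ := Module.Finite.iff_fg.mp (show Module.Finite F E.toSubalgebra.toSubmodule from hE)
  refine ⟨S, fun g h hgh => ?_⟩
  have h1 : g⁻¹ * h ∈ E.fixingSubgroup := by
    rw [IntermediateField.mem_fixingSubgroup_iff]
    intro x hx
    have h2 : x ∈ Submodule.span F (S : Set Ω) := hS ▸ hx
    have h3 : g x = h x := LinearMap.eqOn_span (f := g.toLinearMap) (g := h.toLinearMap)
      (fun y hy => hgh y hy) h2
    rw [AlgEquiv.mul_apply, ← h3]
    exact g.symm_apply_apply x
  have h3 : f (g⁻¹ * h) = 1 := hle h1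
  rwa [map_mul, map_inv, inv_mul_eq_one] at h3

theorem isOpen_ker_of_finDet [Algebra.IsAlgebraic F Ω] (f : (Ω ≃ₐ[F] Ω) →* G) (hf : FinDet f) :
    IsOpen (f.ker : Set (Ω ≃ₐ[F] Ω)) := by
  obtain ⟨S, hS⟩ := hf
  have : FiniteDimensional F (IntermediateField.adjoin F (S : Set Ω)) :=
    IntermediateField.finiteDimensional_adjoin fun x _ => Algebra.IsIntegral.isIntegral x
  refine Subgroup.isOpen_mono ?_ (IntermediateField.fixingSubgroup_isOpen
    (IntermediateField.adjoin F (S : Set Ω)))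
  intro g hg
  rw [MonoidHom.mem_ker, ← map_one f]
  exact hS g 1 fun x hx => (IntermediateField.mem_fixingSubgroup_iff _ _).mp hg x
    (IntermediateField.subset_adjoin F _ hx)

end FinDetHom

section Lift

variable {p : ℕ} [hp : Fact p.Prime]

theorem isUnit_of_isUnit_castHom {z : ZMod (p ^ 2)}
    (hz : IsUnit (ZMod.castHom (dvd_pow_self p two_ne_zero) (ZMod p) z)) : IsUnit z := by
  have : NeZero (p ^ 2) := ⟨(pow_pos hp.out.pos 2).ne'⟩
  obtain ⟨n, rfl⟩ := ZMod.natCast_zmod_surjective z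
  rw [map_natCast, ZMod.isUnit_iff_coprime] at hz
  rw [ZMod.isUnit_iff_coprime]
  exact hz.pow_right 2

theorem mul_eq_zero_of_castHom_eq_zero {a b : ZMod (p ^ 2)}
    (ha : ZMod.castHom (dvd_pow_self p two_ne_zero) (ZMod p) a = 0)
    (hb : ZMod.castHom (dvd_pow_self p two_ne_zero) (ZMod p) b = 0) : a * b = 0 := by
  have : NeZero (p ^ 2) := ⟨(pow_pos hp.out.pos 2).ne'⟩
  obtain ⟨m, rfl⟩ := ZMod.natCast_zmod_surjective a
  obtain ⟨n, rfl⟩ := ZMod.natCast_zmod_surjective b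
  rw [map_natCast, ZMod.natCast_eq_zero_iff] at ha hb
  rw [← Nat.cast_mul, ZMod.natCast_eq_zero_iff, pow_two]
  exact mul_dvd_mul ha hb

theorem exists_map_eq_GL {n : Type*} [Fintype n] [DecidableEq n] (g : GL n (ZMod p)) :
    ∃ u : GL n (ZMod (p ^ 2)), Matrix.GeneralLinearGroup.map
      (ZMod.castHom (dvd_pow_self p two_ne_zero) (ZMod p)) u = g := by
  choose s hs using ZMod.castHom_surjective (dvd_pow_self p two_ne_zero)
  let M : Matrix n n (ZMod (p ^ 2)) := (g : Matrix n n (ZMod p)).map s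
  have hM : (ZMod.castHom (dvd_pow_self p two_ne_zero) (ZMod p)).mapMatrix M = g := by
    ext i j
    exact hs _
  have hu : IsUnit M := by
    rw [Matrix.isUnit_iff_isUnit_det]
    refine isUnit_of_isUnit_castHom ?_
    rw [RingHom.map_det, hM]
    exact (Matrix.isUnit_iff_isUnit_det _).mp g.isUnit
  exact ⟨hu.unit, Units.ext hM⟩

theorem mapMatrix_castHom_mul_eq_zero {n : Type*} [Fintype n] [DecidableEq n]
    (a b : Matrix n n (ZMod (p ^ 2)))
    (ha : (ZMod.castHom (dvd_pow_self p two_ne_zero) (ZMod p)).mapMatrix a = 0)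
    (hb : (ZMod.castHom (dvd_pow_self p two_ne_zero) (ZMod p)).mapMatrix b = 0) : a * b = 0 := by
  ext i j
  exact Finset.sum_eq_zero fun k _ => mul_eq_zero_of_castHom_eq_zero
    (congrFun (congrFun ha i) k) (congrFun (congrFun hb k) j)

theorem exists_subgroup_conj_mem_uniSubgroup {G : Type*} [Group G]
    (ρ : G →* GL (Fin 3) (ZMod p)) :
    ∃ H : Subgroup G, ρ.ker ≤ H ∧ ¬ p ∣ H.index ∧
      ∃ x, ∀ h ∈ H, x⁻¹ * ρ h * x ∈ uniSubgroup (ZMod p) := by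
  let S : Sylow p ρ.range := default
  obtain ⟨x, hx⟩ := exists_conj_mem_uniSubgroup (S.2.map ρ.range.subtype)
  refine ⟨(S : Subgroup ρ.range).comap ρ.rangeRestrict, ?_, ?_, x, fun h hh => ?_⟩
  · intro g hg
    have : ρ.rangeRestrict g = 1 := Subtype.ext hg
    rw [Subgroup.mem_comap, this]
    exact one_mem _
  · rw [Subgroup.index_comap_of_surjective _ ρ.rangeRestrict_surjective]
    exact S.not_dvd_index
  · exact hx _ ⟨_, hh, rfl⟩

/-- A representation conjugate to a unitriangular one lifts. -/
theorem exists_lift_of_conj_mem_uniSubgroup (hp2 : p ≠ 2) {F Ω : Type} [Field F]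
    [NumberField F] [Field Ω] [Algebra F Ω] [IsGalois F Ω] {θ : F}
    (hθ : IsPrimitiveRoot θ (p ^ 2)) (hroot : ∀ x : Ω, ∃ y, y ^ p = x)
    (ρ : (Ω ≃ₐ[F] Ω) →* GL (Fin 3) (ZMod p)) (hρ : FinDet ρ) (x : GL (Fin 3) (ZMod p))
    (hx : ∀ g, x⁻¹ * ρ g * x ∈ uniSubgroup (ZMod p)) :
    ∃ r : (Ω ≃ₐ[F] Ω) →* GL (Fin 3) (ZMod (p ^ 2)), FinDet r ∧
      (Matrix.GeneralLinearGroup.map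
        (ZMod.castHom (dvd_pow_self p two_ne_zero) (ZMod p))).comp r = ρ := by
  choose A₁ B₁ C₁ h₁ using hx
  have hmul : ∀ g h, uni (A₁ (g * h)) (B₁ (g * h)) (C₁ (g * h)) =
      uni (A₁ g + A₁ h) (B₁ g + B₁ h) (C₁ g + C₁ h + A₁ g * B₁ h) := fun g h => by
    rw [← uni_mul, h₁, h₁, h₁, map_mul]
    group
  have hdet : ∀ u : GL (Fin 3) (ZMod p) → ZMod p,
      FinDet fun g => u (uni (A₁ g) (B₁ g) (C₁ g)) := fun u => by
    obtain ⟨S, hS⟩ := hρ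
    exact ⟨S, fun g h hgh => by simp only [h₁, hS g h hgh]⟩
  obtain ⟨A, B, C, hA, hB, hC, hAf, hBf, hCf, hA', hB', hC'⟩ := exists_heisenberg_lift hp2 hθ hroot
    A₁ B₁ C₁ (fun g h => (uni_inj (hmul g h)).1) (fun g h => (uni_inj (hmul g h)).2.1)
    (fun g h => (uni_inj (hmul g h)).2.2) (hdet fun m => (m : Matrix (Fin 3) (Fin 3) (ZMod p)) 0 1)
    (hdet fun m => (m : Matrix (Fin 3) (Fin 3) (ZMod p)) 1 2)
    (hdet fun m => (m : Matrix (Fin 3) (Fin 3) (ZMod p)) 0 2)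
  obtain ⟨X, hX⟩ := exists_map_eq_GL x
  refine ⟨MonoidHom.mk' (fun g => X * uni (A g) (B g) (C g) * X⁻¹) fun g h => ?_, ?_, ?_⟩
  · rw [hA, hB, hC, ← uni_mul]
    group
  · exact (hAf.comp₂ (hBf.comp₂ hCf Prod.mk)
      fun a b => X * uni a b.1 b.2 * X⁻¹)
  · ext1 g
    have h2 : Matrix.GeneralLinearGroup.map
        (ZMod.castHom (dvd_pow_self p two_ne_zero) (ZMod p)) (uni (A g) (B g) (C g)) =
        uni (A₁ g) (B₁ g) (C₁ g) := by
      rw [← hA', ← hB', ← hC']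
      ext i j
      fin_cases i <;> fin_cases j <;> simp [uni]
    rw [MonoidHom.comp_apply, MonoidHom.mk'_apply, map_mul, map_mul, map_inv, hX, h2, h₁]
    group

end Lift

theorem exists_GL_lift {p : ℕ} [hp : Fact p.Prime] (hp2 : p ≠ 2) {F Ω : Type} [Field F]
    [NumberField F] [Field Ω] [Algebra F Ω] [IsGalois F Ω] {θ : F}
    (hθ : IsPrimitiveRoot θ (p ^ 2)) (hroot : ∀ x : Ω, ∃ y, y ^ p = x)
    (ρ : (Ω ≃ₐ[F] Ω) →* GL (Fin 3) (ZMod p)) (hρ : IsOpen (ρ.ker : Set (Ω ≃ₐ[F] Ω))) :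
    ∃ ρ₂ : (Ω ≃ₐ[F] Ω) →* GL (Fin 3) (ZMod (p ^ 2)),
      IsOpen (ρ₂.ker : Set (Ω ≃ₐ[F] Ω)) ∧
      (Matrix.GeneralLinearGroup.map
        (ZMod.castHom (dvd_pow_self p two_ne_zero) (ZMod p))).comp ρ₂ = ρ := by
  classical
  obtain ⟨H, hker, hidx, x, hx⟩ := exists_subgroup_conj_mem_uniSubgroup ρ
  have hHo : IsOpen (H : Set (Ω ≃ₐ[F] Ω)) := Subgroup.isOpen_mono hker hρ
  obtain ⟨L, rfl⟩ : ∃ L : IntermediateField F Ω, L.fixingSubgroup = H :=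
    ⟨_, InfiniteGalois.fixingSubgroup_fixedField ⟨H, H.isClosed_of_isOpen hHo⟩⟩
  have hLf : FiniteDimensional F L := (InfiniteGalois.isOpen_iff_finite L).mp hHo
  have hL : NumberField L := NumberField.of_module_finite F L
  have : L.fixingSubgroup.FiniteIndex := ⟨fun h => hidx (h ▸ dvd_zero p)⟩
  obtain ⟨Sρ, hSρ⟩ := finDet_of_isOpen_ker ρ hρ
  let e := L.fixingSubgroupEquiv
  have he : ∀ (τ : Ω ≃ₐ[L] Ω) (y : Ω), (e.symm τ : Ω ≃ₐ[F] Ω) y = τ y := fun τ y => rfl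
  obtain ⟨r, ⟨Sr, hSr⟩, hr⟩ := exists_lift_of_conj_mem_uniSubgroup hp2
    (hθ.map_of_injective (algebraMap F L).injective) hroot
    (ρ.comp (L.fixingSubgroup.subtype.comp e.symm.toMonoidHom))
    ⟨Sρ, fun g h hgh => hSρ _ _ hgh⟩ x fun g => hx _ (e.symm g).2
  let φ := ZMod.castHom (dvd_pow_self p two_ne_zero) (ZMod p)
  let c := (Units.coeHom (Matrix (Fin 3) (Fin 3) (ZMod p))).comp ρ
  let r' : L.fixingSubgroup →* Matrix (Fin 3) (Fin 3) (ZMod (p ^ 2)) :=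
    (Units.coeHom _).comp (r.comp e.toMonoidHom)
  have hunit : IsUnit (L.fixingSubgroup.index : Matrix (Fin 3) (Fin 3) (ZMod (p ^ 2))) := by
    have h1 : IsUnit (L.fixingSubgroup.index : ZMod (p ^ 2)) := by
      rw [ZMod.isUnit_iff_coprime]
      exact ((hp.out.coprime_iff_not_dvd.mpr hidx).symm).pow_right 2
    simpa using h1.map (algebraMap _ (Matrix (Fin 3) (Fin 3) (ZMod (p ^ 2))))
  obtain ⟨Φ, hΦ, T, hT⟩ := exists_lift_of_index_isUnit φ.mapMatrix
    (fun a b ha hb => mapMatrix_castHom_mul_eq_zero a b ha hb) L.fixingSubgroup hunit c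
    (fun g => by
      obtain ⟨u, hu⟩ := exists_map_eq_GL (ρ g)
      exact ⟨u, congrArg Units.val hu⟩) r'
    (fun h => by
      have := congrArg Units.val (DFunLike.congr_fun hr (e h))
      simp only [MonoidHom.comp_apply, MulEquiv.toMonoidHom_eq_coe,
        MonoidHom.coe_coe, MulEquiv.symm_apply_apply] at this
      exact this)
  refine ⟨Φ.toHomUnits, isOpen_ker_of_finDet _ ?_, ?_⟩
  · obtain ⟨SL, hSL⟩ := Module.Finite.iff_fg.mp
      (show Module.Finite F L.toSubalgebra.toSubmodule from hLf)
    refine FinDet.of_comp (u := Units.val) Units.val_injective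
      ⟨T.biUnion fun t => (SL ∪ Sr).image t, fun g₁ g₂ hg => hT g₁ g₂ fun t ht => ?_⟩
    have hfix : ∀ y ∈ SL ∪ Sr, ((g₁ * t)⁻¹ * (g₂ * t)) y = y := fun y hy => by
      have := hg (t y) (Finset.mem_biUnion.mpr ⟨t, ht, Finset.mem_image_of_mem _ hy⟩)
      rw [AlgEquiv.mul_apply, AlgEquiv.mul_apply, ← this]
      exact (g₁ * t).symm_apply_apply y
    have hmem : (g₁ * t)⁻¹ * (g₂ * t) ∈ L.fixingSubgroup := by
      rw [IntermediateField.mem_fixingSubgroup_iff]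
      intro y hy
      have h2 : y ∈ Submodule.span F (SL : Set Ω) := hSL ▸ hy
      exact LinearMap.eqOn_span (f := ((g₁ * t)⁻¹ * (g₂ * t)).toLinearMap) (g := LinearMap.id)
        (fun z hz => hfix z (Finset.mem_union_left _ hz)) h2
    refine ⟨⟨_, hmem⟩, rfl, ?_⟩
    have h3 : r (e ⟨_, hmem⟩) = r 1 :=
      hSr _ _ fun y hy => hfix y (Finset.mem_union_right _ hy)
    rw [map_one] at h3
    exact congrArg Units.val h3
  · ext1 g
    exact Units.ext (hΦ g)

end

theorem stmt_11 (p : ℕ) [Fact p.Prime] (hodd : p ≠ 2)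
    (F : Type) [Field F] [NumberField F]
    (ζ : F) (hζ : IsPrimitiveRoot ζ (p ^ 2))
    (ρ : AbsGal F →* GL (Fin 3) (ZMod p))
    (hcont : IsOpen (ρ.ker : Set (AbsGal F))) :
    ∃ ρ₂ : AbsGal F →* GL (Fin 3) (ZMod (p ^ 2)),
      IsOpen (ρ₂.ker : Set (AbsGal F)) ∧
      (Matrix.GeneralLinearGroup.map
        (ZMod.castHom (dvd_pow_self p two_ne_zero) (ZMod p))).comp ρ₂ = ρ := by
  have : CharZero (SeparableClosure F) := charZero_of_injective_algebraMap
    (algebraMap F (SeparableClosure F)).injective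
  have : NeZero (p : SeparableClosure F) :=
    ⟨Nat.cast_ne_zero.mpr (Fact.out : p.Prime).ne_zero⟩
  exact exists_GL_lift hodd hζ (fun x => IsSepClosed.exists_pow_nat_eq x p) ρ hcont
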